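/- arXiv:0904.3350 — 2 statements merged into one kernel-verified Lean document; each statement's English description precedes it below -/
import Mathlib

section
/- Let S ⊆ Z^n × Z_{≥0} be a strongly non-negative semigroup with m(S) = 1 and ind(S) = 1, let H_S(k) = #(S ∩ (Z^n × {k})), and let Δ(S) be its Newton-Okounkov body of dimension q. Then lim_{k→∞} H_S(k)/k^q exists and equals the q-dimensional integral volume of Δ(S). -/
open Filter Topology MeasureTheory

/-- The smallest closed convex cone (with apex at the origin) containing a set `T`. -/
def coneGen {V : Type*} [AddCommGroup V] [Module ℝ V] [TopologicalSpace V]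
    (T : Set V) : Set V :=
  closure {x | ∃ (s : Finset V) (c : V → ℝ),
    (s : Set V) ⊆ T ∧ (∀ v ∈ s, 0 ≤ c v) ∧ x = ∑ v ∈ s, c v • v}

/-- The coercion of an integral point of `ℤ^n × ℤ` into `ℝ^n × ℝ`. -/
def intCastPt {n : ℕ} (p : (Fin n → ℤ) × ℤ) : (Fin n → ℝ) × ℝ :=
  (fun i => (p.1 i : ℝ), (p.2 : ℝ))

/-- The (not necessarily closed) cone generated by a finite set of integral points. -/
def finCone {n : ℕ} (F : Finset ((Fin n → ℤ) × ℤ)) : Set ((Fin n → ℝ) × ℝ) :=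
  {x | ∃ c : (Fin n → ℤ) × ℤ → ℝ, (∀ v ∈ F, 0 ≤ c v) ∧ x = ∑ v ∈ F, c v • intCastPt v}

/-- `intCastPt` as a homomorphism. -/
def intCastHom (n : ℕ) : ((Fin n → ℤ) × ℤ) →+ ((Fin n → ℝ) × ℝ) where
  toFun := intCastPt
  map_zero' := by ext <;> simp [intCastPt]
  map_add' := by intro x y; ext <;> simp [intCastPt]

lemma intCastHom_apply {n : ℕ} (p : (Fin n → ℤ) × ℤ) : intCastHom n p = intCastPt p := rfl

lemma intCastPt_injective {n : ℕ} : Function.Injective (intCastPt (n := n)) := by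
  intro x y h
  simp only [intCastPt, Prod.mk.injEq] at h
  ext i
  · exact_mod_cast congrFun h.1 i
  · exact_mod_cast h.2

lemma finCone_mono {n : ℕ} {F G : Finset ((Fin n → ℤ) × ℤ)} (h : F ⊆ G) :
    finCone F ⊆ finCone G := by
  classical
  rintro x ⟨c, hc, rfl⟩
  refine ⟨fun v => if v ∈ F then c v else 0, ?_, ?_⟩
  · intro v _
    dsimp only
    split_ifs with hv
    · exact hc v hv
    · exact le_rfl
  · rw [← Finset.sum_subset h]
    · exact Finset.sum_congr rfl fun v hv => by simp [hv]
    · intro v _ hv; simp [hv]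

lemma finCone_convex {n : ℕ} (F : Finset ((Fin n → ℤ) × ℤ)) : Convex ℝ (finCone F) := by
  rintro x ⟨c, hc, rfl⟩ y ⟨d, hd, rfl⟩ a b ha hb _
  refine ⟨fun v => a * c v + b * d v, fun v hv => ?_, ?_⟩
  · have := hc v hv
    have := hd v hv
    positivity
  · simp [add_smul, Finset.sum_add_distrib, Finset.smul_sum, mul_smul]

lemma finCone_smul {n : ℕ} (F : Finset ((Fin n → ℤ) × ℤ)) {x : (Fin n → ℝ) × ℝ}
    (hx : x ∈ finCone F) {a : ℝ} (ha : 0 ≤ a) : a • x ∈ finCone F := by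
  obtain ⟨c, hc, rfl⟩ := hx
  exact ⟨fun v => a * c v, fun v hv => mul_nonneg ha (hc v hv), by
    simp [Finset.smul_sum, mul_smul]⟩

lemma coneGen_eq {n : ℕ} (S : Set ((Fin n → ℤ) × ℤ)) :
    coneGen (intCastPt '' S) =
      closure (⋃ F : {F : Finset ((Fin n → ℤ) × ℤ) // (F : Set _) ⊆ S}, finCone F.1) := by
  classical
  unfold coneGen
  congr 1
  ext x
  simp only [Set.mem_ofPred_eq, Set.mem_iUnion, Subtype.exists, exists_prop]
  constructor
  · rintro ⟨s, c, hs, hc, rfl⟩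
    obtain ⟨F, hF, rfl⟩ := Finset.subset_set_image_iff.1 hs
    refine ⟨F, hF, fun v => c (intCastPt v), fun v hv => hc _ (Finset.mem_image_of_mem _ hv), ?_⟩
    rw [Finset.sum_image (fun _ _ _ _ h => intCastPt_injective h)]
  · rintro ⟨F, hF, c, hc, rfl⟩
    refine ⟨F.image intCastPt, fun w => c (Function.invFun intCastPt w), ?_, ?_, ?_⟩
    · rw [Finset.coe_image]; exact Set.image_mono hF
    · intro w hw
      obtain ⟨v, hv, rfl⟩ := Finset.mem_image.1 hw
      dsimp only
      rw [Function.leftInverse_invFun intCastPt_injective v]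
      exact hc v hv
    · rw [Finset.sum_image (fun _ _ _ _ h => intCastPt_injective h)]
      refine Finset.sum_congr rfl fun v _ => ?_
      dsimp only
      rw [Function.leftInverse_invFun intCastPt_injective v]

lemma pos_comb_mem {n : ℕ} {S : Set ((Fin n → ℤ) × ℤ)}
    (hadd : ∀ p ∈ S, ∀ q ∈ S, p + q ∈ S) (F : Finset ((Fin n → ℤ) × ℤ))
    (hF : (F : Set _) ⊆ S) (hne : F.Nonempty) (m : (Fin n → ℤ) × ℤ → ℤ)
    (hm : ∀ v ∈ F, 1 ≤ m v) : ∑ v ∈ F, m v • v ∈ S := by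
  refine Finset.sum_induction_nonempty _ (· ∈ S) (fun a b ha hb => hadd a ha b hb) hne ?_
  intro v hv
  obtain ⟨k, hk⟩ := Int.le.dest (hm v hv)
  rw [← hk]
  clear hk
  induction k with
  | zero => simpa using hF hv
  | succ k ih =>
    have := hadd _ ih _ (hF hv)
    convert this using 1
    push_cast
    module

lemma zonotope_finite {n : ℕ} (F : Finset ((Fin n → ℤ) × ℤ)) :
    {x : (Fin n → ℤ) × ℤ | ∃ c : (Fin n → ℤ) × ℤ → ℝ,
      (∀ v ∈ F, 0 ≤ c v ∧ c v ≤ 1) ∧ intCastPt x = ∑ v ∈ F, c v • intCastPt v}.Finite := by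
  classical
  refine (Set.finite_Icc
    ((fun i => -∑ v ∈ F, |v.1 i|, -∑ v ∈ F, |v.2|) : (Fin n → ℤ) × ℤ)
    (fun i => ∑ v ∈ F, |v.1 i|, ∑ v ∈ F, |v.2|)).subset ?_
  rintro x ⟨c, hc, hx⟩
  have key : ∀ (a : (Fin n → ℤ) × ℤ → ℤ) (t : ℤ), (t : ℝ) = ∑ v ∈ F, c v * (a v : ℝ) →
      |t| ≤ ∑ v ∈ F, |a v| := by
    intro a t h
    have : |(t : ℝ)| ≤ ∑ v ∈ F, |(a v : ℝ)| := by
      rw [h]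
      refine (Finset.abs_sum_le_sum_abs _ _).trans (Finset.sum_le_sum fun v hv => ?_)
      rw [abs_mul, abs_of_nonneg (hc v hv).1]
      exact mul_le_of_le_one_left (abs_nonneg _) (hc v hv).2
    exact_mod_cast this
  have h1 : ∀ i, |x.1 i| ≤ ∑ v ∈ F, |v.1 i| := fun i => key (fun v => v.1 i) _ (by
    have := congrFun (congrArg Prod.fst hx) i
    simpa [intCastPt, Prod.fst_sum, Finset.sum_apply] using this)
  have h2 : |x.2| ≤ ∑ v ∈ F, |v.2| := key (fun v => v.2) _ (by
    have := congrArg Prod.snd hx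
    simpa [intCastPt, Prod.snd_sum] using this)
  exact ⟨⟨fun i => (abs_le.1 (h1 i)).1, (abs_le.1 h2).1⟩,
    ⟨fun i => (abs_le.1 (h1 i)).2, (abs_le.1 h2).2⟩⟩

lemma semigroup_conductor {n : ℕ} {S : Set ((Fin n → ℤ) × ℤ)}
    (hadd : ∀ p ∈ S, ∀ q ∈ S, p + q ∈ S) (hnneg : ∀ p ∈ S, 0 ≤ p.2)
    (F : Finset ((Fin n → ℤ) × ℤ)) (hF : (F : Set _) ⊆ S) (hne : F.Nonempty)
    (hspan : Submodule.span ℤ (F : Set ((Fin n → ℤ) × ℤ)) = ⊤) :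
    ∃ p : (Fin n → ℤ) × ℤ, 0 ≤ p.2 ∧ ∀ y, intCastPt y ∈ finCone F → y + p ∈ S := by
  classical
  have hrep : ∀ x : (Fin n → ℤ) × ℤ, ∃ f : (Fin n → ℤ) × ℤ → ℤ, ∑ v ∈ F, f v • v = x := by
    intro x
    obtain ⟨f, -, hf⟩ := Submodule.mem_span_finset.1 (show x ∈ Submodule.span ℤ (F : Set _) by
      rw [hspan]; trivial)
    exact ⟨f, hf⟩
  choose f hf using hrep
  have hfin := zonotope_finite F
  set D : ℤ := ∑ x ∈ hfin.toFinset, ∑ v ∈ F, |f x v| + 1 with hD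
  have hDpos : 1 ≤ D := by
    have : 0 ≤ ∑ x ∈ hfin.toFinset, ∑ v ∈ F, |f x v| :=
      Finset.sum_nonneg fun _ _ => Finset.sum_nonneg fun _ _ => abs_nonneg _
    omega
  refine ⟨∑ v ∈ F, D • v, hnneg _ (pos_comb_mem hadd F hF hne (fun _ => D) fun _ _ => hDpos), ?_⟩
  rintro y ⟨c, hc, hy⟩
  set x := y - ∑ v ∈ F, ⌊c v⌋ • v with hx
  have hxZ : x ∈ hfin.toFinset := by
    rw [Set.Finite.mem_toFinset]
    refine ⟨fun v => Int.fract (c v), fun v _ => ⟨Int.fract_nonneg _, (Int.fract_lt_one _).le⟩, ?_⟩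
    rw [← intCastHom_apply, hx, map_sub, map_sum, intCastHom_apply, hy, ← Finset.sum_sub_distrib]
    refine Finset.sum_congr rfl fun v _ => ?_
    beta_reduce; rw [map_zsmul, intCastHom_apply, ← Int.self_sub_floor, sub_smul, Int.cast_smul_eq_zsmul]
  have hbound : ∀ v ∈ F, |f x v| + 1 ≤ D := by
    intro v hv
    have h1 : |f x v| ≤ ∑ v ∈ F, |f x v| :=
      Finset.single_le_sum (f := fun v => |f x v|) (fun _ _ => abs_nonneg _) hv
    have h2 : ∑ v ∈ F, |f x v| ≤ ∑ x ∈ hfin.toFinset, ∑ v ∈ F, |f x v| :=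
      Finset.single_le_sum (f := fun x => ∑ v ∈ F, |f x v|)
        (fun _ _ => Finset.sum_nonneg fun _ _ => abs_nonneg _) hxZ
    omega
  have : y + ∑ v ∈ F, D • v = ∑ v ∈ F, (⌊c v⌋ + f x v + D) • v := by
    simp only [add_smul, Finset.sum_add_distrib, hf x]
    rw [hx]
    abel
  rw [this]
  refine pos_comb_mem hadd F hF hne _ fun v hv => ?_
  have h0 : 0 ≤ ⌊c v⌋ := Int.floor_nonneg.2 (hc v hv)
  have := hbound v hv
  have := neg_abs_le (f x v)
  omega

lemma count_tendsto {n : ℕ} (s : Set (Fin n → ℝ)) (hb : Bornology.IsBounded s)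
    (hms : MeasurableSet s) (hc : Convex ℝ s) :
    Tendsto (fun k : ℕ =>
        (Nat.card {y : Fin n → ℤ // (fun i => (y i : ℝ) / k) ∈ s} : ℝ) / (k : ℝ) ^ n)
      atTop (𝓝 (volume.real s)) := by
  have h := tendsto_card_div_pow_atTop_volume s hb hms (hc.addHaar_frontier volume)
  rw [Fintype.card_fin] at h
  refine h.congr' ?_
  filter_upwards [eventually_ge_atTop 1] with k hk
  congr 2
  have hk0 : (k : ℝ) ≠ 0 := by positivity
  symm
  refine Nat.card_congr (Equiv.ofBijective
    (fun y => ⟨fun i => (y.1 i : ℝ) / k, y.2, ?_⟩) ⟨?_, ?_⟩)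
  · refine ⟨fun i => (y.1 i : ℝ), ?_, ?_⟩
    · rw [SetLike.mem_coe, Module.Basis.mem_span_iff_repr_mem]
      intro i; simp
    · ext i; simp; field_simp
  · intro y z hyz
    have hyz := congrArg Subtype.val hyz
    ext i
    have := congrFun hyz i
    simp only at this
    rw [div_left_inj' hk0] at this
    exact_mod_cast this
  · rintro ⟨x, hx, w, hw, rfl⟩
    rw [SetLike.mem_coe, Module.Basis.mem_span_iff_repr_mem] at hw
    simp only [Pi.basisFun_repr] at hw
    choose z hz using hw
    have e : (fun i => (z i : ℝ) / k) = (k : ℝ)⁻¹ • w := by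
      ext i
      have := hz i
      simp at this
      simp [this]; field_simp
    exact ⟨⟨z, by rw [e]; exact hx⟩, Subtype.ext e⟩

lemma count_finite {n : ℕ} (s : Set (Fin n → ℝ)) (hb : Bornology.IsBounded s) (k : ℕ)
    (hk : 1 ≤ k) : Finite {y : Fin n → ℤ // (fun i => (y i : ℝ) / k) ∈ s} := by
  classical
  obtain ⟨R, hR⟩ := hb.exists_norm_le
  refine Set.Finite.to_subtype ((Set.finite_Icc (fun _ : Fin n => -⌈R * k⌉)
    (fun _ => ⌈R * k⌉)).subset ?_)
  intro y hy
  have hk0 : (0 : ℝ) < k := by positivity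
  have : ∀ i, |y i| ≤ ⌈R * k⌉ := by
    intro i
    have h1 := (norm_le_pi_norm _ i).trans (hR _ hy)
    rw [Real.norm_eq_abs, abs_div, abs_of_pos hk0, div_le_iff₀ hk0] at h1
    have : (|y i| : ℝ) ≤ ⌈R * k⌉ := h1.trans (Int.le_ceil _)
    exact_mod_cast this
  exact ⟨fun i => (abs_le.1 (this i)).1, fun i => (abs_le.1 (this i)).2⟩

/-- let `S ⊆ ℤ^n × ℤ_{≥0}` be a strongly non-negative semigroup with
`m(S) = 1` and `ind(S) = 1` (so that the level space `L(S)` is all of `ℝ^{n+1}` and the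
Newton–Okounkov body `Δ(S) = Con(S) ∩ {x_{n+1} = 1}` has dimension `q = n`, the integral
volume being ordinary Lebesgue volume).  Then `H_S(k)/k^n` converges to the
`n`-dimensional volume of `Δ(S)`. -/
theorem stmt12 {n : ℕ} (S : Set ((Fin n → ℤ) × ℤ))
    (hadd : ∀ p ∈ S, ∀ q ∈ S, p + q ∈ S)
    (hnneg : ∀ p ∈ S, 0 ≤ p.2)
    (hpos : ∃ p ∈ S, p.2 ≠ 0)
    (hline : ∀ x ∈ coneGen (intCastPt '' S), -x ∈ coneGen (intCastPt '' S) → x = 0)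
    (hlevel0 : ∀ x ∈ coneGen (intCastPt '' S), x.2 = 0 → x = 0)
    (hm : AddSubgroup.map (AddMonoidHom.snd (Fin n → ℤ) ℤ) (AddSubgroup.closure S) = ⊤)
    (hind : ∀ x : Fin n → ℤ, ((x, 0) : (Fin n → ℤ) × ℤ) ∈ AddSubgroup.closure S) :
    Tendsto (fun k : ℕ =>
        (Nat.card {p : (Fin n → ℤ) × ℤ // p ∈ S ∧ p.2 = (k : ℤ)} : ℝ) / (k : ℝ) ^ n)
      atTop
      (𝓝 ((volume {y : Fin n → ℝ |
        ((y, (1 : ℝ)) : (Fin n → ℝ) × ℝ) ∈ coneGen (intCastPt '' S)}).toReal)) := by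
  classical
  set Kc : Set ((Fin n → ℝ) × ℝ) :=
    ⋃ F : {F : Finset ((Fin n → ℤ) × ℤ) // (F : Set _) ⊆ S}, finCone F.1 with hKc
  have hC : coneGen (intCastPt '' S) = closure Kc := coneGen_eq S
  rw [hC] at hlevel0 ⊢
  clear hline hC
  -- the unclosed cone
  have hdir : Directed (· ⊆ ·)
      (fun F : {F : Finset ((Fin n → ℤ) × ℤ) // (F : Set _) ⊆ S} => finCone F.1) := by
    intro F G
    exact ⟨⟨F.1 ∪ G.1, by rw [Finset.coe_union]; exact Set.union_subset F.2 G.2⟩,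
      finCone_mono Finset.subset_union_left, finCone_mono Finset.subset_union_right⟩
  have hKconv : Convex ℝ Kc := hdir.convex_iUnion fun F => finCone_convex F.1
  have hKsmul : ∀ a : ℝ, 0 ≤ a → ∀ x ∈ Kc, a • x ∈ Kc := by
    intro a ha x hx
    obtain ⟨F, hF⟩ := Set.mem_iUnion.1 hx
    exact Set.mem_iUnion.2 ⟨F, finCone_smul _ hF ha⟩
  have hCsmul : ∀ a : ℝ, 0 ≤ a → ∀ x ∈ closure Kc, a • x ∈ closure Kc := by
    intro a ha x hx
    exact map_mem_closure (continuous_const_smul a) hx (hKsmul a ha)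
  have hSC : ∀ p ∈ S, intCastPt p ∈ closure Kc := by
    intro p hp
    refine subset_closure (Set.mem_iUnion.2 ⟨⟨{p}, by simpa using hp⟩, fun _ => 1, ?_, ?_⟩)
    · intros; exact zero_le_one
    · simp
  have hlin : ∀ {u : Set ((Fin n → ℝ) × ℝ)}, Convex ℝ u →
      Convex ℝ {y : Fin n → ℝ | ((y, (1 : ℝ)) : (Fin n → ℝ) × ℝ) ∈ u} := by
    intro u hu x hx y hy a b ha hb hab
    have := hu hx hy ha hb hab
    simpa [hab] using this
  set Δ : Set (Fin n → ℝ) := {y | ((y, (1 : ℝ)) : (Fin n → ℝ) × ℝ) ∈ closure Kc} with hΔ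
  have hΔconv : Convex ℝ Δ := hlin hKconv.closure
  have hcont : Continuous (fun y : Fin n → ℝ => ((y, (1 : ℝ)) : (Fin n → ℝ) × ℝ)) := by fun_prop
  have hΔclosed : IsClosed Δ := isClosed_closure.preimage hcont
  have hΔbdd : Bornology.IsBounded Δ := by
    have hcomp : IsCompact (closure Kc ∩ Metric.sphere (0 : (Fin n → ℝ) × ℝ) 1) :=
      (isCompact_sphere _ _).inter_left isClosed_closure
    have hδ : ∃ δ > 0, ∀ x ∈ closure Kc ∩ Metric.sphere (0 : (Fin n → ℝ) × ℝ) 1, δ ≤ |x.2| := by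
      rcases (closure Kc ∩ Metric.sphere (0 : (Fin n → ℝ) × ℝ) 1).eq_empty_or_nonempty with he | he
      · exact ⟨1, one_pos, by rw [he]; simp⟩
      · obtain ⟨x, hx, hmin⟩ := hcomp.exists_isMinOn he
          (f := fun x : (Fin n → ℝ) × ℝ => |x.2|) (by fun_prop)
        refine ⟨|x.2|, abs_pos.2 fun h0 => ?_, fun y hy => hmin hy⟩
        have := hlevel0 x hx.1 h0
        have h1 := hx.2
        rw [this] at h1
        simp at h1
    obtain ⟨δ, hδ0, hδ⟩ := hδ
    refine (isBounded_iff_forall_norm_le).2 ⟨δ⁻¹, fun y hy => ?_⟩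
    set z : (Fin n → ℝ) × ℝ := (y, 1) with hz
    have hz1 : 1 ≤ ‖z‖ := by
      have := norm_snd_le z
      simpa [hz] using this
    have hz0 : 0 < ‖z‖ := by linarith
    have := hδ (‖z‖⁻¹ • z) ⟨hCsmul _ (by positivity) _ hy, by
      simp [norm_smul, hz0.ne']⟩
    have h2 : δ ≤ ‖z‖⁻¹ := by
      have e : (‖z‖⁻¹ • z).2 = ‖z‖⁻¹ := by rw [Prod.smul_snd, hz]; simp
      rwa [e, abs_of_pos (inv_pos.2 hz0)] at this
    have h3 : ‖z‖ ≤ δ⁻¹ := (le_inv_comm₀ hδ0 hz0).1 h2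
    exact (norm_fst_le z).trans h3
  -- upper bound
  have hinj : ∀ k : ℕ, 1 ≤ k → ∃ φ : {p : (Fin n → ℤ) × ℤ // p ∈ S ∧ p.2 = (k : ℤ)} →
      {y : Fin n → ℤ // (fun i => (y i : ℝ) / k) ∈ Δ}, Function.Injective φ := by
    intro k hk
    refine ⟨fun p => ⟨p.1.1, ?_⟩, ?_⟩
    · have h := hCsmul (k : ℝ)⁻¹ (by positivity) _ (hSC p.1 p.2.1)
      have hk0 : (k : ℝ) ≠ 0 := by positivity
      have e : (k : ℝ)⁻¹ • intCastPt p.1 = (fun i => (p.1.1 i : ℝ) / k, 1) := by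
        ext i
        · simp [intCastPt]; field_simp
        · simp [intCastPt, p.2.2, hk0]
      rw [e] at h
      exact h
    · intro p q hpq
      have h1 : p.1.1 = q.1.1 := congrArg Subtype.val hpq
      exact Subtype.ext (Prod.ext h1 (p.2.2.trans q.2.2.symm))
  have hfinS : ∀ k : ℕ, 1 ≤ k → Finite {p : (Fin n → ℤ) × ℤ // p ∈ S ∧ p.2 = (k : ℤ)} := by
    intro k hk
    obtain ⟨φ, hφ⟩ := hinj k hk
    have := count_finite Δ hΔbdd k hk
    exact Finite.of_injective φ hφ
  have hup : ∀ k : ℕ, 1 ≤ k →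
      (Nat.card {p : (Fin n → ℤ) × ℤ // p ∈ S ∧ p.2 = (k : ℤ)} : ℝ) / (k : ℝ) ^ n ≤
      (Nat.card {y : Fin n → ℤ // (fun i => (y i : ℝ) / k) ∈ Δ} : ℝ) / (k : ℝ) ^ n := by
    intro k hk
    obtain ⟨φ, hφ⟩ := hinj k hk
    have := count_finite Δ hΔbdd k hk
    have := Nat.card_le_card_of_injective φ hφ
    gcongr
  have hΔlim := count_tendsto Δ hΔbdd hΔclosed.measurableSet hΔconv
  -- finite generating set
  have htop : AddSubgroup.closure S = ⊤ := by
    rw [eq_top_iff]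
    rintro ⟨x, t⟩ -
    have ht : t ∈ AddSubgroup.map (AddMonoidHom.snd (Fin n → ℤ) ℤ) (AddSubgroup.closure S) := by
      rw [hm]; trivial
    obtain ⟨⟨y, t'⟩, hy, rfl⟩ := ht
    have := add_mem hy (hind (x - y))
    simpa using this
  have hspanS : Submodule.span ℤ S = ⊤ := by
    rw [eq_top_iff]
    rintro x -
    have hx : x ∈ AddSubgroup.closure S := by rw [htop]; trivial
    have hle : AddSubgroup.closure S ≤ (Submodule.span ℤ S).toAddSubgroup :=
      (AddSubgroup.closure_le _).2 Submodule.subset_span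
    exact hle hx
  obtain ⟨F₀, hF₀S, hF₀⟩ := (Submodule.fg_span_iff_fg_span_finset_subset S).1
    (by rw [hspanS]; exact Module.Finite.fg_top)
  rw [hspanS] at hF₀
  obtain ⟨p₀, hp₀, -⟩ := hpos
  -- the volume as a supremum
  have hvol : volume Δ ≤ ⨆ F : {F : Finset ((Fin n → ℤ) × ℤ) // (F : Set _) ⊆ S},
      volume {y : Fin n → ℝ | ((y, (1 : ℝ)) : (Fin n → ℝ) × ℝ) ∈ finCone F.1} := by
    rw [← Directed.measure_iUnion]
    · have e : (⋃ F : {F : Finset ((Fin n → ℤ) × ℤ) // (F : Set _) ⊆ S},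
          {y : Fin n → ℝ | ((y, (1 : ℝ)) : (Fin n → ℝ) × ℝ) ∈ finCone F.1}) =
          {y : Fin n → ℝ | ((y, (1 : ℝ)) : (Fin n → ℝ) × ℝ) ∈ Kc} := by
        ext y; simp [hKc]
      rw [e]
      set A := {y : Fin n → ℝ | ((y, (1 : ℝ)) : (Fin n → ℝ) × ℝ) ∈ Kc} with hA
      have hsub : Δ ⊆ closure A := by
        intro y hy
        obtain ⟨u, hu, hlim⟩ := mem_closure_iff_seq_limit.1 hy
        have h1 : Tendsto (fun j => (u j).1) atTop (𝓝 y) := (continuous_fst.tendsto _).comp hlim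
        have h2 : Tendsto (fun j => (u j).2) atTop (𝓝 1) := (continuous_snd.tendsto _).comp hlim
        have h3 : Tendsto (fun j => ((u j).2)⁻¹ • (u j).1) atTop (𝓝 y) := by
          have := (h2.inv₀ one_ne_zero).smul h1
          simpa using this
        refine mem_closure_of_tendsto h3 ?_
        filter_upwards [h2.eventually (lt_mem_nhds (zero_lt_one : (0 : ℝ) < 1))] with j hj
        have := hKsmul ((u j).2)⁻¹ (by positivity) _ (hu j)
        have e : ((u j).2)⁻¹ • u j = (((u j).2)⁻¹ • (u j).1, 1) := by
          ext i
          · simp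
          · simp [hj.ne']
        rw [e] at this
        exact this
      calc volume Δ ≤ volume (closure A) := measure_mono hsub
        _ ≤ volume (A ∪ frontier A) := measure_mono (by
            rw [closure_eq_self_union_frontier])
        _ ≤ volume A + volume (frontier A) := measure_union_le _ _
        _ = volume A := by rw [(hlin hKconv).addHaar_frontier volume, add_zero]
    · intro F G
      obtain ⟨H, h1, h2⟩ := hdir F G
      exact ⟨H, fun y hy => h1 hy, fun y hy => h2 hy⟩
  -- lower bound
  change Tendsto _ _ (𝓝 (volume.real Δ))
  have hΔfin : volume Δ ≠ ⊤ := hΔbdd.measure_lt_top.ne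
  rw [tendsto_order]
  refine ⟨fun c hc => ?_, fun c hc => ?_⟩
  swap
  · filter_upwards [hΔlim.eventually (gt_mem_nhds hc), eventually_ge_atTop 1] with k h1 h2
    exact (hup k h2).trans_lt h1
  by_cases hc0 : c < 0
  · exact Eventually.of_forall fun k => hc0.trans_le (by positivity)
  push Not at hc0
  have hc' : ENNReal.ofReal c < volume Δ := (ENNReal.ofReal_lt_iff_lt_toReal hc0 hΔfin).2 hc
  obtain ⟨G, hG⟩ := lt_iSup_iff.1 (hc'.trans_le hvol)
  set F : Finset ((Fin n → ℤ) × ℤ) := insert p₀ (F₀ ∪ G.1) with hF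
  have hFS : (F : Set ((Fin n → ℤ) × ℤ)) ⊆ S := by
    rw [hF, Finset.coe_insert, Finset.coe_union]
    exact Set.insert_subset hp₀ (Set.union_subset hF₀S G.2)
  have hF₀F : F₀ ⊆ F := Finset.subset_union_left.trans (Finset.subset_insert _ _)
  have hGF : G.1 ⊆ F := Finset.subset_union_right.trans (Finset.subset_insert _ _)
  have hspanF : Submodule.span ℤ (F : Set ((Fin n → ℤ) × ℤ)) = ⊤ := by
    rw [eq_top_iff, hF₀]
    exact Submodule.span_mono (by exact_mod_cast hF₀F)
  obtain ⟨p, hp2, hp⟩ := semigroup_conductor hadd hnneg F hFS ⟨p₀, Finset.mem_insert_self _ _⟩ hspanF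
  set B : Set (Fin n → ℝ) := {y | ((y, (1 : ℝ)) : (Fin n → ℝ) × ℝ) ∈ finCone F} with hB
  have hBconv : Convex ℝ B := hlin (finCone_convex F)
  have hBΔ : B ⊆ Δ := fun y hy => subset_closure (Set.mem_iUnion.2 ⟨⟨F, hFS⟩, hy⟩)
  have hBb : Bornology.IsBounded (interior B) := hΔbdd.subset (interior_subset.trans hBΔ)
  have hcB : c < volume.real (interior B) := by
    have h1 : ENNReal.ofReal c < volume B := hG.trans_le (measure_mono fun y hy => finCone_mono hGF hy)
    have h2 : volume B ≤ volume (interior B) := by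
      calc volume B ≤ volume (interior B ∪ frontier B) := measure_mono (by
            rw [← closure_eq_interior_union_frontier]; exact subset_closure)
        _ ≤ volume (interior B) + volume (frontier B) := measure_union_le _ _
        _ = volume (interior B) := by rw [hBconv.addHaar_frontier volume, add_zero]
    exact (ENNReal.ofReal_lt_iff_lt_toReal hc0 hBb.measure_lt_top.ne).1 (h1.trans_le h2)
  obtain ⟨h, hh⟩ := Int.eq_ofNat_of_zero_le hp2
  have hBlim := count_tendsto (interior B) hBb isOpen_interior.measurableSet hBconv.interior
  have hlow : ∀ j : ℕ, 1 ≤ j →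
      Nat.card {y : Fin n → ℤ // (fun i => (y i : ℝ) / j) ∈ interior B} ≤
      Nat.card {p : (Fin n → ℤ) × ℤ // p ∈ S ∧ p.2 = ((j + h : ℕ) : ℤ)} := by
    intro j hj
    have := hfinS (j + h) (by omega)
    have hj0 : (j : ℝ) ≠ 0 := by positivity
    refine Nat.card_le_card_of_injective
      (fun y => ⟨(y.1, (j : ℤ)) + p, hp _ ?_, ?_⟩) ?_
    · have h1 := finCone_smul F (interior_subset y.2 : _ ∈ B) (a := (j : ℝ)) (by positivity)
      have e : (j : ℝ) • (((fun i => (y.1 i : ℝ) / j), (1 : ℝ)) : (Fin n → ℝ) × ℝ) =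
          intCastPt (y.1, (j : ℤ)) := by
        ext i
        · simp [intCastPt]; field_simp
        · simp [intCastPt]
      rw [e] at h1
      exact h1
    · simp [hh]
    · intro y z hyz
      have := congrArg Subtype.val hyz
      simp only [add_left_inj, Prod.mk.injEq, and_true] at this
      exact Subtype.ext this
  have hratio : Tendsto (fun j : ℕ => ((j : ℝ) / ((j + h : ℕ) : ℝ)) ^ n) atTop (𝓝 1) := by
    have : Tendsto (fun j : ℕ => (j : ℝ) / ((j : ℝ) + (h : ℝ))) atTop (𝓝 1) :=
      tendsto_natCast_div_add_atTop (h : ℝ)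
    simpa using this.pow n
  have hprod := hBlim.mul hratio
  rw [mul_one] at hprod
  have hev := hprod.eventually (lt_mem_nhds hcB)
  suffices hs : ∀ᶠ j : ℕ in atTop, c <
      (Nat.card {p : (Fin n → ℤ) × ℤ // p ∈ S ∧ p.2 = ((j + h : ℕ) : ℤ)} : ℝ) /
        ((j + h : ℕ) : ℝ) ^ n by
    obtain ⟨N, hN⟩ := eventually_atTop.1 hs
    filter_upwards [eventually_ge_atTop (N + h)] with k hk
    have := hN (k - h) (by omega)
    rwa [show k - h + h = k by omega] at this
  filter_upwards [hev, eventually_ge_atTop 1] with j h1 h2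
  refine h1.trans_le ?_
  have hj0 : (j : ℝ) ≠ 0 := by positivity
  rw [div_pow, div_mul_div_cancel₀ (pow_ne_zero n hj0)]
  have := hlow j h2
  gcongr
end

section
/- Let V: (convex bodies in R^n)^n → R be the mixed volume. For convex bodies Δ1, ..., Δn in R^n: V(Δ1, Δ1, Δ3, ..., Δn) · V(Δ2, Δ2, Δ3, ..., Δn) ≤ V(Δ1, Δ2, Δ3, ..., Δn)^2 (the Alexandrov–Fenchel inequality). -/
open Function MeasureTheory
set_option linter.unusedSectionVars false
set_option linter.unusedSimpArgs false


section Multi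

theorem af_polarization {R M : Type*} [CommSemiring R] [AddCommMonoid M] [Module R M] [Module R ℝ]
    {n : ℕ} (F : MultilinearMap R (fun _ : Fin n => M) ℝ)
    (hsym : ∀ (x : Fin n → M) (σ : Equiv.Perm (Fin n)), F (x ∘ σ) = F x) (x : Fin n → M) :
    (n.factorial : ℝ) * F x =
      ∑ U : Finset (Fin n), (-1 : ℝ) ^ U.card * F (fun _ => ∑ k ∈ Uᶜ, x k) := by
  classical
  have h1 : ∀ U : Finset (Fin n), F (fun _ => ∑ k ∈ Uᶜ, x k) =
      ∑ f : Fin n → Fin n, if U ⊆ (Finset.univ.image f)ᶜ then F (x ∘ f) else 0 := by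
    intro U
    rw [F.map_sum_finset (fun _ k => x k) (fun _ => Uᶜ), ← Finset.sum_filter]
    apply Finset.sum_congr
    · ext f
      simp only [Fintype.mem_piFinset, Finset.mem_compl, Finset.mem_filter, Finset.mem_univ,
        true_and, Finset.subset_iff, Finset.mem_image, not_exists]
      constructor
      · intro h a ha b hb
        exact h b (hb ▸ ha)
      · intro h a ha
        exact h ha a rfl
    · intro f _; rfl
  simp_rw [h1, Finset.mul_sum]
  rw [Finset.sum_comm]
  have h2 : ∀ f : Fin n → Fin n, (∑ U : Finset (Fin n), (-1 : ℝ) ^ U.card *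
      (if U ⊆ (Finset.univ.image f)ᶜ then F (x ∘ f) else 0)) =
      if Function.Bijective f then F x else 0 := by
    intro f
    have h3 : (∑ U : Finset (Fin n), (-1 : ℝ) ^ U.card *
      (if U ⊆ (Finset.univ.image f)ᶜ then F (x ∘ f) else 0)) =
      (∑ U ∈ ((Finset.univ.image f)ᶜ).powerset, (-1 : ℝ) ^ U.card) * F (x ∘ f) := by
      rw [Finset.sum_mul]
      simp only [mul_ite, mul_zero]
      rw [← Finset.sum_filter]
      apply Finset.sum_congr _ (fun _ _ => rfl)
      ext U; simp
    have h4 : (∑ U ∈ ((Finset.univ.image f)ᶜ).powerset, (-1 : ℝ) ^ U.card) =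
        if (Finset.univ.image f)ᶜ = ∅ then 1 else 0 := by
      have := Finset.sum_powerset_neg_one_pow_card (x := (Finset.univ.image f)ᶜ)
      exact_mod_cast congrArg (Int.cast : ℤ → ℝ) this
    rw [h3, h4]
    by_cases hb : Function.Bijective f
    · have : (Finset.univ.image f)ᶜ = ∅ := by
        rw [Finset.compl_eq_empty_iff, Finset.image_univ_of_surjective hb.2]
      rw [if_pos this, if_pos hb, one_mul]
      exact hsym x (Equiv.ofBijective f hb)
    · rw [if_neg hb, if_neg, zero_mul]
      intro h
      apply hb
      rw [Finset.compl_eq_empty_iff] at h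
      apply Finite.surjective_iff_bijective.mp
      intro y
      have : y ∈ Finset.univ.image f := by rw [h]; exact Finset.mem_univ y
      simpa using this
  rw [Finset.sum_congr rfl (fun f _ => h2 f), ← Finset.sum_filter, Finset.sum_const, nsmul_eq_mul]
  congr 2
  have : Fintype.card (Equiv.Perm (Fin n)) = n.factorial := by
    rw [Fintype.card_perm, Fintype.card_fin]
  rw [← this, ← Fintype.card_subtype]
  exact Fintype.card_congr (Equiv.ofBijective (fun σ : Equiv.Perm (Fin n) => ⟨σ, σ.bijective⟩)
    ⟨fun a b h => by ext i; simpa using congrFun (congrArg Subtype.val h) i |> congrArg Fin.val,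
     fun f => ⟨Equiv.ofBijective f.1 f.2, rfl⟩⟩)

def afTuple {M : Type*} (n k : ℕ) (x v : M) : Fin n → M := fun j => if (j : ℕ) < k then x else v

theorem af_binomial {R M : Type*} [CommSemiring R] [AddCommMonoid M] [Module R M] [Module R ℝ]
    {n : ℕ} (F : MultilinearMap R (fun _ : Fin n => M) ℝ)
    (hsym : ∀ (x : Fin n → M) (σ : Equiv.Perm (Fin n)), F (x ∘ σ) = F x) (x v : M) (t : R) :
    F (fun _ => v + t • x) = ∑ k ∈ Finset.range (n + 1), n.choose k • (t ^ k • F (afTuple n k x v)) := by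
  classical
  have h0 : (fun _ : Fin n => v + t • x) = (fun _ : Fin n => t • x) + (fun _ => v) := by
    ext; simp [add_comm]
  rw [h0, F.map_add_univ]
  have h1 : ∀ s : Finset (Fin n), F (s.piecewise (fun _ : Fin n => t • x) (fun _ => v)) =
      t ^ s.card • F (afTuple n s.card x v) := by
    intro s
    have h2 : s.piecewise (fun _ : Fin n => t • x) (fun _ => v) =
      s.piecewise (fun i => t • (s.piecewise (fun _ : Fin n => x) (fun _ => v)) i)
        (s.piecewise (fun _ : Fin n => x) (fun _ => v)) := by
      ext i
      by_cases hi : i ∈ s <;> simp [hi]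
    rw [h2, F.map_piecewise_smul (fun _ => t), Finset.prod_const]
    congr 1
    have hc : Fintype.card {i : Fin n // i ∈ s} = Fintype.card {i : Fin n // (i : ℕ) < s.card} := by
      rw [Fintype.card_coe, Fintype.card_subtype]
      have : s.card ≤ n := by simpa using s.card_le_univ
      simp only [Fin.card_filter_val_lt]
      omega
    let e := Fintype.equivOfCardEq hc
    let σ : Equiv.Perm (Fin n) := e.extendSubtype
    rw [← hsym (afTuple n s.card x v) σ]
    congr 1
    ext i
    by_cases hi : i ∈ s
    · have := e.extendSubtype_mem i hi
      simp [hi, afTuple, σ, this]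
    · have := e.extendSubtype_not_mem i hi
      simp only [hi, afTuple, σ, comp, Finset.piecewise, if_false]
      rw [if_neg this]
  rw [Finset.sum_congr rfl (fun s _ => h1 s)]
  have := Finset.sum_powerset_apply_card (x := (Finset.univ : Finset (Fin n))) (fun k => t ^ k • F (afTuple n k x v))
  rw [Finset.powerset_univ] at this
  simpa using this

variable {X : Type*} [NormedAddCommGroup X] [NormedSpace ℝ X]

structure AfCone (C : Set X) : Prop where
  isOpen : IsOpen C
  add : ∀ a ∈ C, ∀ b ∈ C, a + b ∈ C
  smul : ∀ c : ℝ, 0 < c → ∀ a ∈ C, c • a ∈ C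

theorem AfCone.absorb {C : Set X} (hC : AfCone C) {v : X} (hv : v ∈ C) (x : X) :
    ∃ T : ℝ, 0 < T ∧ x + T • v ∈ C := by
  have : Filter.Tendsto (fun s : ℝ => v + s • x) (nhds 0) (nhds v) := by
    have : Continuous (fun s : ℝ => v + s • x) := by fun_prop
    simpa using this.tendsto 0
  have h := this.eventually (hC.isOpen.mem_nhds hv)
  obtain ⟨ε, hε, h⟩ := Metric.eventually_nhds_iff.mp h
  have h1 := h (y := ε / 2) (by simp [abs_of_pos hε]; linarith)
  refine ⟨(ε/2)⁻¹, by positivity, ?_⟩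
  have h2 := hC.smul (ε/2)⁻¹ (by positivity) _ h1
  rw [smul_add, smul_smul, inv_mul_cancel₀ (by positivity), one_smul, add_comm] at h2
  exact h2

theorem AfCone.linExt {C : Set X} (hC : AfCone C) {v : X} (hv : v ∈ C)
    {Y : Type*} [AddCommGroup Y] [Module ℝ Y] (g : X → Y)
    (hadd : ∀ a ∈ C, ∀ b ∈ C, g (a + b) = g a + g b)
    (hsmul : ∀ c : ℝ, 0 < c → ∀ a ∈ C, g (c • a) = c • g a) :
    ∃ L : X →ₗ[ℝ] Y, ∀ a ∈ C, L a = g a := by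
  choose T hT0 hT using hC.absorb hv
  have key : ∀ x (S : ℝ), 0 < S → x + S • v ∈ C →
      g (x + T x • v) - T x • g v = g (x + S • v) - S • g v := by
    intro x S hS hxS
    have h1 : g (x + T x • v) + S • g v = g (x + S • v) + T x • g v := by
      rw [← hsmul S hS v hv, ← hsmul _ (hT0 x) v hv, ← hadd _ (hT x) _ (hC.smul _ hS _ hv),
        ← hadd _ hxS _ (hC.smul _ (hT0 x) _ hv)]
      congr 1; abel
    rw [sub_eq_sub_iff_add_eq_add, h1]
  have hadd' : ∀ x y, g (x + y + T (x + y) • v) - T (x + y) • g v =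
      (g (x + T x • v) - T x • g v) + (g (y + T y • v) - T y • g v) := by
    intro x y
    have h2 : x + y + (T x + T y) • v = (x + T x • v) + (y + T y • v) := by
      rw [add_smul]; abel
    rw [key (x + y) (T x + T y) (add_pos (hT0 x) (hT0 y)) (h2 ▸ hC.add _ (hT x) _ (hT y)),
      h2, hadd _ (hT x) _ (hT y), add_smul]
    abel
  let L0 : X →+ Y := AddMonoidHom.mk' (fun x => g (x + T x • v) - T x • g v) hadd'
  have hpos : ∀ c : ℝ, 0 < c → ∀ x, L0 (c • x) = c • L0 x := by
    intro c hc x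
    change g (c • x + T (c • x) • v) - T (c • x) • g v = c • (g (x + T x • v) - T x • g v)
    have h2 : c • x + (c * T x) • v = c • (x + T x • v) := by
      rw [smul_add, smul_smul]
    rw [key (c • x) (c * T x) (mul_pos hc (hT0 x)) (h2 ▸ hC.smul _ hc _ (hT x)), h2,
      hsmul c hc _ (hT x), smul_sub, smul_smul]
  refine ⟨{ toFun := L0, map_add' := L0.map_add, map_smul' := ?_ }, ?_⟩
  · intro c x
    rcases lt_trichotomy c 0 with h | h | h
    · have := hpos (-c) (by linarith) x
      rw [neg_smul, neg_smul, map_neg] at this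
      simpa using this
    · subst h; simp
    · exact hpos c h x
  · intro a ha
    change g (a + T a • v) - T a • g v = g a
    rw [hadd _ ha _ (hC.smul _ (hT0 a) _ hv), hsmul _ (hT0 a) _ hv]
    abel

theorem AfCone.lin_unique {C : Set X} (hC : AfCone C) {v : X} (hv : v ∈ C)
    {Y : Type*} [AddCommGroup Y] [Module ℝ Y] (L L' : X →ₗ[ℝ] Y) (h : ∀ a ∈ C, L a = L' a) :
    L = L' := by
  ext x
  obtain ⟨T, hT, hx⟩ := hC.absorb hv x
  have h1 := h _ hx
  rw [map_add, map_add, map_smul, map_smul, h v hv] at h1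
  exact add_right_cancel h1

theorem AfCone.multi_unique {C : Set X} (hC : AfCone C) {v : X} (hv : v ∈ C) :
    ∀ {n : ℕ} (M M' : MultilinearMap ℝ (fun _ : Fin n => X) ℝ)
    (_ : ∀ w : Fin n → X, (∀ k, w k ∈ C) → M w = M' w), M = M' := by
  intro n
  induction n with
  | zero =>
    intro M M' h
    ext w
    exact h w (fun k => k.elim0)
  | succ n ih =>
    intro M M' h
    have : M.curryLeft = M'.curryLeft := by
      apply hC.lin_unique hv
      intro a ha
      apply ih
      intro w hw
      simp only [MultilinearMap.curryLeft_apply]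
      apply h
      intro k
      refine Fin.cases ?_ ?_ k
      · simpa using ha
      · intro i; simpa using hw i
    ext w
    have h2 := congrArg (fun L => L (w 0) (Fin.tail w)) this
    simpa using h2

theorem AfCone.multiExt {C : Set X} (hC : AfCone C) {v : X} (hv : v ∈ C) :
    ∀ {n : ℕ} (F : (Fin n → X) → ℝ)
    (_ : ∀ w : Fin n → X, (∀ k, w k ∈ C) → ∀ k, ∀ a ∈ C, ∀ b ∈ C,
      F (update w k (a + b)) = F (update w k a) + F (update w k b))
    (_ : ∀ w : Fin n → X, (∀ k, w k ∈ C) → ∀ k, ∀ c : ℝ, 0 < c → ∀ a ∈ C,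
      F (update w k (c • a)) = c * F (update w k a)),
    ∃ M : MultilinearMap ℝ (fun _ : Fin n => X) ℝ, ∀ w : Fin n → X, (∀ k, w k ∈ C) → M w = F w := by
  intro n
  induction n with
  | zero =>
    intro F _ _
    refine ⟨MultilinearMap.constOfIsEmpty ℝ _ (F Fin.elim0), ?_⟩
    intro w _
    rw [MultilinearMap.constOfIsEmpty_apply, Function.const_apply]
    exact congrArg F (Subsingleton.elim _ _)
  | succ n ih =>
    intro F hadd hsmul
    have hcons : ∀ a ∈ C, ∀ w : Fin n → X, (∀ k, w k ∈ C) →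
        ∀ k, (Fin.cons a w : Fin (n+1) → X) k ∈ C := by
      intro a ha w hw k
      refine Fin.cases ?_ ?_ k
      · simpa using ha
      · intro i; simpa using hw i
    have H : ∀ a ∈ C, ∃ M : MultilinearMap ℝ (fun _ : Fin n => X) ℝ,
        ∀ w : Fin n → X, (∀ k, w k ∈ C) → M w = F (Fin.cons a w) := by
      intro a ha
      apply ih (fun w => F (Fin.cons a w))
      · intro w hw k b hb b' hb'
        have := hadd (Fin.cons a w) (hcons a ha w hw) k.succ b hb b' hb'
        simpa only [Fin.cons_update] using this
      · intro w hw k c hc b hb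
        have := hsmul (Fin.cons a w) (hcons a ha w hw) k.succ c hc b hb
        simpa only [Fin.cons_update] using this
    classical
    choose! Mf hMf using H
    obtain ⟨L, hL⟩ := hC.linExt hv Mf (by
      intro a ha b hb
      apply hC.multi_unique hv
      intro w hw
      rw [add_apply, hMf _ (hC.add a ha b hb) w hw, hMf a ha w hw, hMf b hb w hw]
      have := hadd (Fin.cons a w) (hcons a ha w hw) 0 a ha b hb
      simpa only [Fin.update_cons_zero] using this) (by
      intro c hc a ha
      apply hC.multi_unique hv
      intro w hw
      rw [smul_apply, smul_eq_mul, hMf _ (hC.smul c hc a ha) w hw, hMf a ha w hw]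
      have := hsmul (Fin.cons a w) (hcons a ha w hw) 0 c hc a ha
      simpa only [Fin.update_cons_zero] using this)
    refine ⟨LinearMap.uncurryLeft L, ?_⟩
    intro w hw
    rw [LinearMap.uncurryLeft_apply, hL _ (hw 0), hMf _ (hw 0) (Fin.tail w) (fun k => hw k.succ)]
    congr 1
    exact Fin.cons_self_tail w

theorem AfCone.multi_sym {C : Set X} (hC : AfCone C) {v : X} (hv : v ∈ C) {n : ℕ}
    (M : MultilinearMap ℝ (fun _ : Fin n => X) ℝ)
    (h : ∀ w : Fin n → X, (∀ k, w k ∈ C) → ∀ σ : Equiv.Perm (Fin n), M (w ∘ σ) = M w)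
    (w : Fin n → X) (σ : Equiv.Perm (Fin n)) : M (w ∘ σ) = M w := by
  have : M.domDomCongr σ = M := by
    apply hC.multi_unique hv
    intro w hw
    exact h w hw σ
  have h2 := congrArg (fun L => L w) this
  exact h2

/-- A symmetric multilinear map in at least one variable which vanishes on the diagonal of a cone
vanishes on tuples of elements of the cone. -/
theorem AfCone.multi_diag {C : Set X} (hC : AfCone C) {n : ℕ} (hn : n ≠ 0)
    (M : MultilinearMap ℝ (fun _ : Fin n => X) ℝ)
    (hsym : ∀ (w : Fin n → X) (σ : Equiv.Perm (Fin n)), M (w ∘ σ) = M w)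
    (h : ∀ a ∈ C, M (fun _ => a) = 0) (w : Fin n → X) (hw : ∀ k, w k ∈ C) : M w = 0 := by
  have hp := af_polarization M hsym w
  have : ∀ U : Finset (Fin n), M (fun _ => ∑ k ∈ Uᶜ, w k) = 0 := by
    intro U
    rcases Finset.eq_empty_or_nonempty Uᶜ with hU | hU
    · rw [hU]
      simp only [Finset.sum_empty]
      exact M.map_coord_zero (i := ⟨0, Nat.pos_of_ne_zero hn⟩) rfl
    · apply h
      apply Finset.sum_induction_nonempty w (fun a => a ∈ C) (fun a b ha hb => hC.add a ha b hb) hU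
      intro k _; exact hw k
  simp only [this, mul_zero, Finset.sum_const_zero] at hp
  have hf : (n.factorial : ℝ) ≠ 0 := by exact_mod_cast n.factorial_ne_zero
  exact (mul_eq_zero.mp hp).resolve_left hf

end Multi


section LinAlg

variable {ι : Type*} [Fintype ι]

theorem af_gap [DecidableEq ι] (B : (ι → ℝ) →ₗ[ℝ] (ι → ℝ) →ₗ[ℝ] ℝ) (hs : ∀ x y, B x y = B y x)
    (v : ι → ℝ) (hv : ∀ i, 0 < v i)
    (hp : ∀ i, 0 < B v (Pi.single i 1))
    (hgap : ∀ x, B x x ≤ ∑ i, v i / B v (Pi.single i 1) * (B x (Pi.single i 1)) ^ 2)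
    (hbad : ∃ x, (B x v) ^ 2 < B v v * B x x) :
    ∃ x : ι → ℝ, ‖x‖ = 1 ∧ B x v = 0 ∧ ∑ i, B v (Pi.single i 1) / v i * (x i) ^ 2 ≤ B x x := by
  have hexp : ∀ x y, B x y = ∑ i, y i * B x (Pi.single i 1) := by
    intro x y
    conv_lhs => rw [← Finset.univ_sum_single y]
    rw [map_sum]
    refine Finset.sum_congr rfl fun i _ => ?_
    have : Pi.single i (y i) = y i • (Pi.single i 1 : ι → ℝ) := by
      rw [← Pi.single_smul]; simp
    rw [this, map_smul, smul_eq_mul]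
  set p : ι → ℝ := fun i => B v (Pi.single i 1) with hpdef
  set w : ι → ℝ := fun i => p i / v i with hwdef
  have hw : ∀ i, 0 < w i := fun i => div_pos (hp i) (hv i)
  obtain ⟨x, hx⟩ := hbad
  have hBvv0 : 0 ≤ B v v := by
    rw [hexp]; exact Finset.sum_nonneg fun i _ => mul_nonneg (hv i).le (hp i).le
  have hBvv : 0 < B v v := by
    rcases hBvv0.lt_or_eq with h | h
    · exact h
    · rw [← h] at hx; nlinarith [sq_nonneg (B x v)]
  set x' := x - (B x v / B v v) • v with hx'
  have h1 : B x' v = 0 := by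
    simp only [hx', map_sub, map_smul, LinearMap.sub_apply, LinearMap.smul_apply, smul_eq_mul]
    field_simp; ring
  have h2 : 0 < B x' x' := by
    have : B x' x' = B x x - (B x v)^2 / B v v := by
      simp only [hx', map_sub, map_smul, LinearMap.sub_apply, LinearMap.smul_apply, smul_eq_mul]
      rw [hs v x]; field_simp; ring
    rw [this, sub_pos, div_lt_iff₀ hBvv]; linarith
  -- weighted inner product
  let q : (ι → ℝ) → ℝ := fun y => ∑ i, w i * (y i) ^ 2
  have hq0 : ∀ y, 0 ≤ q y := fun y => Finset.sum_nonneg fun i _ => mul_nonneg (hw i).le (sq_nonneg _)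
  have hqpos : ∀ y, y ≠ 0 → 0 < q y := by
    intro y hy
    obtain ⟨i, hi⟩ := Function.ne_iff.mp hy
    apply Finset.sum_pos' (fun i _ => mul_nonneg (hw i).le (sq_nonneg _))
    exact ⟨i, Finset.mem_univ i, mul_pos (hw i) (by have : y i ≠ 0 := hi; positivity)⟩
  have hqsmul : ∀ (c : ℝ) y, q (c • y) = c ^ 2 * q y := by
    intro c y
    simp only [q, Pi.smul_apply, smul_eq_mul, Finset.mul_sum]
    exact Finset.sum_congr rfl fun i _ => by ring
  have hqc : Continuous q := by
    simp only [q]; fun_prop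
  have hBc : Continuous fun y => B y y := by
    have h3 : (fun y => B y y) = fun y : ι → ℝ => ∑ i, y i * B (Pi.single i 1) y := by
      ext y; rw [hexp]; exact Finset.sum_congr rfl fun i _ => by rw [hs]
    rw [h3]
    refine continuous_finsetSum _ fun i _ => ?_
    exact (continuous_apply i).mul (LinearMap.continuous_of_finiteDimensional _)
  have hBvc : Continuous fun y => B y v := by
    have : (fun y => B y v) = fun y => B v y := by ext y; exact hs y v
    rw [this]
    exact LinearMap.continuous_of_finiteDimensional _
  let K : Set (ι → ℝ) := {y | B y v = 0 ∧ q y = 1}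
  have hKclosed : IsClosed K :=
    (isClosed_eq hBvc continuous_const).inter (isClosed_eq hqc continuous_const)
  have hKb : Bornology.IsBounded K := by
    rw [isBounded_iff_forall_norm_le]
    refine ⟨∑ i, Real.sqrt (1 / w i), ?_⟩
    intro y hy
    rw [pi_norm_le_iff_of_nonneg (Finset.sum_nonneg fun i _ => Real.sqrt_nonneg _)]
    intro i
    refine le_trans ?_ (Finset.single_le_sum (f := fun i => Real.sqrt (1 / w i))
      (fun i _ => Real.sqrt_nonneg _) (Finset.mem_univ i))
    rw [Real.norm_eq_abs]
    apply Real.abs_le_sqrt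
    rw [le_div_iff₀ (hw i), mul_comm, ← hy.2]
    exact Finset.single_le_sum (f := fun i => w i * (y i)^2)
      (fun i _ => mul_nonneg (hw i).le (sq_nonneg _)) (Finset.mem_univ i)
  have hKc : IsCompact K := Metric.isCompact_of_isClosed_isBounded hKclosed hKb
  have hx'0 : x' ≠ 0 := by
    intro h; rw [h] at h2; simp at h2
  have hnorm : ∀ y, y ≠ 0 → B y v = 0 → (Real.sqrt (q y))⁻¹ • y ∈ K := by
    intro y hy hyv
    refine ⟨by simp [hyv], ?_⟩
    rw [hqsmul, inv_pow, Real.sq_sqrt (hq0 y), inv_mul_cancel₀ (hqpos y hy).ne']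
  obtain ⟨x0, hx0K, hmax⟩ := hKc.exists_isMaxOn ⟨_, hnorm x' hx'0 h1⟩ hBc.continuousOn
  set μ := B x0 x0 with hμ
  have hmax' : ∀ y, B y v = 0 → B y y ≤ μ * q y := by
    intro y hyv
    by_cases hy : y = 0
    · subst hy; simp [q]
    have h3 := hmax (hnorm y hy hyv)
    simp only [Set.mem_ofPred_eq, map_smul, LinearMap.smul_apply, smul_eq_mul] at h3
    rw [← mul_assoc, ← mul_inv, Real.mul_self_sqrt (hq0 y), inv_mul_le_iff₀ (hqpos y hy)] at h3
    linarith
  have hμpos : 0 < μ := by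
    have h3 := hmax' x' h1
    by_contra hcon
    nlinarith [hq0 x']
  have hkey : ∀ z, B z v = 0 → B x0 z = μ * ∑ i, w i * x0 i * z i := by
    intro z hz
    set b := B x0 z - μ * ∑ i, w i * x0 i * z i with hb
    have h4 : ∀ s : ℝ, 2 * s * b + s ^ 2 * (B z z - μ * q z) ≤ 0 := by
      intro s
      have h5 := hmax' (x0 + s • z) (by simp [hx0K.1, hz])
      have h6 : q (x0 + s • z) = 1 + 2 * s * ∑ i, w i * x0 i * z i + s ^ 2 * q z := by
        rw [← hx0K.2]
        simp only [q, Pi.add_apply, Pi.smul_apply, smul_eq_mul, Finset.mul_sum,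
          ← Finset.sum_add_distrib]
        exact Finset.sum_congr rfl fun i _ => by ring
      rw [h6] at h5
      simp only [map_add, map_smul, LinearMap.add_apply, LinearMap.smul_apply, smul_eq_mul] at h5
      rw [hs z x0, ← hμ] at h5
      rw [hb]; linarith
    have hb0 : b = 0 := by
      by_contra hne
      set c := B z z - μ * q z
      have h7 := h4 (b / (|c| + 1))
      have hc : 0 < |c| + 1 := by positivity
      have h8 : 2 * (b / (|c| + 1)) * b + (b / (|c| + 1)) ^ 2 * c
        = (b ^ 2 / (|c| + 1) ^ 2) * (2 * (|c| + 1) + c) := by field_simp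
      rw [h8] at h7
      have h9 : 0 < (b ^ 2 / (|c| + 1) ^ 2) := by positivity
      have h10 : 0 < 2 * (|c| + 1) + c := by linarith [neg_abs_le c, abs_nonneg c]
      nlinarith [mul_pos h9 h10]
    linarith
  have hx0v : ∑ i, w i * x0 i * v i = 0 := by
    have : B x0 v = ∑ i, w i * x0 i * v i := by
      rw [hs, hexp]
      refine Finset.sum_congr rfl fun i _ => ?_
      simp only [hwdef, hpdef]
      have := (hv i).ne'
      field_simp
    rw [← this]; exact hx0K.1
  have hall : ∀ y, B x0 y = μ * ∑ i, w i * x0 i * y i := by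
    intro y
    have h3 := hkey (y - (B y v / B v v) • v) (by
      simp only [map_sub, map_smul, LinearMap.sub_apply, LinearMap.smul_apply, smul_eq_mul]
      field_simp; ring)
    have h4 : ∑ i, w i * x0 i * (y - (B y v / B v v) • v) i = ∑ i, w i * x0 i * y i := by
      have : ∑ i, w i * x0 i * (y - (B y v / B v v) • v) i =
        ∑ i, w i * x0 i * y i - (B y v / B v v) * ∑ i, w i * x0 i * v i := by
        rw [Finset.mul_sum, ← Finset.sum_sub_distrib]
        refine Finset.sum_congr rfl fun i _ => ?_
        simp only [Pi.sub_apply, Pi.smul_apply, smul_eq_mul]; ring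
      rw [this, hx0v]; ring
    rw [h4] at h3
    simpa [hx0K.1] using h3
  have hμ1 : 1 ≤ μ := by
    have h3 := hgap x0
    have h4 : ∑ i, v i / B v (Pi.single i 1) * (B x0 (Pi.single i 1)) ^ 2 = μ ^ 2 := by
      have : μ ^ 2 = μ ^ 2 * q x0 := by rw [hx0K.2, mul_one]
      rw [this]
      simp only [q, Finset.mul_sum]
      refine Finset.sum_congr rfl fun i _ => ?_
      rw [hall (Pi.single i 1)]
      have h5 : ∑ j, w j * x0 j * (Pi.single i 1 : ι → ℝ) j = w i * x0 i := by
        simp [Pi.single_apply]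
      rw [h5]
      simp only [hwdef, hpdef]
      have := (hv i).ne'
      have := (hp i).ne'
      field_simp
    rw [h4] at h3
    nlinarith
  have hx00 : x0 ≠ 0 := by
    intro h; have := hx0K.2; rw [h] at this; simp [q] at this
  refine ⟨‖x0‖⁻¹ • x0, ?_, by simp [hx0K.1], ?_⟩
  · rw [norm_smul, norm_inv, norm_norm, inv_mul_cancel₀ (norm_ne_zero_iff.mpr hx00)]
  · have : ∑ i, B v (Pi.single i 1) / v i * ((‖x0‖⁻¹ • x0) i) ^ 2 = q (‖x0‖⁻¹ • x0) := rfl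
    rw [this, hqsmul, hx0K.2]
    simp only [map_smul, LinearMap.smul_apply, smul_eq_mul]
    have : 0 ≤ ‖x0‖⁻¹ := by positivity
    nlinarith [mul_nonneg this this]

theorem af_path [DecidableEq ι] (B : ℝ → (ι → ℝ) →ₗ[ℝ] (ι → ℝ) →ₗ[ℝ] ℝ)
    (hs : ∀ t x y, B t x y = B t y x)
    (hcont : ∀ x y, Continuous fun t => B t x y)
    (v : ι → ℝ) (hv : ∀ i, 0 < v i)
    (hp : ∀ t ∈ Set.Icc (0:ℝ) 1, ∀ i, 0 < B t v (Pi.single i 1))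
    (hgap : ∀ t ∈ Set.Icc (0:ℝ) 1,
      ∀ x, B t x x ≤ ∑ i, v i / B t v (Pi.single i 1) * (B t x (Pi.single i 1)) ^ 2)
    (h0 : ∀ x, B 0 v v * B 0 x x ≤ (B 0 x v) ^ 2) :
    ∀ x, B 1 v v * B 1 x x ≤ (B 1 x v) ^ 2 := by
  have hexp : ∀ t x y, B t x y = ∑ i, ∑ j, x i * (y j * B t (Pi.single i 1) (Pi.single j 1)) := by
    intro t x y
    have h1 : ∀ y : ι → ℝ, y = ∑ i, y i • (Pi.single i 1 : ι → ℝ) := by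
      intro y
      conv_lhs => rw [← Finset.univ_sum_single y]
      refine Finset.sum_congr rfl fun i _ => ?_
      rw [← Pi.single_smul]; simp
    conv_lhs => rw [h1 x, h1 y]
    simp only [map_sum, LinearMap.sum_apply, map_smul, LinearMap.smul_apply, smul_eq_mul]
    simp only [Finset.mul_sum]
    rw [Finset.sum_comm]
    refine Finset.sum_congr rfl fun i _ => Finset.sum_congr rfl fun j _ => ?_
    ring
  have hjc : ∀ f g : ℝ × (ι → ℝ) → (ι → ℝ), Continuous f → Continuous g →
      Continuous fun z : ℝ × (ι → ℝ) => B z.1 (f z) (g z) := by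
    intro f g hf hg
    have h1 : (fun z : ℝ × (ι → ℝ) => B z.1 (f z) (g z)) = fun z => ∑ i, ∑ j, f z i *
        (g z j * B z.1 (Pi.single i 1) (Pi.single j 1)) := by
      ext z; rw [hexp]
    rw [h1]
    refine continuous_finsetSum _ fun i _ => continuous_finsetSum _ fun j _ => ?_
    refine ((continuous_apply i).comp hf).mul (((continuous_apply j).comp hg).mul ?_)
    exact (hcont _ _).comp continuous_fst
  let T : Set ℝ := {t | ∀ x, B t v v * B t x x ≤ (B t x v) ^ 2}
  have hT : IsClosed T := by
    have : T = ⋂ x, {t | B t v v * B t x x ≤ (B t x v) ^ 2} := by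
      ext t; simp [T]
    rw [this]
    exact isClosed_iInter fun x => isClosed_le ((hcont _ _).mul (hcont _ _)) ((hcont _ _).pow 2)
  -- the bad set
  let Z : Set (ℝ × (ι → ℝ)) := (Set.Icc 0 1 ×ˢ Metric.sphere 0 1) ∩
    ({z | B z.1 z.2 v = 0} ∩
      {z | ∑ i, B z.1 v (Pi.single i 1) / v i * (z.2 i) ^ 2 ≤ B z.1 z.2 z.2})
  have hZ : IsCompact Z := by
    apply IsCompact.inter_right
    · exact isCompact_Icc.prod (isCompact_sphere 0 1)
    · apply IsClosed.inter
      · exact isClosed_eq (hjc _ _ continuous_snd continuous_const) continuous_const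
      · apply isClosed_le
        · refine continuous_finsetSum _ fun i _ => ?_
          refine Continuous.mul ?_ (((continuous_apply i).comp continuous_snd).pow 2)
          exact (hjc _ _ continuous_const continuous_const).div_const _
        · exact hjc _ _ continuous_snd continuous_snd
  let N : Set ℝ := Prod.fst '' Z
  have hN : IsClosed N := (hZ.image continuous_fst).isClosed
  have hcover : Set.Icc (0:ℝ) 1 ⊆ T ∪ N := by
    intro t ht
    by_cases h : t ∈ T
    · exact Or.inl h
    · right
      simp only [T, Set.mem_ofPred_eq, not_forall, not_le] at h
      obtain ⟨x, hx1, hx2, hx3⟩ := af_gap (B t) (hs t) v hv (hp t ht) (hgap t ht) h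
      exact ⟨(t, x), ⟨⟨ht, by simpa using hx1⟩, hx2, hx3⟩, rfl⟩
  have hdisj : ∀ t, t ∈ T → t ∈ N → False := by
    rintro t htT ⟨⟨t', x⟩, ⟨⟨ht, hx1⟩, hx2, hx3⟩, rfl⟩
    simp only [mem_sphere_zero_iff_norm] at hx1
    have hx2' : B t' x v = 0 := hx2
    have hx3' : ∑ i, B t' v (Pi.single i 1) / v i * (x i) ^ 2 ≤ B t' x x := hx3
    have h1 : B t' v v * B t' x x ≤ (B t' x v) ^ 2 := htT x
    rw [hx2'] at h1
    have hx0 : x ≠ 0 := by intro h; rw [h] at hx1; simp at hx1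
    obtain ⟨i, hi⟩ := Function.ne_iff.mp hx0
    have hi' : x i ≠ 0 := hi
    have h2 : 0 < ∑ i, B t' v (Pi.single i 1) / v i * (x i) ^ 2 := by
      apply Finset.sum_pos' (fun i _ => mul_nonneg (div_pos (hp t' ht i) (hv i)).le (sq_nonneg _))
      exact ⟨i, Finset.mem_univ i, mul_pos (div_pos (hp t' ht i) (hv i)) (by positivity)⟩
    have h3 : 0 < B t' v v := by
      have h4 : B t' v v = ∑ i, v i * B t' v (Pi.single i 1) := by
        conv_lhs => rw [← Finset.univ_sum_single v]
        rw [Finset.univ_sum_single, ← Finset.univ_sum_single (M := fun _ => ℝ) v, map_sum]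
        refine Finset.sum_congr rfl fun i _ => ?_
        rw [Finset.univ_sum_single]
        have : Pi.single i (v i) = v i • (Pi.single i 1 : ι → ℝ) := by
          rw [← Pi.single_smul]; simp
        rw [this, map_smul, smul_eq_mul]
      rw [h4]
      exact Finset.sum_pos (fun i _ => mul_pos (hv i) (hp t' ht i)) ⟨i, Finset.mem_univ i⟩
    have := mul_pos h3 (lt_of_lt_of_le h2 hx3')
    nlinarith
  have h0T : (0:ℝ) ∈ T := h0
  have h1T : (1:ℝ) ∈ T := by
    by_contra hcon
    have h1N : (1:ℝ) ∈ N := (hcover (by simp)).resolve_left hcon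
    have := (isPreconnected_closed_iff.mp (isPreconnected_Icc (a := (0:ℝ)) (b := 1))) T N hT hN hcover
      ⟨0, by simp, h0T⟩ ⟨1, by simp, h1N⟩
    obtain ⟨t, _, ht1, ht2⟩ := this
    exact hdisj t ht1 ht2
  exact h1T

end LinAlg


section PL
open Set
open scoped Pointwise

theorem pl_compact {K L : Set ℝ} (hK : IsCompact K) (hL : IsCompact L) (hKn : K.Nonempty) (hLn : L.Nonempty)
    {H : Set ℝ} (hH : ∀ x ∈ K, ∀ y ∈ L, (x + y) / 2 ∈ H) : volume K + volume L ≤ 2 * volume H := by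
  obtain ⟨a, ha, hamax⟩ := hK.exists_isGreatest hKn
  obtain ⟨b, hb, hbmin⟩ := hL.exists_isLeast hLn
  have h2 : volume ((fun z : ℝ => 2 * z) '' H) = 2 * volume H := by
    have h3 := Measure.addHaar_smul (volume : Measure ℝ) 2 H
    simp only [Module.finrank_self, pow_one, abs_two] at h3
    have h4 : ((2:ℝ) • H) = (fun z : ℝ => 2 * z) '' H := rfl
    rw [← h4, h3]; simp
  rw [← h2]
  have e1 : volume K = volume ((fun x => x + b) '' K) := by
    rw [image_add_right, measure_preimage_add_right]
  have e2 : volume L = volume ((fun y => a + y) '' L) := by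
    rw [image_add_left, measure_preimage_add]
  have hm2 : MeasurableSet ((fun y => a + y) '' L) := (hL.image (by fun_prop)).measurableSet
  have hd : AEDisjoint volume ((fun x => x + b) '' K) ((fun y => a + y) '' L) := by
    have : ((fun x => x + b) '' K) ∩ ((fun y => a + y) '' L) ⊆ {a + b} := by
      rintro z ⟨⟨x, hx, rfl⟩, ⟨y, hy, hxy⟩⟩
      have := hamax hx
      have := hbmin hy
      simp only [mem_singleton_iff] at *
      linarith
    exact measure_mono_null this (by simp)
  rw [e1, e2, ← measure_union₀ hm2.nullMeasurableSet hd]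
  apply measure_mono
  rintro z (⟨x, hx, rfl⟩ | ⟨y, hy, rfl⟩)
  · exact ⟨_, hH x hx b hb, by ring⟩
  · exact ⟨_, hH a ha y hy, by ring⟩

theorem pl_inner {F : Set ℝ} (hF : MeasurableSet F) (hn : F.Nonempty) {r : ENNReal} (hr : r < volume F) :
    ∃ K ⊆ F, IsCompact K ∧ K.Nonempty ∧ r < volume K := by
  obtain ⟨K, h1, h2, h3⟩ := hF.exists_lt_isCompact hr
  obtain ⟨x, hx⟩ := hn
  exact ⟨insert x K, insert_subset hx h1, h2.insert x, ⟨x, mem_insert _ _⟩,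
    h3.trans_le (measure_mono (subset_insert _ _))⟩

theorem pl_one {F G H : Set ℝ} (hF : MeasurableSet F) (hG : MeasurableSet G) (hFn : F.Nonempty) (hGn : G.Nonempty)
    (hH : ∀ x ∈ F, ∀ y ∈ G, (x + y) / 2 ∈ H) : volume F + volume G ≤ 2 * volume H := by
  obtain ⟨x, hx⟩ := hFn
  obtain ⟨y, hy⟩ := hGn
  have key : ∀ K ⊆ F, IsCompact K → ∀ L ⊆ G, IsCompact L → volume K + volume L ≤ 2 * volume H := by
    intro K hK hKc L hL hLc
    refine le_trans (add_le_add (measure_mono (subset_insert x K)) (measure_mono (subset_insert y L))) ?_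
    refine pl_compact (hKc.insert x) (hLc.insert y) ⟨x, mem_insert _ _⟩ ⟨y, mem_insert _ _⟩ ?_
    intro p hp q hq
    exact hH p (insert_subset hx hK hp) q (insert_subset hy hL hq)
  rw [hF.measure_eq_iSup_isCompact, hG.measure_eq_iSup_isCompact]
  have hne : Nonempty {K : Set ℝ // K ⊆ F ∧ IsCompact K} := ⟨⟨∅, by simp⟩⟩
  have e : ∀ A : Set ℝ, (⨆ K, ⨆ (_ : K ⊆ A), ⨆ (_ : IsCompact K), volume K) =
      ⨆ K : {K : Set ℝ // K ⊆ A ∧ IsCompact K}, volume K.1 := by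
    intro A
    rw [iSup_subtype]
    simp only [iSup_and]
  have hneG : Nonempty {K : Set ℝ // K ⊆ G ∧ IsCompact K} := ⟨⟨∅, by simp⟩⟩
  rw [e, e, ENNReal.iSup_add]
  refine iSup_le fun K => ?_
  rw [ENNReal.add_iSup]
  exact iSup_le fun L => key _ K.2.1 K.2.2 _ L.2.1 L.2.2

theorem pl_real {f g h : ℝ → ℝ} (hf : Measurable f) (hg : Measurable g) (hh : Measurable h)
    (f0 : ∀ x, 0 ≤ f x) (g0 : ∀ x, 0 ≤ g x) (h0 : ∀ x, 0 ≤ h x)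
    (f1 : ∀ x, f x ≤ 1) (g1 : ∀ x, g x ≤ 1)
    (fs : ∀ t < 1, ∃ x, t < f x) (gs : ∀ t < 1, ∃ x, t < g x)
    (H : ∀ t, 0 < t → ∀ x y, t < f x → t < g y → t < h ((x + y) / 2)) :
    (∫⁻ x, ENNReal.ofReal (f x)) + (∫⁻ x, ENNReal.ofReal (g x)) ≤ 2 * ∫⁻ x, ENNReal.ofReal (h x) := by
  rw [lintegral_eq_lintegral_meas_lt _ (.of_forall f0) hf.aemeasurable,
    lintegral_eq_lintegral_meas_lt _ (.of_forall g0) hg.aemeasurable,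
    lintegral_eq_lintegral_meas_lt _ (.of_forall h0) hh.aemeasurable]
  have mf : Measurable fun t => volume {a | t < f a} :=
    Antitone.measurable fun s t hst => measure_mono fun x (hx : t < f x) => lt_of_le_of_lt hst hx
  rw [← lintegral_add_left mf, ← lintegral_const_mul' _ _ (by simp)]
  refine setLIntegral_mono' measurableSet_Ioi fun t ht => ?_
  by_cases h1 : t < 1
  · exact pl_one (measurableSet_lt measurable_const hf) (measurableSet_lt measurable_const hg)
      (fs t h1) (gs t h1) (fun x hx y hy => H t ht x y hx hy)
  · have e1 : {a | t < f a} = ∅ := by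
      ext x; simp only [mem_ofPred_eq, mem_empty_iff_false, iff_false]; intro hx; exact h1 (hx.trans_le (f1 x))
    have e2 : {a | t < g a} = ∅ := by
      ext x; simp only [mem_ofPred_eq, mem_empty_iff_false, iff_false]; intro hx; exact h1 (hx.trans_le (g1 x))
    rw [e1, e2]; simp

theorem pl_amgm (x y z : ENNReal) (h : x + y ≤ 2 * z) : x * y ≤ z ^ 2 := by
  by_cases hz : z = ⊤
  · simp [hz]
  have hxy : x + y ≠ ⊤ := ne_top_of_le_ne_top (by finiteness) h
  obtain ⟨hx, hy⟩ := ENNReal.add_ne_top.1 hxy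
  lift x to NNReal using hx
  lift y to NNReal using hy
  lift z to NNReal using hz
  norm_cast at *
  have h' : (x:ℝ) + y ≤ 2 * z := by exact_mod_cast h
  have : (x:ℝ) * y ≤ z ^ 2 := by nlinarith [sq_nonneg ((x:ℝ) - y), x.2, y.2, z.2, NNReal.coe_nonneg x, NNReal.coe_nonneg y]
  exact_mod_cast this

theorem pl_bdd {f g h : ℝ → ENNReal} (hf : Measurable f) (hg : Measurable g) (hh : Measurable h)
    {N : ENNReal} (hN : N ≠ ⊤) (fN : ∀ x, f x ≤ N) (gN : ∀ x, g x ≤ N)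
    (H : ∀ x y, f x * g y ≤ h ((x + y) / 2) ^ 2) :
    (∫⁻ x, f x) * (∫⁻ x, g x) ≤ (∫⁻ x, h x) ^ 2 := by
  set a := ⨆ x, f x with ha
  set b := ⨆ x, g x with hb
  have hat : a ≠ ⊤ := ne_top_of_le_ne_top hN (iSup_le fN)
  have hbt : b ≠ ⊤ := ne_top_of_le_ne_top hN (iSup_le gN)
  by_cases ha0 : a = 0
  · have : f = 0 := by
      ext x; have := le_iSup f x; rw [← ha, ha0] at this; simpa using this
    simp [this]
  by_cases hb0 : b = 0
  · have : g = 0 := by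
      ext x; have := le_iSup g x; rw [← hb, hb0] at this; simpa using this
    simp [this]
  -- real versions
  obtain ⟨c, hc0, hct, hc⟩ : ∃ c : ENNReal, c ≠ 0 ∧ c ≠ ⊤ ∧ c ^ 2 = a * b := by
    refine ⟨(a * b) ^ (1/2 : ℝ), ?_, ?_, ?_⟩
    · simp [ENNReal.rpow_eq_zero_iff, ha0, hb0, hat, hbt]
    · have : a * b ≠ ⊤ := ENNReal.mul_ne_top hat hbt
      finiteness
    · rw [← ENNReal.rpow_natCast, ← ENNReal.rpow_mul]; norm_num
  have fle : ∀ x, f x / a ≤ 1 := fun x => ENNReal.div_le_of_le_mul (by rw [one_mul]; exact le_iSup f x)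
  have gle : ∀ x, g x / b ≤ 1 := fun x => ENNReal.div_le_of_le_mul (by rw [one_mul]; exact le_iSup g x)
  have key := pl_real (f := fun x => (f x / a).toReal) (g := fun x => (g x / b).toReal)
    (h := fun x => (min (h x / c) 1).toReal)
    (by fun_prop) (by fun_prop) (by fun_prop)
    (fun _ => ENNReal.toReal_nonneg) (fun _ => ENNReal.toReal_nonneg) (fun _ => ENNReal.toReal_nonneg)
    (fun x => by simpa using ENNReal.toReal_mono (by simp) (fle x))
    (fun x => by simpa using ENNReal.toReal_mono (by simp) (gle x))
    (by
      intro t ht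
      by_contra! hcon
      have h1 : a ≤ ENNReal.ofReal t * a := iSup_le fun x => by
        have := (ENNReal.le_ofReal_iff_toReal_le (ne_top_of_le_ne_top (by simp) (fle x))
          (by simpa using (ENNReal.toReal_nonneg).trans (hcon x))).2 (hcon x)
        rwa [ENNReal.div_le_iff ha0 hat] at this
      have h2 : ENNReal.ofReal t < 1 := by simpa using ht
      have h3 : ENNReal.ofReal t * a < 1 * a := ENNReal.mul_lt_mul_left ha0 hat h2
      rw [one_mul] at h3
      exact absurd h1 (not_le.2 h3))
    (by
      intro t ht
      by_contra! hcon
      have h1 : b ≤ ENNReal.ofReal t * b := iSup_le fun x => by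
        have := (ENNReal.le_ofReal_iff_toReal_le (ne_top_of_le_ne_top (by simp) (gle x))
          (by simpa using (ENNReal.toReal_nonneg).trans (hcon x))).2 (hcon x)
        rwa [ENNReal.div_le_iff hb0 hbt] at this
      have h2 : ENNReal.ofReal t < 1 := by simpa using ht
      have h3 : ENNReal.ofReal t * b < 1 * b := ENNReal.mul_lt_mul_left hb0 hbt h2
      rw [one_mul] at h3
      exact absurd h1 (not_le.2 h3))
    (by
      intro t ht x y h1 h2
      rw [← ENNReal.ofReal_lt_iff_lt_toReal ht.le (ne_top_of_le_ne_top (by simp) (fle x))] at h1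
      rw [← ENNReal.ofReal_lt_iff_lt_toReal ht.le (ne_top_of_le_ne_top (by simp) (gle y))] at h2
      rw [← ENNReal.ofReal_lt_iff_lt_toReal ht.le (ne_top_of_le_ne_top (by simp) (min_le_right _ _))]
      refine lt_min ?_ (h1.trans_le (fle x))
      have h3 : ENNReal.ofReal t * ENNReal.ofReal t < (h ((x + y) / 2) / c) ^ 2 := by
        refine (ENNReal.mul_lt_mul h1 h2).trans_le ?_
        rw [ENNReal.div_eq_inv_mul, ENNReal.div_eq_inv_mul, ENNReal.div_eq_inv_mul, mul_pow, ← ENNReal.inv_pow, hc,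
          ENNReal.mul_inv (.inl ha0) (.inl hat)]
        calc a⁻¹ * f x * (b⁻¹ * g y) = a⁻¹ * b⁻¹ * (f x * g y) := by ring
          _ ≤ _ := by gcongr; exact H x y
      rw [← sq] at h3
      exact lt_of_pow_lt_pow_left' 2 h3)
  have ef : ∀ x, ENNReal.ofReal ((f x / a).toReal) = a⁻¹ * f x := fun x => by
    rw [ENNReal.ofReal_toReal (ne_top_of_le_ne_top (by simp) (fle x)), ENNReal.div_eq_inv_mul]
  have eg : ∀ x, ENNReal.ofReal ((g x / b).toReal) = b⁻¹ * g x := fun x => by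
    rw [ENNReal.ofReal_toReal (ne_top_of_le_ne_top (by simp) (gle x)), ENNReal.div_eq_inv_mul]
  have eh : ∀ x, ENNReal.ofReal ((min (h x / c) 1).toReal) ≤ c⁻¹ * h x := fun x => by
    rw [ENNReal.ofReal_toReal (ne_top_of_le_ne_top (by simp) (min_le_right _ _)), ENNReal.div_eq_inv_mul]
    exact min_le_left _ _
  simp only [ef, eg] at key
  have key2 := key.trans (mul_le_mul_right (lintegral_mono eh) 2)
  rw [lintegral_const_mul _ hf, lintegral_const_mul _ hg, lintegral_const_mul _ hh] at key2
  have key3 := pl_amgm _ _ _ key2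
  rw [mul_pow, ← ENNReal.inv_pow, hc] at key3
  have e : a⁻¹ * (∫⁻ x, f x) * (b⁻¹ * ∫⁻ x, g x) = (a*b)⁻¹ * ((∫⁻ x, f x) * ∫⁻ x, g x) := by
    rw [ENNReal.mul_inv (.inl ha0) (.inl hat)]; ring
  rw [e] at key3
  exact (ENNReal.mul_le_mul_iff_right (by simp [hat, hbt, ENNReal.mul_eq_top]) (by simp [ha0, hb0])).1 key3

theorem pl_line {f g h : ℝ → ENNReal} (hf : Measurable f) (hg : Measurable g) (hh : Measurable h)
    (H : ∀ x y, f x * g y ≤ h ((x + y) / 2) ^ 2) :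
    (∫⁻ x, f x) * (∫⁻ x, g x) ≤ (∫⁻ x, h x) ^ 2 := by
  have trunc : ∀ f : ℝ → ENNReal, Measurable f → ∫⁻ x, f x = ⨆ N : ℕ, ∫⁻ x, min (f x) N := by
    intro f hf
    rw [← lintegral_iSup (fun N => by fun_prop)]
    · congr 1; ext x
      refine le_antisymm ?_ (iSup_le fun N => min_le_left _ _)
      rcases eq_or_ne (f x) ⊤ with hx | hx
      · simp [hx, ENNReal.iSup_natCast]
      · obtain ⟨N, hN⟩ := ENNReal.exists_nat_gt hx
        exact le_iSup_of_le N (le_min le_rfl hN.le)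
    · intro N M hNM x
      exact min_le_min le_rfl (by exact_mod_cast hNM)
  rw [trunc f hf, trunc g hg]
  have mono : ∀ f : ℝ → ENNReal, Monotone fun N : ℕ => ∫⁻ x, min (f x) N := by
    intro f N M hNM
    exact lintegral_mono fun x => min_le_min le_rfl (by exact_mod_cast hNM)
  rw [ENNReal.iSup_mul]
  refine iSup_le fun N => ?_
  rw [ENNReal.mul_iSup]
  refine iSup_le fun M => ?_
  refine (mul_le_mul' (mono f (le_max_left N M)) (mono g (le_max_right N M))).trans ?_
  refine pl_bdd (by fun_prop) (by fun_prop) hh (N := ((max N M : ℕ) : ENNReal)) (by simp) (fun x => min_le_right _ _)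
    (fun x => min_le_right _ _) ?_
  intro x y
  exact (mul_le_mul' (min_le_left _ _) (min_le_left _ _)).trans (H x y)

theorem pl_pi : ∀ (n : ℕ) {f g h : (Fin n → ℝ) → ENNReal} (hf : Measurable f) (hg : Measurable g) (hh : Measurable h)
    (H : ∀ x y, f x * g y ≤ h ((1/2:ℝ) • (x + y)) ^ 2),
    (∫⁻ x, f x) * (∫⁻ x, g x) ≤ (∫⁻ x, h x) ^ 2
  | 0, f, g, h, hf, hg, hh, H => by
    have hv : (volume : Measure (Fin 0 → ℝ)) univ = 1 := by
      rw [volume_pi, Measure.pi_of_empty]; simp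
    have hc : ∀ f : (Fin 0 → ℝ) → ENNReal, ∫⁻ x, f x = f 0 := by
      intro f
      have : f = fun _ => f 0 := by ext x; rw [Subsingleton.elim x 0]
      rw [this, lintegral_const, hv, mul_one]
    rw [hc, hc, hc]
    simpa using H 0 0
  | n+1, f, g, h, hf, hg, hh, H => by
    have e := (volume_preserving_piFinSuccAbove (fun _ : Fin (n+1) => ℝ) 0).symm
    have tr : ∀ f : (Fin (n+1) → ℝ) → ENNReal, Measurable f →
        ∫⁻ x, f x = ∫⁻ s : ℝ, ∫⁻ y : Fin n → ℝ, f (Fin.cons s y) := by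
      intro f hf
      rw [← e.lintegral_comp hf]
      rw [show (volume : Measure (ℝ × (Fin n → ℝ))) = volume.prod volume from rfl]
      rw [lintegral_prod _ (by fun_prop)]
      congr 1; ext s; congr 1; ext y
      congr 1
      simp [MeasurableEquiv.piFinSuccAbove, Fin.insertNthEquiv]
    have mcons : Measurable fun p : ℝ × (Fin n → ℝ) => (Fin.cons p.1 p.2 : Fin (n+1) → ℝ) := by
      refine measurable_pi_lambda _ fun i => ?_
      refine Fin.cases ?_ (fun j => ?_) i
      · simpa using measurable_fst
      · simp only [Fin.cons_succ]; fun_prop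
    rw [tr f hf, tr g hg, tr h hh]
    refine pl_line ?_ ?_ ?_ ?_
    · exact (hf.comp mcons).lintegral_prod_right'
    · exact (hg.comp mcons).lintegral_prod_right'
    · exact (hh.comp mcons).lintegral_prod_right'
    intro s t
    refine pl_pi n ?_ ?_ ?_ ?_
    · exact (hf.comp mcons).comp (by fun_prop : Measurable fun y : Fin n → ℝ => (s, y))
    · exact (hg.comp mcons).comp (by fun_prop : Measurable fun y : Fin n → ℝ => (t, y))
    · exact (hh.comp mcons).comp (by fun_prop : Measurable fun y : Fin n → ℝ => ((s+t)/2, y))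
    intro x y
    convert H (Fin.cons s x) (Fin.cons t y) using 3
    ext i
    refine Fin.cases ?_ (fun j => ?_) i
    · simp; ring
    · simp; ring

variable {E : Type*} [NormedAddCommGroup E] [InnerProductSpace ℝ E] [FiniteDimensional ℝ E]
  [MeasurableSpace E] [BorelSpace E]

theorem bm_mid {K L H : Set E} (hK : MeasurableSet K) (hL : MeasurableSet L) (hH : MeasurableSet H)
    (h : ∀ x ∈ K, ∀ y ∈ L, (1/2:ℝ) • (x + y) ∈ H) : volume K * volume L ≤ volume H ^ 2 := by
  let b := stdOrthonormalBasis ℝ E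
  have e := b.measurePreserving_repr_symm.comp (PiLp.volume_preserving_toLp (Fin (Module.finrank ℝ E)))
  set φ : (Fin (Module.finrank ℝ E) → ℝ) → E := b.repr.symm ∘ (WithLp.toLp 2) with hφ
  have hadd : ∀ x y, φ ((1/2:ℝ) • (x + y)) = (1/2:ℝ) • (φ x + φ y) := by
    intro x y
    simp only [hφ, comp_apply, ← map_add, ← map_smul, ← WithLp.toLp_add, ← WithLp.toLp_smul]
  have key := pl_pi _ (f := (φ ⁻¹' K).indicator 1) (g := (φ ⁻¹' L).indicator 1) (h := (φ ⁻¹' H).indicator 1)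
    (measurable_one.indicator (e.measurable hK)) (measurable_one.indicator (e.measurable hL))
    (measurable_one.indicator (e.measurable hH)) (by
      intro x y
      by_cases hx : φ x ∈ K
      · by_cases hy : φ y ∈ L
        · have : (1/2:ℝ) • (x + y) ∈ φ ⁻¹' H := by
            rw [mem_preimage, hadd]; exact h _ hx _ hy
          rw [indicator_of_mem this, indicator_of_mem (s := φ ⁻¹' K) hx, indicator_of_mem (s := φ ⁻¹' L) hy]; simp
        · rw [indicator_of_notMem (s := φ ⁻¹' L) hy]; simp
      · rw [indicator_of_notMem (s := φ ⁻¹' K) hx]; simp)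
  rw [lintegral_indicator_one (e.measurable hK), lintegral_indicator_one (e.measurable hL),
    lintegral_indicator_one (e.measurable hH), e.measure_preimage hK.nullMeasurableSet,
    e.measure_preimage hL.nullMeasurableSet, e.measure_preimage hH.nullMeasurableSet] at key
  exact key
end PL


section MV
open Set
open scoped Pointwise NNReal

variable {E : Type*} [NormedAddCommGroup E] [InnerProductSpace ℝ E] [FiniteDimensional ℝ E]
  [MeasurableSpace E] [BorelSpace E]

/-- A mixed volume functional. -/
structure IsMV {n : ℕ} (V : MultilinearMap ℝ≥0 (fun _ : Fin n => ConvexBody E) ℝ) : Prop where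
  sym : ∀ (x : Fin n → ConvexBody E) (σ : Equiv.Perm (Fin n)), V (x ∘ σ) = V x
  diag : ∀ K : ConvexBody E, V (fun _ => K) = (volume (K : Set E)).toReal

def afPt (a : E) : ConvexBody E := ⟨{a}, convex_singleton a, isCompact_singleton, singleton_nonempty a⟩

theorem afPt_add (a b : E) : afPt (a + b) = afPt a + afPt b := by
  apply ConvexBody.ext
  rw [ConvexBody.coe_add]
  simp [afPt]

theorem afPt_sum {κ : Type*} (s : Finset κ) (a : κ → E) : ∑ k ∈ s, afPt (a k) = afPt (∑ k ∈ s, a k) := by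
  classical
  induction s using Finset.induction_on with
  | empty => simp only [Finset.sum_empty]; apply ConvexBody.ext; simp [afPt]; rfl
  | insert i s hi ih => rw [Finset.sum_insert hi, Finset.sum_insert hi, ih, afPt_add]

theorem vol_add_pt (K : ConvexBody E) (a : E) : volume ((K + afPt a : ConvexBody E) : Set E) = volume (K : Set E) := by
  rw [ConvexBody.coe_add]
  simp [afPt]

variable {n : ℕ} {V : MultilinearMap ℝ≥0 (fun _ : Fin n => ConvexBody E) ℝ}

theorem IsMV.translate (hV : IsMV V) (K : Fin n → ConvexBody E) (a : Fin n → E) :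
    V (fun k => K k + afPt (a k)) = V K := by
  have h1 := af_polarization V hV.sym (fun k => K k + afPt (a k))
  have h2 := af_polarization V hV.sym K
  have : (n.factorial : ℝ) ≠ 0 := by positivity
  apply mul_left_cancel₀ this
  rw [h1, h2]
  refine Finset.sum_congr rfl fun U _ => ?_
  rw [hV.diag, hV.diag, Finset.sum_add_distrib, afPt_sum, vol_add_pt]

theorem sum_near {κ : Type*} (s : Finset κ) (K T : κ → ConvexBody E) (ε : ℝ)
    (hT : ∀ k, ∀ x ∈ T k, ∃ y ∈ K k, ‖x - y‖ ≤ ε) :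
    ∀ x ∈ ∑ k ∈ s, T k, ∃ y ∈ ∑ k ∈ s, K k, ‖x - y‖ ≤ s.card * ε := by
  classical
  induction s using Finset.induction_on with
  | empty => intro x hx; exact ⟨x, by simpa using hx, by simp⟩
  | insert i s hi ih =>
    intro x hx
    rw [Finset.sum_insert hi, ← SetLike.mem_coe, ConvexBody.coe_add, Set.mem_add] at hx
    obtain ⟨p, hp, q, hq, rfl⟩ := hx
    obtain ⟨p', hp', h1⟩ := hT i p hp
    obtain ⟨q', hq', h2⟩ := ih q hq
    refine ⟨p' + q', ?_, ?_⟩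
    · rw [Finset.sum_insert hi, ← SetLike.mem_coe, ConvexBody.coe_add]
      exact add_mem_add hp' hq'
    · rw [Finset.card_insert_of_notMem hi, add_sub_add_comm]
      push_cast
      linarith [norm_add_le (p - p') (q - q')]

theorem sum_sub {κ : Type*} (s : Finset κ) (K T : κ → ConvexBody E)
    (hT : ∀ k, (K k : Set E) ⊆ T k) :
    ((∑ k ∈ s, K k : ConvexBody E) : Set E) ⊆ (∑ k ∈ s, T k : ConvexBody E) := by
  classical
  induction s using Finset.induction_on with
  | empty => simp
  | insert i s hi ih =>
    rw [Finset.sum_insert hi, Finset.sum_insert hi, ConvexBody.coe_add, ConvexBody.coe_add]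
    exact add_subset_add (hT i) ih

theorem vol_tendsto (K : ConvexBody E) (T : ℕ → ConvexBody E) (ε : ℕ → ℝ)
    (hε : Filter.Tendsto ε .atTop (nhds 0)) (h1 : ∀ N, (K : Set E) ⊆ T N)
    (h2 : ∀ N, ∀ x ∈ T N, ∃ y ∈ K, ‖x - y‖ ≤ ε N) :
    Filter.Tendsto (fun N => (volume (T N : Set E)).toReal) .atTop (nhds (volume (K : Set E)).toReal) := by
  have h3 := (tendsto_measure_cthickening_of_isCompact (μ := (volume : Measure E)) K.isCompact).comp hε
  have h4 : Filter.Tendsto (fun N => volume (T N : Set E)) .atTop (nhds (volume (K : Set E))) := by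
    refine tendsto_of_tendsto_of_tendsto_of_le_of_le tendsto_const_nhds h3 (fun N => measure_mono (h1 N))
      (fun N => measure_mono ?_)
    intro x hx
    obtain ⟨y, hy, hxy⟩ := h2 N x hx
    exact Metric.mem_cthickening_of_dist_le x y _ _ hy (by rwa [dist_eq_norm])
  exact (ENNReal.tendsto_toReal K.isCompact.measure_ne_top).comp h4

theorem IsMV.tendsto (hV : IsMV V) (K : Fin n → ConvexBody E) (T : ℕ → Fin n → ConvexBody E) (ε : ℕ → ℝ)
    (hε : Filter.Tendsto ε .atTop (nhds 0)) (h1 : ∀ N k, (K k : Set E) ⊆ T N k)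
    (h2 : ∀ N k, ∀ x ∈ T N k, ∃ y ∈ K k, ‖x - y‖ ≤ ε N) :
    Filter.Tendsto (fun N => V (T N)) .atTop (nhds (V K)) := by
  have hf : (n.factorial : ℝ) ≠ 0 := by positivity
  have key : ∀ x, V x = (n.factorial : ℝ)⁻¹ * ∑ U : Finset (Fin n), (-1 : ℝ) ^ U.card * V (fun _ => ∑ k ∈ Uᶜ, x k) := by
    intro x
    rw [← af_polarization V hV.sym x, inv_mul_cancel_left₀ hf]
  rw [key K]
  simp only [key (T _)]
  refine Filter.Tendsto.const_mul _ (tendsto_finsetSum _ fun U _ => Filter.Tendsto.const_mul _ ?_)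
  simp only [hV.diag]
  refine vol_tendsto _ _ (fun N => (Uᶜ.card : ℝ) * ε N) ?_ (fun N => sum_sub _ _ _ (h1 N))
    (fun N => sum_near _ _ _ _ (h2 N))
  simpa using hε.const_mul (Uᶜ.card : ℝ)

end MV

section descent
open Set
open scoped Pointwise NNReal RealInnerProductSpace

variable {E : Type*} [NormedAddCommGroup E] [InnerProductSpace ℝ E] [FiniteDimensional ℝ E]
  [MeasurableSpace E] [BorelSpace E]

/-- image of a convex body under a continuous linear map -/
noncomputable def afMap {F : Type*} [NormedAddCommGroup F] [NormedSpace ℝ F] {G : Type*} [NormedAddCommGroup G] [NormedSpace ℝ G]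
    (f : F →L[ℝ] G) : ConvexBody F →ₗ[ℝ≥0] ConvexBody G where
  toFun K := ⟨f '' K, K.convex.linear_image f.toLinearMap, K.isCompact.image f.continuous, K.nonempty.image f⟩
  map_add' K L := by
    apply ConvexBody.ext
    simp [ConvexBody.coe_add, image_add]
  map_smul' c K := by
    apply ConvexBody.ext
    simp only [ConvexBody.coe_mk, ConvexBody.coe_smul', RingHom.id_apply]
    ext x
    simp [mem_smul_set, NNReal.smul_def]

noncomputable abbrev afH (u : E) : Submodule ℝ E := (ℝ ∙ u)ᗮ

noncomputable def afSplit (u : E) (p : afH u × ℝ) : E := (p.1 : E) + p.2 • u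

theorem finrank_afH {m : ℕ} {u : E} (hu : ‖u‖ = 1) (hm : Module.finrank ℝ E = m + 1) :
    Module.finrank ℝ (afH u) = m := by
  have hu0 : u ≠ 0 := by rintro rfl; simp at hu
  have : Fact (Module.finrank ℝ E = m + 1) := ⟨hm⟩
  exact Submodule.finrank_orthogonal_span_singleton hu0

theorem afSplit_mp (u : E) (hu : ‖u‖ = 1) : MeasurePreserving (afSplit u) := by
  have hu0 : u ≠ 0 := by rintro rfl; simp at hu
  let L : WithLp 2 (afH u × ℝ) →ₗᵢ[ℝ] E :=
    { toFun := fun p => (p.ofLp.1 : E) + p.ofLp.2 • u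
      map_add' := by intro p q; simp [add_smul]; abel
      map_smul' := by intro c p; simp [mul_smul]
      norm_map' := by
        intro p
        have ho : ⟪(p.ofLp.1 : E), p.ofLp.2 • u⟫ = 0 := by
          rw [real_inner_comm]
          exact p.ofLp.1.2 _ (Submodule.smul_mem _ _ (Submodule.mem_span_singleton_self u))
        have h1 := norm_add_sq_eq_norm_sq_add_norm_sq_of_inner_eq_zero _ _ ho
        have h2 := WithLp.prod_norm_sq_eq_of_L2 p
        have h3 : ‖(p.ofLp.1 : E) + p.ofLp.2 • u‖ ^ 2 = ‖p‖ ^ 2 := by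
          rw [h2, sq, h1]; simp [norm_smul, hu, sq]
        simpa using (sq_eq_sq₀ (norm_nonneg _) (norm_nonneg _)).1 h3 }
  have hfr : Module.finrank ℝ (WithLp 2 (afH u × ℝ)) = Module.finrank ℝ E := by
    rw [LinearEquiv.finrank_eq (WithLp.linearEquiv 2 ℝ (afH u × ℝ)), Module.finrank_prod, Module.finrank_self]
    have h1 := Submodule.finrank_add_finrank_orthogonal (ℝ ∙ u)
    rw [finrank_span_singleton hu0] at h1
    change 1 + Module.finrank ℝ (afH u) = _ at h1
    omega
  have h := (L.toLinearIsometryEquiv hfr).measurePreserving.comp (WithLp.volume_preserving_toLp (afH u) ℝ)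
  exact h

theorem vol_split (u : E) (hu : ‖u‖ = 1) {S : Set E} (hS : MeasurableSet S) :
    volume S = ∫⁻ s : ℝ, volume {y : afH u | (y : E) + s • u ∈ S} := by
  have h := afSplit_mp u hu
  rw [← h.measure_preimage hS.nullMeasurableSet]
  rw [show (volume : Measure (afH u × ℝ)) = volume.prod volume from rfl]
  rw [Measure.prod_apply_symm (h.measurable hS)]
  rfl

theorem af_coeff1 {n : ℕ} (hn : 1 ≤ n) (c : ℕ → ℝ) (a : ℝ)
    (h : ∀ t : ℝ, 0 ≤ t → ∑ k ∈ Finset.range (n+1), c k * t ^ k = a * t) : c 1 = a := by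
  let p : Polynomial ℝ := ∑ k ∈ Finset.range (n+1), Polynomial.C (c k) * Polynomial.X ^ k - Polynomial.C a * Polynomial.X
  have hp : p = 0 := by
    refine Polynomial.eq_zero_of_infinite_isRoot _ (Set.Infinite.mono (s := Ici 0) ?_ (Ici_infinite 0))
    intro t ht
    simp only [mem_ofPred_eq, Polynomial.IsRoot.def, p, Polynomial.eval_sub, Polynomial.eval_finsetSum,
      Polynomial.eval_mul, Polynomial.eval_C, Polynomial.eval_pow, Polynomial.eval_X]
    rw [h t ht]; ring
  have h2 := congrArg (fun q => q.coeff 1) hp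
  simp only [p, Polynomial.coeff_sub, Polynomial.finsetSum_coeff, Polynomial.coeff_C_mul, Polynomial.coeff_X_pow,
    Polynomial.coeff_X, Polynomial.coeff_zero] at h2
  rw [Finset.sum_eq_single_of_mem 1 (by simp; omega)] at h2
  · simp at h2; linarith
  · intro b _ hb; simp [Ne.symm hb]

noncomputable def afSeg (u : E) : ConvexBody E :=
  ⟨segment ℝ 0 u, convex_segment _ _, by
    rw [segment_eq_image]; exact isCompact_Icc.image (by fun_prop), ⟨0, left_mem_segment _ _ _⟩⟩

noncomputable def afIncl (u : E) : ConvexBody (afH u) →ₗ[ℝ≥0] ConvexBody E := afMap (afH u).subtypeL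

noncomputable def afDesc {m : ℕ} (V : MultilinearMap ℝ≥0 (fun _ : Fin (m+1) => ConvexBody E) ℝ) (u : E) :
    MultilinearMap ℝ≥0 (fun _ : Fin m => ConvexBody (afH u)) ℝ :=
  ((m+1 : ℕ) : ℝ≥0) • (V.curryLeft (afSeg u)).compLinearMap (fun _ => afIncl u)

theorem afDesc_apply {m : ℕ} (V : MultilinearMap ℝ≥0 (fun _ : Fin (m+1) => ConvexBody E) ℝ) (u : E)
    (K : Fin m → ConvexBody (afH u)) :
    afDesc V u K = (m+1 : ℝ) * V (Fin.cons (afSeg u) (fun k => afIncl u (K k))) := by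
  simp [afDesc, NNReal.smul_def]

theorem vol_cyl (u : E) (hu : ‖u‖ = 1) (K : ConvexBody (afH u)) (t : ℝ≥0) :
    (volume ((afIncl u K + t • afSeg u : ConvexBody E) : Set E)).toReal = (volume (K : Set (afH u))).toReal * t := by
  rw [vol_split u hu (ConvexBody.isCompact _).measurableSet]
  have : ∀ s : ℝ, volume {y : afH u | (y : E) + s • u ∈ ((afIncl u K + t • afSeg u : ConvexBody E) : Set E)} =
      (Icc (0:ℝ) t).indicator (fun _ => volume (K : Set (afH u))) s := by
    intro s
    have key : ∀ y : afH u, (y : E) + s • u ∈ ((afIncl u K + t • afSeg u : ConvexBody E) : Set E) ↔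
        y ∈ K ∧ s ∈ Icc (0:ℝ) t := by
      intro y
      rw [ConvexBody.coe_add, ConvexBody.coe_smul', Set.mem_add]
      constructor
      · rintro ⟨p, ⟨k, hk, rfl⟩, q, ⟨r, hr, rfl⟩, hpq⟩
        simp only [afSeg, ConvexBody.coe_mk, segment_eq_image, Set.mem_image] at hr
        obtain ⟨θ, hθ, rfl⟩ := hr
        simp only [Submodule.subtypeL_apply, smul_zero, zero_add] at hpq
        have h0 : ∀ z : afH u, ⟪u, (z:E)⟫ = 0 := fun z => z.2 _ (Submodule.mem_span_singleton_self u)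
        have h1 := congrArg (fun z => ⟪u, z⟫) hpq
        simp only [inner_add_right, h0, NNReal.smul_def, inner_smul_right, real_inner_self_eq_norm_sq, hu] at h1
        have hs : s = t * θ := by linarith
        refine ⟨?_, ?_⟩
        · have : k = y := by
            apply Subtype.ext
            rw [hs] at hpq
            simpa [NNReal.smul_def, mul_smul] using hpq
          rw [← this]; exact hk
        · rw [hs]; exact ⟨mul_nonneg t.2 hθ.1, mul_le_of_le_one_right t.2 hθ.2⟩
      · rintro ⟨hy, hs⟩
        refine ⟨y, ⟨y, hy, rfl⟩, s • u, ?_, rfl⟩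
        rcases eq_or_ne t 0 with rfl | ht
        · have : s = 0 := by simpa using hs
          exact ⟨0, left_mem_segment _ _ _, by simp [this]⟩
        · have ht' : (0:ℝ) < t := by positivity
          refine ⟨(s / t) • u, ?_, ?_⟩
          · simp only [afSeg, ConvexBody.coe_mk, segment_eq_image, Set.mem_image]
            exact ⟨s / t, ⟨div_nonneg hs.1 ht'.le, (div_le_one ht').2 hs.2⟩, by simp⟩
          · simp only [NNReal.smul_def, smul_smul]; congr 1; field_simp
    by_cases hs : s ∈ Icc (0:ℝ) t
    · rw [indicator_of_mem hs]; congr 1; ext y; rw [mem_ofPred_eq, key]; simp only [hs, and_true, SetLike.mem_coe]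
    · rw [indicator_of_notMem hs]; convert measure_empty (μ := (volume : Measure (afH u)));
      ext y; rw [mem_ofPred_eq, key]; simp [hs]
  simp only [this]
  rw [lintegral_indicator measurableSet_Icc, setLIntegral_const]
  simp [ENNReal.toReal_mul]

theorem afDesc_isMV {m : ℕ} {V : MultilinearMap ℝ≥0 (fun _ : Fin (m+1) => ConvexBody E) ℝ} (hV : IsMV V) (u : E)
    (hu : ‖u‖ = 1) : IsMV (afDesc V u) where
  sym x σ := by
    rw [afDesc_apply, afDesc_apply]
    congr 1
    let τ : Equiv.Perm (Fin (m+1)) := Equiv.Perm.decomposeFin.symm (0, σ)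
    rw [← hV.sym (Fin.cons (afSeg u) (fun k => afIncl u (x k))) τ]
    congr 1
    ext1 i
    refine Fin.cases ?_ (fun j => ?_) i
    · simp [τ]
    · simp [τ]
  diag K := by
    rw [afDesc_apply]
    have key := af_coeff1 (n := m+1) (by omega)
      (fun k => (m+1).choose k * V (afTuple (m+1) k (afSeg u) (afIncl u K))) (volume (K : Set (afH u))).toReal (by
        intro t ht
        lift t to ℝ≥0 using ht
        rw [← vol_cyl u hu, ← hV.diag, af_binomial V hV.sym]
        refine Finset.sum_congr rfl fun k _ => ?_
        rw [nsmul_eq_mul, NNReal.smul_def]; push_cast; simp; ring)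
    rw [← key]
    simp only [Nat.choose_one_right]
    push_cast
    congr 2
    ext1 i
    refine Fin.cases ?_ (fun j => ?_) i
    · simp [afTuple]
    · simp [afTuple]
end descent


section fan
open Set
open scoped Pointwise NNReal RealInnerProductSpace

variable {E : Type*} [NormedAddCommGroup E] [InnerProductSpace ℝ E] [FiniteDimensional ℝ E]
  [MeasurableSpace E] [BorelSpace E]

/-- A complete fan, given by its unit rays `u` and maximal cones `supp b`, with vertex maps `X b`. -/
structure AfFan (E : Type*) [NormedAddCommGroup E] [InnerProductSpace ℝ E] (ι β : Type*) [Fintype ι] where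
  u : ι → E
  X : β → (ι → ℝ) →ₗ[ℝ] E
  supp : β → Finset ι
  unit : ∀ i, ‖u i‖ = 1
  hX : ∀ b, ∀ i ∈ supp b, ∀ h, ⟪u i, X b h⟫ = h i
  complete : ∀ z : E, ∃ b, ∃ c : ι → ℝ, (∀ i, 0 ≤ c i) ∧ (∀ i, i ∉ supp b → c i = 0) ∧ z = ∑ i, c i • u i
  cover : ∀ i, ∃ b, i ∈ supp b

variable {ι β : Type*} [Fintype ι] [Finite β]

namespace AfFan
variable (F : AfFan E ι β)

def C : Set (ι → ℝ) := {h | (∀ i, 0 < h i) ∧ ∀ b, ∀ j, j ∉ F.supp b → ⟪F.u j, F.X b h⟫ < h j}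

def P (h : ι → ℝ) : Set E := {x | ∀ i, ⟪F.u i, x⟫ ≤ h i}

theorem cont (b : β) : Continuous (F.X b) := LinearMap.continuous_of_finiteDimensional _

theorem isCone : AfCone F.C where
  isOpen := by
    have e : F.C = (⋂ i, {h : ι → ℝ | 0 < h i}) ∩ ⋂ b, ⋂ j, ⋂ (_ : j ∉ F.supp b), {h : ι → ℝ | ⟪F.u j, F.X b h⟫ < h j} := by
      ext h; simp [C]
    rw [e]
    refine IsOpen.inter (isOpen_iInter_of_finite fun i => isOpen_lt continuous_const (continuous_apply i)) ?_
    refine isOpen_iInter_of_finite fun b => isOpen_iInter_of_finite fun j => isOpen_iInter_of_finite fun _ => ?_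
    have := F.cont b
    exact isOpen_lt (by fun_prop) (continuous_apply j)
  add := by
    rintro a ⟨ha, ha'⟩ b ⟨hb, hb'⟩
    refine ⟨fun i => add_pos (ha i) (hb i), fun c j hj => ?_⟩
    rw [map_add, inner_add_right]
    exact add_lt_add (ha' c j hj) (hb' c j hj)
  smul := by
    rintro c hc a ⟨ha, ha'⟩
    refine ⟨fun i => mul_pos hc (ha i), fun b j hj => ?_⟩
    rw [map_smul, inner_smul_right]
    exact mul_lt_mul_of_pos_left (ha' b j hj) hc

variable {F}

theorem X_mem {h : ι → ℝ} (hh : h ∈ F.C) (b : β) : F.X b h ∈ F.P h := by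
  intro i
  by_cases hi : i ∈ F.supp b
  · rw [F.hX b i hi]
  · exact (hh.2 b i hi).le

theorem P_convex (h : ι → ℝ) : Convex ℝ (F.P h) := by
  have : F.P h = ⋂ i, {x | ⟪F.u i, x⟫ ≤ h i} := by ext; simp [P]
  rw [this]
  exact convex_iInter fun i => convex_halfSpace_le (innerₛₗ ℝ (F.u i)).isLinear _

theorem P_closed (h : ι → ℝ) : IsClosed (F.P h) := by
  have : F.P h = ⋂ i, {x | ⟪F.u i, x⟫ ≤ h i} := by ext; simp [P]
  rw [this]
  exact isClosed_iInter fun i => isClosed_le (by fun_prop) continuous_const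

theorem inner_le {h : ι → ℝ} {x z : E} (hx : x ∈ F.P h) {b : β} {c : ι → ℝ} (hc : ∀ i, 0 ≤ c i)
    (hc' : ∀ i, i ∉ F.supp b → c i = 0) (hz : z = ∑ i, c i • F.u i) : ⟪z, x⟫ ≤ ⟪z, F.X b h⟫ := by
  rw [hz, sum_inner, sum_inner]
  refine Finset.sum_le_sum fun i _ => ?_
  rw [inner_smul_left, inner_smul_left]
  by_cases hi : i ∈ F.supp b
  · rw [F.hX b i hi]; exact mul_le_mul_of_nonneg_left (hx i) (by simpa using hc i)
  · simp [hc' i hi]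

theorem P_sub_hull (h : ι → ℝ) : F.P h ⊆ convexHull ℝ (range fun b => F.X b h) := by
  intro x hx
  by_contra hcon
  have hcl : IsClosed (convexHull ℝ (range fun b => F.X b h)) :=
    ((finite_range _).isCompact_convexHull (𝕜 := ℝ)).isClosed
  obtain ⟨f, r, h1, h2⟩ := geometric_hahn_banach_closed_point (convex_convexHull ℝ _) hcl hcon
  obtain ⟨z, hz⟩ := (InnerProductSpace.toDual ℝ E).surjective f
  have hf : ∀ y, f y = ⟪z, y⟫ := by intro y; rw [← hz]; simp
  obtain ⟨b, c, hc, hc', hzz⟩ := F.complete z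
  have h3 := inner_le hx hc hc' hzz
  have h4 := h1 (F.X b h) (subset_convexHull ℝ _ ⟨b, rfl⟩)
  rw [hf] at h2 h4
  linarith

theorem P_eq_hull {h : ι → ℝ} (hh : h ∈ F.C) : F.P h = convexHull ℝ (range fun b => F.X b h) :=
  (P_sub_hull h).antisymm (convexHull_min (by rintro _ ⟨b, rfl⟩; exact X_mem hh b) (P_convex h))

theorem P_compact (h : ι → ℝ) : IsCompact (F.P h) :=
  ((finite_range _).isCompact_convexHull (𝕜 := ℝ)).of_isClosed_subset (P_closed h) (P_sub_hull h)

theorem P_add {g h : ι → ℝ} (hg : g ∈ F.C) (hh : h ∈ F.C) : F.P (g + h) = F.P g + F.P h := by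
  apply Subset.antisymm
  · refine (P_sub_hull _).trans (convexHull_min ?_ ((P_convex g).add (P_convex h)))
    rintro _ ⟨b, rfl⟩
    simp only [map_add]
    exact add_mem_add (X_mem hg b) (X_mem hh b)
  · rintro _ ⟨x, hx, y, hy, rfl⟩ i
    simp only [inner_add_right]
    exact add_le_add (hx i) (hy i)

theorem P_smul (h : ι → ℝ) {c : ℝ} (hc : 0 < c) : F.P (c • h) = c • F.P h := by
  ext x
  rw [mem_smul_set_iff_inv_smul_mem₀ hc.ne']
  simp only [P, mem_ofPred_eq, inner_smul_right, Pi.smul_apply, smul_eq_mul]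
  refine forall_congr' fun i => ?_
  rw [inv_mul_le_iff₀ hc]

variable (F)
def facet (i : ι) (h : ι → ℝ) : Set E := F.P h ∩ {x | ⟪F.u i, x⟫ = h i}

variable {F}
theorem facet_add {g h : ι → ℝ} (hg : g ∈ F.C) (hh : h ∈ F.C) (i : ι) :
    F.facet i (g + h) = F.facet i g + F.facet i h := by
  ext x
  constructor
  · rintro ⟨hx, hxi⟩
    rw [P_add hg hh] at hx
    obtain ⟨y, hy, z, hz, rfl⟩ := hx
    have h1 := hy i
    have h2 := hz i
    simp only [mem_ofPred_eq, inner_add_right, Pi.add_apply] at hxi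
    exact add_mem_add ⟨hy, by simp only [mem_ofPred_eq]; linarith⟩ ⟨hz, by simp only [mem_ofPred_eq]; linarith⟩
  · rintro ⟨y, ⟨hy, hy'⟩, z, ⟨hz, hz'⟩, rfl⟩
    refine ⟨?_, ?_⟩
    · rw [P_add hg hh]; exact add_mem_add hy hz
    · simp only [mem_ofPred_eq, inner_add_right, Pi.add_apply] at *; rw [hy', hz']

theorem facet_smul (h : ι → ℝ) {c : ℝ} (hc : 0 < c) (i : ι) : F.facet i (c • h) = c • F.facet i h := by
  ext x
  rw [mem_smul_set_iff_inv_smul_mem₀ hc.ne', facet, facet, P_smul h hc, mem_inter_iff, mem_inter_iff,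
    mem_smul_set_iff_inv_smul_mem₀ hc.ne']
  simp only [mem_ofPred_eq, inner_smul_right, Pi.smul_apply, smul_eq_mul, inv_mul_eq_iff_eq_mul₀ hc.ne']

theorem facet_nonempty {h : ι → ℝ} (hh : h ∈ F.C) (i : ι) : (F.facet i h).Nonempty := by
  obtain ⟨b, hb⟩ := F.cover i
  exact ⟨F.X b h, X_mem hh b, F.hX b i hb h⟩

theorem facet_compact (h : ι → ℝ) (i : ι) : IsCompact (F.facet i h) :=
  (P_compact h).inter_right (isClosed_eq (by fun_prop) continuous_const)

theorem facet_convex (h : ι → ℝ) (i : ι) : Convex ℝ (F.facet i h) :=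
  (P_convex h).inter (convex_hyperplane (innerₛₗ ℝ (F.u i)).isLinear _)

theorem P_nonempty [Nonempty β] {h : ι → ℝ} (hh : h ∈ F.C) : (F.P h).Nonempty :=
  ⟨_, X_mem hh (Classical.arbitrary β)⟩

variable (F)
open Classical in
noncomputable def body (h : ι → ℝ) : ConvexBody E :=
  if hh : h ∈ F.C then ⟨F.P h, P_convex h, P_compact h, ⟨0, fun i => by simpa using (hh.1 i).le⟩⟩ else 0

open Classical in
noncomputable def face (i : ι) (h : ι → ℝ) : ConvexBody (afH (F.u i)) :=
  if hh : h ∈ F.C then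
    afMap (afH (F.u i)).orthogonalProjectionOnto ⟨F.facet i h, facet_convex h i, facet_compact h i, facet_nonempty hh i⟩
  else 0

variable {F}
theorem body_coe {h : ι → ℝ} (hh : h ∈ F.C) : (F.body h : Set E) = F.P h := by
  rw [body, dif_pos hh]; rfl

theorem face_coe {h : ι → ℝ} (hh : h ∈ F.C) (i : ι) :
    (F.face i h : Set (afH (F.u i))) = (afH (F.u i)).orthogonalProjectionOnto '' F.facet i h := by
  rw [face, dif_pos hh]; rfl

theorem body_add {g h : ι → ℝ} (hg : g ∈ F.C) (hh : h ∈ F.C) : F.body (g + h) = F.body g + F.body h := by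
  apply ConvexBody.ext
  rw [ConvexBody.coe_add, body_coe hg, body_coe hh, body_coe (F.isCone.add g hg h hh), P_add hg hh]

theorem body_smul {h : ι → ℝ} (hh : h ∈ F.C) {c : ℝ} (hc : 0 < c) : F.body (c • h) = c • F.body h := by
  apply ConvexBody.ext
  rw [ConvexBody.coe_smul, body_coe hh, body_coe (F.isCone.smul c hc h hh), P_smul h hc]

theorem face_add {g h : ι → ℝ} (hg : g ∈ F.C) (hh : h ∈ F.C) (i : ι) : F.face i (g + h) = F.face i g + F.face i h := by
  apply ConvexBody.ext
  rw [ConvexBody.coe_add, face_coe hg, face_coe hh, face_coe (F.isCone.add g hg h hh), facet_add hg hh, image_add]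

theorem face_smul {h : ι → ℝ} (hh : h ∈ F.C) {c : ℝ} (hc : 0 < c) (i : ι) : F.face i (c • h) = c • F.face i h := by
  apply ConvexBody.ext
  rw [ConvexBody.coe_smul, face_coe hh, face_coe (F.isCone.smul c hc h hh), facet_smul h hc]
  ext x; simp [mem_smul_set]

theorem inner_H (u : E) (z : afH u) : ⟪u, (z:E)⟫ = 0 := z.2 _ (Submodule.mem_span_singleton_self u)

theorem proj_H (u : E) (z : afH u) (s : ℝ) : (afH u).orthogonalProjectionOnto ((z : E) + s • u) = z := by
  rw [map_add, map_smul, Submodule.orthogonalProjectionOnto_mem_subspace_eq_self]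
  have : (afH u).orthogonalProjectionOnto u = 0 := by
    rw [Submodule.orthogonalProjectionOnto_eq_zero_iff]
    intro y hy
    have := inner_H u ⟨y, hy⟩
    rwa [real_inner_comm]
  rw [this]; simp

theorem decomp_H (u : E) (hu : ‖u‖ = 1) (x : E) : ((afH u).orthogonalProjectionOnto x : E) + ⟪u, x⟫ • u = x := by
  have h1 := Submodule.starProjection_add_starProjection_orthogonal (K := ℝ ∙ u) x
  rw [Submodule.starProjection_unit_singleton ℝ hu] at h1
  rw [add_comm]; exact h1

theorem mem_face {h : ι → ℝ} (hh : h ∈ F.C) (i : ι) (y : afH (F.u i)) :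
    y ∈ (F.face i h : Set (afH (F.u i))) ↔ (y : E) + h i • F.u i ∈ F.P h := by
  rw [face_coe hh]
  constructor
  · rintro ⟨x, ⟨hx, hxi⟩, rfl⟩
    have := decomp_H (F.u i) (F.unit i) x
    rw [hxi] at this
    rw [this]; exact hx
  · intro hy
    refine ⟨_, ⟨hy, ?_⟩, proj_H _ y _⟩
    simp [inner_add_right, inner_smul_right, inner_H, F.unit i]

theorem body_interior {h : ι → ℝ} (hh : h ∈ F.C) : (0 : E) ∈ interior (F.body h : Set E) := by
  rw [body_coe hh, mem_interior]
  refine ⟨⋂ i, {x | ⟪F.u i, x⟫ < h i}, ?_, ?_, ?_⟩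
  · intro x hx i; exact (mem_iInter.1 hx i).le
  · exact isOpen_iInter_of_finite fun i => isOpen_lt (by fun_prop) continuous_const
  · simp only [mem_iInter, mem_ofPred_eq, inner_zero_right]; exact hh.1

theorem face_interior {h : ι → ℝ} (hh : h ∈ F.C) (i : ι) : (interior (F.face i h : Set (afH (F.u i)))).Nonempty := by
  classical
  obtain ⟨b, hb⟩ := F.cover i
  let g : ℝ → (ι → ℝ) := fun δ j => if j = i then h i else h j - δ
  have hg : Continuous g := by
    refine continuous_pi fun j => ?_
    by_cases hj : j = i <;> simp only [g, hj, if_true, if_false] <;> fun_prop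
  have hX : Continuous fun δ => F.X b (g δ) := (F.cont b).comp hg
  have g0 : g 0 = h := by ext j; by_cases hj : j = i <;> simp [g, hj]
  have h1 : ∀ᶠ δ in nhds (0:ℝ), ∀ j, j ∉ F.supp b → ⟪F.u j, F.X b (g δ)⟫ < h j := by
    rw [Filter.eventually_all]
    intro j
    by_cases hj : j ∈ F.supp b
    · simp [hj]
    · simp only [hj, not_false_eq_true, true_imp_iff]
      have : Continuous fun δ => ⟪F.u j, F.X b (g δ)⟫ := by fun_prop
      refine this.continuousAt.eventually (gt_mem_nhds ?_) 
      simp only [g0]; exact hh.2 b j hj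
  have h2 : ∃ᶠ δ in nhds (0:ℝ), 0 < δ := by
    exact (frequently_gt_nhds (0:ℝ))
  obtain ⟨δ, hδ0, hδ⟩ := (h2.and_eventually h1).exists
  set x := F.X b (g δ)
  have hxi : ⟪F.u i, x⟫ = h i := by rw [F.hX b i hb]; simp [g]
  have hxj : ∀ j, j ≠ i → ⟪F.u j, x⟫ < h j := by
    intro j hj
    by_cases hjb : j ∈ F.supp b
    · rw [F.hX b j hjb]; simp [g, hj, hδ0]
    · exact hδ j hjb
  refine ⟨(afH (F.u i)).orthogonalProjectionOnto x, ?_⟩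
  rw [mem_interior]
  refine ⟨⋂ j, {y : afH (F.u i) | j ≠ i → ⟪F.u j, (y:E) + h i • F.u i⟫ < h j}, ?_, ?_, ?_⟩
  · intro y hy
    rw [mem_face hh]
    intro j
    by_cases hj : j = i
    · subst hj; simp [inner_add_right, inner_smul_right, inner_H, F.unit j]
    · exact (mem_iInter.1 hy j hj).le
  · refine isOpen_iInter_of_finite fun j => ?_
    by_cases hj : j = i
    · simp [hj]
    · simp only [ne_eq, hj, not_false_eq_true, true_imp_iff]
      exact isOpen_lt (by fun_prop) continuous_const
  · simp only [mem_iInter, mem_ofPred_eq]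
    intro j hj
    have := decomp_H (F.u i) (F.unit i) x
    rw [hxi] at this
    rw [this]; exact hxj j hj

end AfFan
end fan


section deriv
open Set
open scoped Pointwise NNReal RealInnerProductSpace

variable {E : Type*} [NormedAddCommGroup E] [InnerProductSpace ℝ E] [FiniteDimensional ℝ E]
  [MeasurableSpace E] [BorelSpace E]
variable {ι β : Type*} [Fintype ι] [Finite β]

namespace AfFan
variable {F : AfFan E ι β}

theorem facet_volume [DecidableEq ι] {h : ι → ℝ} (i : ι) {t : ℝ} (ht : 0 ≤ t)
    (hs : ∀ s ∈ Icc 0 t, h + s • Pi.single i 1 ∈ F.C) :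
    volume (F.P (h + t • Pi.single i 1)) = volume (F.P h) +
      ∫⁻ s in Ioc 0 t, volume (F.face i (h + s • Pi.single i 1) : Set (afH (F.u i))) := by
  set h' := h + t • (Pi.single i 1 : ι → ℝ) with hh'
  have hi : ∀ s : ℝ, (h + s • (Pi.single i 1 : ι → ℝ)) i = h i + s := by intro s; simp
  have hj : ∀ s : ℝ, ∀ j, j ≠ i → (h + s • (Pi.single i 1 : ι → ℝ)) j = h j := by intro s j hj; simp [hj]
  have e : F.P h' = F.P h ∪ (F.P h' ∩ {x | h i < ⟪F.u i, x⟫}) := by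
    ext x
    constructor
    · intro hx
      by_cases hxi : h i < ⟪F.u i, x⟫
      · exact Or.inr ⟨hx, hxi⟩
      · left
        intro j
        by_cases hji : j = i
        · subst hji; exact not_lt.1 hxi
        · have := hx j; rwa [hh', hj t j hji] at this
    · rintro (hx | hx)
      · intro j
        by_cases hji : j = i
        · subst hji; rw [hh', hi]; linarith [hx j]
        · rw [hh', hj t j hji]; exact hx j
      · exact hx.1
  have hm : MeasurableSet (F.P h' ∩ {x | h i < ⟪F.u i, x⟫}) :=
    (P_closed h').measurableSet.inter (isOpen_lt continuous_const (by fun_prop)).measurableSet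
  have hd : Disjoint (F.P h) (F.P h' ∩ {x | h i < ⟪F.u i, x⟫}) := by
    rw [Set.disjoint_left]
    rintro x hx ⟨_, hx'⟩
    exact absurd (hx i) (not_le.2 hx')
  rw [e, measure_union hd hm]
  congr 1
  rw [vol_split (F.u i) (F.unit i) hm]
  rw [← lintegral_indicator measurableSet_Ioc, ← lintegral_add_left_eq_self _ (h i)]
  congr 1
  ext s
  have hin : ∀ y : afH (F.u i), ⟪F.u i, (y : E) + (h i + s) • F.u i⟫ = h i + s := by
    intro y; simp [inner_add_right, inner_smul_right, inner_H, F.unit i]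
  by_cases hst : s ∈ Ioc 0 t
  · rw [indicator_of_mem hst]
    congr 1
    ext y
    have hC := hs s ⟨hst.1.le, hst.2⟩
    rw [mem_face hC, hi]
    simp only [mem_ofPred_eq, mem_inter_iff, hin]
    constructor
    · rintro ⟨h1, h2⟩ j
      by_cases hji : j = i
      · subst hji; rw [hin, hi]
      · have := h1 j; rw [hj s j hji]; rwa [hh', hj t j hji] at this
    · intro h1
      refine ⟨fun j => ?_, by linarith [hst.1]⟩
      by_cases hji : j = i
      · subst hji; rw [hin, hh', hi]; linarith [hst.2]
      · have := h1 j; rw [hh', hj t j hji]; rwa [hj s j hji] at this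
  · rw [indicator_of_notMem hst]
    convert measure_empty (μ := (volume : Measure (afH (F.u i))))
    ext y
    simp only [mem_ofPred_eq, mem_inter_iff, hin, mem_empty_iff_false, iff_false]
    rintro ⟨h1, h2⟩
    apply hst
    refine ⟨by linarith, ?_⟩
    have := h1 i
    rw [hin, hh', hi] at this; linarith

variable {m : ℕ} {V : MultilinearMap ℝ≥0 (fun _ : Fin (m+1) => ConvexBody E) ℝ}

theorem exists_M {n : ℕ} {V : MultilinearMap ℝ≥0 (fun _ : Fin n => ConvexBody E) ℝ} (hV : IsMV V) {v : ι → ℝ} (hv : v ∈ F.C) :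
    ∃ M : MultilinearMap ℝ (fun _ : Fin n => ι → ℝ) ℝ,
      (∀ w : Fin n → ι → ℝ, (∀ k, w k ∈ F.C) → M w = V (fun k => F.body (w k))) ∧
      (∀ (w : Fin n → ι → ℝ) (σ : Equiv.Perm (Fin n)), M (w ∘ σ) = M w) := by
  have hu : ∀ (w : Fin n → ι → ℝ) k a, (fun j => F.body (update w k a j)) = update (fun j => F.body (w j)) k (F.body a) := by
    intro w k a; ext1 j; by_cases hj : j = k
    · subst hj; simp
    · simp [hj]
  obtain ⟨M, hM⟩ := F.isCone.multiExt hv (fun w => V (fun k => F.body (w k)))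
    (by
      intro w hw k a ha b hb
      simp only [hu, body_add ha hb, V.map_update_add])
    (by
      intro w hw k c hc a ha
      simp only [hu, body_smul ha hc]
      have := V.map_update_smul (fun j => F.body (w j)) k ⟨c, hc.le⟩ (F.body a)
      exact this)
  refine ⟨M, hM, F.isCone.multi_sym hv M ?_⟩
  intro w hw σ
  rw [hM w hw, hM (w ∘ σ) (fun k => hw _)]
  exact hV.sym (fun k => F.body (w k)) σ

theorem exists_D {m : ℕ} (i : ι) {V : MultilinearMap ℝ≥0 (fun _ : Fin m => ConvexBody (afH (F.u i))) ℝ} (hV : IsMV V) {v : ι → ℝ} (hv : v ∈ F.C) :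
    ∃ M : MultilinearMap ℝ (fun _ : Fin m => ι → ℝ) ℝ,
      (∀ w : Fin m → ι → ℝ, (∀ k, w k ∈ F.C) → M w = V (fun k => F.face i (w k))) ∧
      (∀ (w : Fin m → ι → ℝ) (σ : Equiv.Perm (Fin m)), M (w ∘ σ) = M w) := by
  have hu : ∀ (w : Fin m → ι → ℝ) k a, (fun j => F.face i (update w k a j)) = update (fun j => F.face i (w j)) k (F.face i a) := by
    intro w k a; ext1 j; by_cases hj : j = k
    · subst hj; simp
    · simp [hj]
  obtain ⟨M, hM⟩ := F.isCone.multiExt hv (fun w => V (fun k => F.face i (w k)))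
    (by
      intro w hw k a ha b hb
      simp only [hu, face_add ha hb, V.map_update_add])
    (by
      intro w hw k c hc a ha
      simp only [hu, face_smul ha hc]
      have := V.map_update_smul (fun j => F.face i (w j)) k ⟨c, hc.le⟩ (F.face i a)
      exact this)
  refine ⟨M, hM, F.isCone.multi_sym hv M ?_⟩
  intro w hw σ
  rw [hM w hw, hM (w ∘ σ) (fun k => hw _)]
  exact hV.sym (fun k => F.face i (w k)) σ

theorem hasDeriv_multi {n : ℕ} (M : MultilinearMap ℝ (fun _ : Fin (n+1) => ι → ℝ) ℝ)
    (hM : ∀ (w : Fin (n+1) → ι → ℝ) (σ : Equiv.Perm (Fin (n+1))), M (w ∘ σ) = M w) (x v : ι → ℝ) :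
    HasDerivAt (fun t : ℝ => M (fun _ => v + t • x)) ((n+1 : ℝ) * M (Fin.cons x (fun _ => v))) 0 := by
  simp only [af_binomial M hM]
  have : ∀ k ∈ Finset.range (n+1+1), HasDerivAt (fun t : ℝ => (n+1).choose k • (t ^ k • M (afTuple (n+1) k x v)))
      (if k = 1 then ((n+1 : ℝ) * M (Fin.cons x (fun _ => v))) else 0) 0 := by
    intro k _
    have h := ((hasDerivAt_pow k (0:ℝ)).mul_const (M (afTuple (n+1) k x v))).const_mul ((n+1).choose k : ℝ)
    simp only [smul_eq_mul, nsmul_eq_mul]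
    refine h.congr_deriv ?_
    rcases k with _ | _ | k
    · simp
    · have : (afTuple (n+1) 1 x v) = Fin.cons x (fun _ => v) := by
        ext1 j; refine Fin.cases ?_ (fun j => ?_) j <;> simp [afTuple]
      simp [this]
    · simp
  have h2 := HasDerivAt.fun_sum this
  refine h2.congr_deriv ?_
  rw [Finset.sum_ite_eq' (Finset.range (n+1+1)) 1]; simp

theorem diag_formula [DecidableEq ι] (hV : IsMV V) {i : ι} {h : ι → ℝ} (hh : h ∈ F.C)
    (M : MultilinearMap ℝ (fun _ : Fin (m+1) => ι → ℝ) ℝ)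
    (hM : ∀ w : Fin (m+1) → ι → ℝ, (∀ k, w k ∈ F.C) → M w = V (fun k => F.body (w k)))
    (hMs : ∀ (w : Fin (m+1) → ι → ℝ) (σ : Equiv.Perm (Fin (m+1))), M (w ∘ σ) = M w)
    (D : MultilinearMap ℝ (fun _ : Fin m => ι → ℝ) ℝ)
    (hD : ∀ w : Fin m → ι → ℝ, (∀ k, w k ∈ F.C) → D w = afDesc V (F.u i) (fun k => F.face i (w k)))
    (hDs : ∀ (w : Fin m → ι → ℝ) (σ : Equiv.Perm (Fin m)), D (w ∘ σ) = D w) :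
    (m+1 : ℝ) * M (Fin.cons (Pi.single i 1) (fun _ => h)) = D (fun _ => h) := by
  set e : ι → ℝ := Pi.single i 1 with he
  have hVH := afDesc_isMV hV (F.u i) (F.unit i)
  -- neighbourhood
  obtain ⟨ε, hε, hball⟩ : ∃ ε > 0, ∀ s ∈ Icc (0:ℝ) ε, h + s • e ∈ F.C := by
    have hc : Continuous fun s : ℝ => h + s • e := by fun_prop
    have : ∀ᶠ s in nhds (0:ℝ), h + s • e ∈ F.C :=
      hc.continuousAt.eventually (F.isCone.isOpen.mem_nhds (by simpa using hh))
    obtain ⟨ε, hε, h1⟩ := Metric.eventually_nhds_iff.1 this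
    refine ⟨ε / 2, by positivity, fun s hs => h1 ?_⟩
    rw [dist_zero_right, Real.norm_eq_abs, abs_of_nonneg hs.1]; linarith [hs.2]
  have hDc : Continuous fun s : ℝ => D (fun _ => h + s • e) := by
    simp only [af_binomial D hDs, smul_eq_mul, nsmul_eq_mul]
    fun_prop
  have hvolM : ∀ s ∈ Icc (0:ℝ) ε, M (fun _ => h + s • e) = (volume (F.P (h + s • e))).toReal := by
    intro s hs
    rw [hM _ (fun _ => hball s hs), hV.diag, body_coe (hball s hs)]
  have hvolD : ∀ s ∈ Icc (0:ℝ) ε, D (fun _ => h + s • e) = (volume (F.face i (h + s • e) : Set (afH (F.u i)))).toReal := by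
    intro s hs
    rw [hD _ (fun _ => hball s hs), hVH.diag]
  have key : ∀ t ∈ Icc (0:ℝ) ε, M (fun _ => h + t • e) = M (fun _ => h) + ∫ s in (0:ℝ)..t, D (fun _ => h + s • e) := by
    intro t ht
    have hsub : ∀ s ∈ Icc (0:ℝ) t, s ∈ Icc (0:ℝ) ε := fun s hs => ⟨hs.1, hs.2.trans ht.2⟩
    have h0 : M (fun _ => h) = (volume (F.P h)).toReal := by
      have := hvolM 0 ⟨le_rfl, hε.le⟩; simpa using this
    rw [hvolM t ht, h0, facet_volume i ht.1 (fun s hs => hball s (hsub s hs))]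
    have h1 : ∫⁻ s in Ioc 0 t, volume (F.face i (h + s • e) : Set (afH (F.u i))) =
        ∫⁻ s in Ioc 0 t, ENNReal.ofReal (D (fun _ => h + s • e)) := by
      refine setLIntegral_congr_fun measurableSet_Ioc fun s hs => ?_
      rw [hvolD s (hsub s ⟨hs.1.le, hs.2⟩), ENNReal.ofReal_toReal (ConvexBody.isCompact _).measure_ne_top]
    have hIntg : IntegrableOn (fun s => D (fun _ => h + s • e)) (Ioc 0 t) volume :=
      (hDc.integrableOn_Icc).mono_set Ioc_subset_Icc_self
    have h2 := ofReal_integral_eq_lintegral_ofReal (μ := volume.restrict (Ioc 0 t)) hIntg (by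
      rw [Filter.EventuallyLE, ae_restrict_iff' measurableSet_Ioc]
      refine .of_forall fun s hs => ?_
      rw [hvolD s (hsub s ⟨hs.1.le, hs.2⟩)]; exact ENNReal.toReal_nonneg)
    rw [h1, ← h2, ENNReal.toReal_add (P_compact h).measure_ne_top (by simp), intervalIntegral.integral_of_le ht.1,
      ENNReal.toReal_ofReal]
    refine setIntegral_nonneg measurableSet_Ioc fun s hs => ?_
    rw [hvolD s (hsub s ⟨hs.1.le, hs.2⟩)]; exact ENNReal.toReal_nonneg
  have d1 := (hasDeriv_multi M hMs e h).hasDerivWithinAt (s := Ici 0)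
  have d2 : HasDerivAt (fun t => M (fun _ => h) + ∫ s in (0:ℝ)..t, D (fun _ => h + s • e)) (D (fun _ => h)) 0 := by
    have := (intervalIntegral.integral_hasDerivAt_right (a := 0) (b := 0) (f := fun s => D (fun _ => h + s • e))
      (hDc.intervalIntegrable _ _) (hDc.stronglyMeasurableAtFilter _ _) hDc.continuousAt).const_add (M (fun _ => h))
    simpa using this
  have d3 := d2.hasDerivWithinAt (s := Ici 0)
  refine (uniqueDiffOn_Ici (0:ℝ) 0 self_mem_Ici).eq_deriv _ d1 (d3.congr_of_eventuallyEq ?_ ?_)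
  · filter_upwards [Icc_mem_nhdsGE hε] with t ht using key t ht
  · exact key 0 ⟨le_rfl, hε.le⟩

theorem formula [DecidableEq ι] (hm : m ≠ 0) (hV : IsMV V) {v : ι → ℝ} (hv : v ∈ F.C)
    (M : MultilinearMap ℝ (fun _ : Fin (m+1) => ι → ℝ) ℝ)
    (hM : ∀ w : Fin (m+1) → ι → ℝ, (∀ k, w k ∈ F.C) → M w = V (fun k => F.body (w k)))
    (hMs : ∀ (w : Fin (m+1) → ι → ℝ) (σ : Equiv.Perm (Fin (m+1))), M (w ∘ σ) = M w)
    (D : ι → MultilinearMap ℝ (fun _ : Fin m => ι → ℝ) ℝ)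
    (hD : ∀ i, ∀ w : Fin m → ι → ℝ, (∀ k, w k ∈ F.C) → D i w = afDesc V (F.u i) (fun k => F.face i (w k)))
    (hDs : ∀ i, ∀ (w : Fin m → ι → ℝ) (σ : Equiv.Perm (Fin m)), D i (w ∘ σ) = D i w)
    (x : ι → ℝ) (w : Fin m → ι → ℝ) :
    (m+1 : ℝ) * M (Fin.cons x w) = ∑ i, x i * D i w := by
  have h1 : ∀ i, (m+1 : ℝ) • M.curryLeft (Pi.single i 1) = D i := by
    intro i
    apply F.isCone.multi_unique hv
    have hG := F.isCone.multi_diag hm ((m+1 : ℝ) • M.curryLeft (Pi.single i 1) - D i) (by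
      intro w σ
      simp only [_root_.sub_apply, _root_.smul_apply, hDs, MultilinearMap.curryLeft_apply]
      congr 2
      let τ : Equiv.Perm (Fin (m+1)) := Equiv.Perm.decomposeFin.symm (0, σ)
      rw [← hMs (Fin.cons (Pi.single i 1) w) τ]
      congr 1
      ext1 i
      refine Fin.cases ?_ (fun j => ?_) i
      · simp [τ]
      · simp [τ])
      (by
        intro a ha
        simp only [_root_.sub_apply, _root_.smul_apply, MultilinearMap.curryLeft_apply, smul_eq_mul]
        rw [diag_formula hV ha M hM hMs (D i) (hD i) (hDs i), sub_self])
    intro w hw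
    have := hG w hw
    rwa [_root_.sub_apply, sub_eq_zero] at this
  have h2 : M.curryLeft x = ∑ i, x i • M.curryLeft (Pi.single i 1) := by
    conv_lhs => rw [pi_eq_sum_univ' x]
    simp
  have h3 : M (Fin.cons x w) = (∑ i, x i • M.curryLeft (Pi.single i 1)) w := by rw [← h2]; rfl
  rw [h3, _root_.sum_apply, Finset.mul_sum]
  refine Finset.sum_congr rfl fun i _ => ?_
  rw [← h1 i]
  simp only [_root_.smul_apply, smul_eq_mul]; ring

end AfFan
end deriv


section approxA
open Set
open scoped Pointwise NNReal RealInnerProductSpace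

variable {E : Type*} [NormedAddCommGroup E] [InnerProductSpace ℝ E] [FiniteDimensional ℝ E]

theorem af_ext_sep {ι : Type*} [Finite ι] (a : ι → E) (c : ι → ℝ) {x : E}
    (hx : x ∈ extremePoints ℝ {y | ∀ j, ⟪a j, y⟫ ≤ c j}) (d : E)
    (hd : ∀ j, ⟪a j, x⟫ = c j → ⟪a j, d⟫ = 0) : d = 0 := by
  rw [mem_extremePoints] at hx
  obtain ⟨hx0, hx1⟩ := hx
  have key : ∀ᶠ t in nhds (0:ℝ), ∀ j, ⟪a j, x + t • d⟫ ≤ c j := by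
    rw [Filter.eventually_all]
    intro j
    by_cases hj : ⟪a j, x⟫ = c j
    · filter_upwards with t
      rw [inner_add_right, inner_smul_right, hd j hj]; simp [hj]
    · have hlt : ⟪a j, x⟫ < c j := lt_of_le_of_ne (hx0 j) hj
      have hc : Continuous fun t : ℝ => ⟪a j, x + t • d⟫ := by fun_prop
      have := hc.tendsto 0
      simp only [zero_smul, add_zero] at this
      filter_upwards [this.eventually (gt_mem_nhds hlt)] with t ht using ht.le
  obtain ⟨r, hr, hball⟩ := Metric.eventually_nhds_iff.1 key
  have h1 := hball (y := r/2) (by simp [abs_of_pos hr]; linarith)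
  have h2 := hball (y := -(r/2)) (by simp [abs_of_pos hr]; linarith)
  have := (hx1 _ h1 _ h2 ⟨1/2, 1/2, by norm_num, by norm_num, by norm_num, by module⟩).1
  have h3 : (r/2) • d = 0 := by simpa using this
  rcases smul_eq_zero.1 h3 with h | h
  · linarith
  · exact h

theorem af_hrep (S : Finset E) (hS : (0:E) ∈ interior (convexHull ℝ (S : Set E))) :
    ∃ Y : Finset E, (∀ y ∈ Y, y ≠ 0) ∧ convexHull ℝ (S : Set E) = {x | ∀ y ∈ Y, ⟪y, x⟫ ≤ 1} := by
  classical
  set Q : Set E := {y | ∀ s : S, ⟪(s:E), y⟫ ≤ 1} with hQ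
  have hQ' : ∀ y ∈ Q, ∀ x ∈ convexHull ℝ (S : Set E), ⟪x, y⟫ ≤ 1 := by
    intro y hy x hx
    have hc : Convex ℝ {x : E | ⟪x, y⟫ ≤ 1} := by
      have : {x : E | ⟪x, y⟫ ≤ 1} = {x : E | innerₛₗ ℝ y x ≤ 1} := by
        ext x; simp [real_inner_comm]
      rw [this]; exact convex_halfSpace_le (innerₛₗ ℝ y).isLinear 1
    exact convexHull_min (fun s hs => hy ⟨s, hs⟩) hc hx
  obtain ⟨r, hr, hball⟩ := Metric.mem_nhds_iff.1 (mem_interior_iff_mem_nhds.1 hS)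
  have hbd : Q ⊆ Metric.closedBall 0 (2/r) := by
    intro y hy
    rw [mem_closedBall_zero_iff]
    by_cases hy0 : y = 0
    · rw [hy0, norm_zero]; positivity
    have hn : 0 < ‖y‖ := norm_pos_iff.2 hy0
    have := hQ' y hy ((r/(2*‖y‖)) • y) (hball (by
      rw [mem_ball_zero_iff, norm_smul, Real.norm_of_nonneg (by positivity)]
      field_simp; linarith))
    rw [real_inner_smul_left, real_inner_self_eq_norm_sq] at this
    rw [le_div_iff₀ hr]
    have e : r / (2 * ‖y‖) * ‖y‖ ^ 2 = ‖y‖ * r / 2 := by field_simp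
    linarith
  have hQcl : IsClosed Q := by
    have : Q = ⋂ s : S, {y | ⟪(s:E), y⟫ ≤ 1} := by ext; simp [Q]
    rw [this]; exact isClosed_iInter fun s => isClosed_le (by fun_prop) continuous_const
  have hQcv : Convex ℝ Q := by
    have : Q = ⋂ s : S, {y | innerₛₗ ℝ (s:E) y ≤ 1} := by ext; simp [Q]
    rw [this]; exact convex_iInter fun s => convex_halfSpace_le (innerₛₗ ℝ (s:E)).isLinear 1
  have hQc : IsCompact Q := (isCompact_closedBall 0 (2/r)).of_isClosed_subset hQcl hbd
  have hfin : (extremePoints ℝ Q).Finite := by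
    refine Set.Finite.of_injOn (f := fun y => (Finset.univ.filter fun s : S => ⟪(s:E), y⟫ = 1)) (t := univ)
      (fun _ _ => mem_univ _) ?_ (Set.toFinite _)
    intro y hy y' hy' h
    have : y' - y = 0 := by
      refine af_ext_sep (fun s : S => (s:E)) (fun _ => 1) hy _ fun j hj => ?_
      have h2 : j ∈ (Finset.univ.filter fun s : S => ⟪(s:E), y⟫ = 1) := by simpa using hj
      simp only at h
      rw [h] at h2
      rw [inner_sub_right, hj]
      have := (Finset.mem_filter.1 h2).2
      rw [this]; simp
    exact (sub_eq_zero.1 this).symm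
  refine ⟨hfin.toFinset.filter (fun y => y ≠ 0), fun y hy => (Finset.mem_filter.1 hy).2, ?_⟩
  apply Set.Subset.antisymm
  · intro x hx y hy
    have hy1 : y ∈ Q := (hfin.mem_toFinset.1 (Finset.mem_filter.1 hy).1).1
    rw [real_inner_comm]; exact hQ' y hy1 x hx
  · intro x hx
    by_contra hxn
    obtain ⟨f, u, hf1, hf2⟩ := geometric_hahn_banach_closed_point (convex_convexHull ℝ (S : Set E))
      (S.finite_toSet.isCompact_convexHull ℝ).isClosed hxn
    set z := (InnerProductSpace.toDual ℝ E).symm f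
    have hz : ∀ a, f a = ⟪z, a⟫ := fun a => by simp [z]
    have hu : 0 < u := by simpa using hf1 0 (interior_subset hS)
    have hyQ : (1/u) • z ∈ Q := by
      intro s
      rw [inner_smul_right, real_inner_comm, ← hz]
      have := hf1 s (subset_convexHull ℝ _ s.2)
      rw [one_div, inv_mul_le_iff₀ hu]; linarith
    have hcv : Convex ℝ {q : E | ⟪q, x⟫ ≤ 1} := by
      have : {q : E | ⟪q, x⟫ ≤ 1} = {q : E | innerₛₗ ℝ x q ≤ 1} := by
        ext q; simp [real_inner_comm]
      rw [this]; exact convex_halfSpace_le (innerₛₗ ℝ x).isLinear 1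
    have hcl : IsClosed {q : E | ⟪q, x⟫ ≤ 1} := isClosed_le (by fun_prop) continuous_const
    have hsub : Q ⊆ {q : E | ⟪q, x⟫ ≤ 1} := by
      rw [← closure_convexHull_extremePoints hQc hQcv]
      refine closure_minimal (convexHull_min ?_ hcv) hcl
      intro q hq
      by_cases hq0 : q = 0
      · simp [hq0]
      · exact hx q (Finset.mem_filter.2 ⟨hfin.mem_toFinset.2 hq, hq0⟩)
    have := hsub hyQ
    simp only [mem_ofPred_eq, real_inner_smul_left, ← hz] at this
    rw [one_div, inv_mul_le_iff₀ hu] at this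
    linarith

/-- dual basis map -/
theorem af_dual {ι : Type*} [Fintype ι] (u : ι → E) (B : Finset ι)
    (hli : LinearIndependent ℝ (fun i : B => u i))
    (hsep : ∀ d, (∀ i ∈ B, ⟪u i, d⟫ = 0) → d = 0) :
    ∃ X : (ι → ℝ) →ₗ[ℝ] E, (∀ i ∈ B, ∀ h, ⟪u i, X h⟫ = h i) := by
  let T : E →ₗ[ℝ] (B → ℝ) := LinearMap.pi fun i => innerₛₗ ℝ (u i)
  have hT : Injective T := by
    rw [injective_iff_map_eq_zero]
    intro d hd
    exact hsep d fun i hi => by simpa [T] using congrFun hd ⟨i, hi⟩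
  have h1 := LinearMap.finrank_le_finrank_of_injective hT
  have h2 := hli.fintype_card_le_finrank
  rw [Module.finrank_fintype_fun_eq_card] at h1
  let e := LinearMap.linearEquivOfInjective T hT (by rw [Module.finrank_fintype_fun_eq_card]; omega)
  let R : (ι → ℝ) →ₗ[ℝ] (B → ℝ) := LinearMap.funLeft ℝ ℝ (Subtype.val)
  refine ⟨e.symm.toLinearMap ∘ₗ R, fun i hi h => ?_⟩
  have : T (e.symm (R h)) = R h := e.apply_symm_apply (R h)
  exact congrFun this ⟨i, hi⟩

theorem af_generic {ι : Type*} [Fintype ι] (u : ι → E) :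
    Dense {h : ι → ℝ | ∀ J : Finset ι, ¬ LinearIndependent ℝ (fun i : J => u i) →
      ¬ ∃ x, ∀ j ∈ J, ⟪u j, x⟫ = h j} := by
  classical
  refine Measure.dense_of_ae (μ := (volume : Measure (ι → ℝ))) ?_
  rw [ae_all_iff]
  intro J
  by_cases hJ : LinearIndependent ℝ (fun i : J => u i)
  · filter_upwards with h h'; exact absurd hJ h'
  rw [Fintype.linearIndependent_iff] at hJ
  push Not at hJ
  obtain ⟨g, hg, i, hi⟩ := hJ
  let φ : (ι → ℝ) →ₗ[ℝ] ℝ := ∑ j : J, g j • LinearMap.proj (j : ι)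
  have hφ : ∀ h, φ h = ∑ j : J, g j * h j := fun h => by simp [φ, LinearMap.sum_apply]
  have hne : LinearMap.ker φ ≠ ⊤ := by
    intro h
    have : Pi.single (i:ι) (1:ℝ) ∈ LinearMap.ker φ := by rw [h]; trivial
    rw [LinearMap.mem_ker, hφ, Finset.sum_eq_single i] at this
    · simp at this; exact hi this
    · intro b _ hb
      rw [Pi.single_eq_of_ne (fun h => hb (Subtype.ext h)), mul_zero]
    · simp
  have h0 := Measure.addHaar_submodule (volume : Measure (ι → ℝ)) _ hne
  rw [measure_eq_zero_iff_ae_notMem] at h0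
  filter_upwards [h0] with h hh _
  rintro ⟨x, hx⟩
  apply hh
  simp only [SetLike.mem_coe, LinearMap.mem_ker, hφ]
  have : ⟪∑ j : J, g j • u j, x⟫ = 0 := by rw [hg, inner_zero_left]
  rw [sum_inner] at this
  rw [← this]
  refine Finset.sum_congr rfl fun j _ => ?_
  rw [real_inner_smul_left, hx j j.2]

end approxA


section approxB
open Set
open scoped Pointwise NNReal RealInnerProductSpace
universe uE
variable {E : Type uE} [NormedAddCommGroup E] [InnerProductSpace ℝ E] [FiniteDimensional ℝ E]

theorem af_fan {ι : Type uE} [Fintype ι] (u : ι → E) (hu : ∀ i, ‖u i‖ = 1) (p : ι → ℝ) (hp : ∀ i, 0 < p i)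
    (hc : IsCompact {x | ∀ i, ⟪u i, x⟫ ≤ p i}) :
    ∃ (ι' β : Type uE) (_ : Fintype ι') (_ : Finite β) (F : AfFan E ι' β) (e : ι' → ι) (h0 : ι' → ℝ),
      h0 ∈ F.C ∧ (∀ i, F.u i = u (e i)) ∧ ∀ b, (∀ d, (∀ i ∈ F.supp b, ⟪F.u i, d⟫ = 0) → d = 0) ∧
        ∃ x, (∀ i, ⟪u i, x⟫ ≤ p i) ∧ ∀ i ∈ F.supp b, ⟪F.u i, x⟫ = p (e i) := by
  classical
  let IsB : Finset ι → Prop := fun B => LinearIndependent ℝ (fun i : B => u i) ∧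
    ∀ d, (∀ i ∈ B, ⟪u i, d⟫ = 0) → d = 0
  choose X hX using fun B : {B // IsB B} => af_dual u B.1 B.2.1 B.2.2
  have Xc : ∀ B, Continuous (X B) := fun B => LinearMap.continuous_of_finiteDimensional _
  have Xuniq : ∀ (B : {B // IsB B}) h x, (∀ i ∈ B.1, ⟪u i, x⟫ = h i) → X B h = x := by
    intro B h x hx
    rw [← sub_eq_zero]
    refine B.2.2 _ fun i hi => ?_
    rw [inner_sub_right, hX B i hi, hx i hi, sub_self]
  have ev : ∀ᶠ h in nhds p, (∀ i, 0 < h i) ∧ (∀ i, h i < 2 * p i) ∧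
      ∀ B, (∃ j, p j < ⟪u j, X B p⟫) → ∃ j, h j < ⟪u j, X B h⟫ := by
    refine Filter.Eventually.and ?_ (Filter.Eventually.and ?_ ?_)
    · rw [Filter.eventually_all]
      exact fun i => (continuous_apply i).continuousAt.eventually (lt_mem_nhds (hp i))
    · rw [Filter.eventually_all]
      exact fun i => (continuous_apply i).continuousAt.eventually (gt_mem_nhds (by have := hp i; linarith))
    · rw [Filter.eventually_all]
      intro B
      by_cases hB : ∃ j, p j < ⟪u j, X B p⟫
      · obtain ⟨j, hj⟩ := hB
        have h1 : IsOpen {h : ι → ℝ | h j < ⟪u j, X B h⟫} := by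
          have := Xc B
          exact isOpen_lt (continuous_apply j) (by fun_prop)
        filter_upwards [h1.mem_nhds hj] with h hh _ using ⟨j, hh⟩
      · filter_upwards with h hh using absurd hh hB
  obtain ⟨h0, hgen, hpos, hlt, hinf⟩ := (af_generic u).inter_nhds_nonempty ev
  set P0 : Set E := {x | ∀ i, ⟪u i, x⟫ ≤ h0 i} with hP0
  have hP0c : IsCompact P0 := by
    have hcl : IsClosed P0 := by
      have : P0 = ⋂ i, {x | ⟪u i, x⟫ ≤ h0 i} := by ext; simp [P0]
      rw [this]; exact isClosed_iInter fun i => isClosed_le (by fun_prop) continuous_const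
    refine (hc.smul (2:ℝ)).of_isClosed_subset hcl fun x hx => ?_
    rw [mem_smul_set_iff_inv_smul_mem₀ (by norm_num)]
    intro i
    rw [inner_smul_right]
    have := hx i
    have := hlt i
    linarith
  let β := {B : {B // IsB B} // ∀ j, ⟪u j, X B h0⟫ ≤ h0 j}
  let ι' := {i : ι // ∃ b : β, i ∈ b.1.1}
  let ext : (ι' → ℝ) →ₗ[ℝ] (ι → ℝ) := Function.ExtendByZero.linearMap ℝ Subtype.val
  have hext : ∀ h (i : ι'), ext h i = h i := fun h i =>
    Subtype.val_injective.extend_apply h 0 i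
  let supp : β → Finset ι' := fun b => Finset.univ.filter fun i => (i : ι) ∈ b.1.1
  have hsupp : ∀ b (i : ι'), i ∈ supp b ↔ (i:ι) ∈ b.1.1 := fun b i => by simp [supp]
  have complete : ∀ z : E, ∃ b : β, ∃ c : ι' → ℝ, (∀ i, 0 ≤ c i) ∧ (∀ i, i ∉ supp b → c i = 0) ∧
      z = ∑ i : ι', c i • u i := by
    intro z
    let f : E →L[ℝ] ℝ := innerSL ℝ z
    have hA : IsExposed ℝ P0 {x ∈ P0 | ∀ y ∈ P0, f y ≤ f x} := fun _ => ⟨f, rfl⟩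
    obtain ⟨x0, hx0, hx0'⟩ := hP0c.exists_isMaxOn ⟨0, fun i => by simpa using (hpos i).le⟩ f.continuous.continuousOn
    obtain ⟨x, hx⟩ := (hA.isCompact hP0c).extremePoints_nonempty ⟨x0, hx0, fun y hy => hx0' hy⟩
    have hxP := hA.isExtreme.extremePoints_subset_extremePoints hx
    have hxm : ∀ y ∈ P0, f y ≤ f x := hx.1.2
    have hx0 : x ∈ P0 := hx.1.1
    let J : Finset ι := Finset.univ.filter fun i => ⟪u i, x⟫ = h0 i
    have hJ : ∀ i, i ∈ J ↔ ⟪u i, x⟫ = h0 i := fun i => by simp [J]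
    have hJB : IsB J := by
      refine ⟨?_, fun d hd => af_ext_sep u h0 hxP d fun j hj => hd j ((hJ j).2 hj)⟩
      by_contra hli
      exact hgen J hli ⟨x, fun j hj => (hJ j).1 hj⟩
    let B : {B // IsB B} := ⟨J, hJB⟩
    have hXx : X B h0 = x := Xuniq B h0 x fun i hi => (hJ i).1 hi
    let b : β := ⟨B, by rw [hXx]; exact hx0⟩
    let d : ι → E := fun i => X B (Pi.single i 1)
    have hXd : ∀ h, X B h = ∑ i, h i • d i := by
      intro h
      conv_lhs => rw [← Finset.univ_sum_single h, map_sum]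
      refine Finset.sum_congr rfl fun i _ => ?_
      rw [← map_smul]; congr 1; ext k; simp [Pi.single_apply]
    have hd0 : ∀ i ∉ J, d i = 0 := fun i hi => Xuniq B _ _ fun k hk => by
      rw [inner_zero_right, Pi.single_eq_of_ne]; rintro rfl; exact hi hk
    let c : ι → ℝ := fun i => ⟪z, d i⟫
    have hc0 : ∀ i ∉ J, c i = 0 := fun i hi => by simp only [c]; rw [hd0 i hi, inner_zero_right]
    have hcn : ∀ i, 0 ≤ c i := by
      intro i
      by_cases hi : i ∈ J
      swap
      · rw [hc0 i hi]
      have key : ∀ᶠ t in nhdsWithin (0:ℝ) (Ioi 0), ∀ j, ⟪u j, x - t • d i⟫ ≤ h0 j := by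
        rw [Filter.eventually_all]
        intro j
        by_cases hj : j ∈ J
        · filter_upwards [self_mem_nhdsWithin] with t ht
          rw [inner_sub_right, inner_smul_right, hX B j hj, (hJ j).1 hj]
          have : (0:ℝ) ≤ (Pi.single i (1:ℝ) : ι → ℝ) j := by
            rw [Pi.single_apply]; split_ifs <;> norm_num
          have := mul_nonneg (le_of_lt ht) this
          linarith
        · have hlt : ⟪u j, x⟫ < h0 j := lt_of_le_of_ne (hx0 j) fun h => hj ((hJ j).2 h)
          have hc : Continuous fun t : ℝ => ⟪u j, x - t • d i⟫ := by fun_prop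
          have := hc.tendsto 0
          simp only [zero_smul, sub_zero] at this
          filter_upwards [(this.mono_left nhdsWithin_le_nhds).eventually (gt_mem_nhds hlt)] with t ht using ht.le
      obtain ⟨t, ht, ht0⟩ := (key.and self_mem_nhdsWithin).exists
      have ht0 : 0 < t := ht0
      have := hxm _ ht
      rw [map_sub, map_smul, smul_eq_mul] at this
      have h2 : 0 ≤ t * f (d i) := by linarith
      exact nonneg_of_mul_nonneg_right h2 ht0
    refine ⟨b, fun i => c i, fun i => hcn i, fun i hi => hc0 i fun h => hi ((hsupp b i).2 h), ?_⟩
    have hz : z = ∑ i, c i • u i := by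
      refine ext_inner_right ℝ fun y => ?_
      have hy : X B (fun i => ⟪u i, y⟫) = y := Xuniq B _ _ fun i _ => rfl
      conv_lhs => rw [← hy, hXd, inner_sum]
      rw [sum_inner]
      refine Finset.sum_congr rfl fun i _ => ?_
      rw [inner_smul_right, real_inner_smul_left, mul_comm]
    rw [hz]
    symm
    refine Finset.sum_of_injOn (e := (Subtype.val : ι' → ι)) (Subtype.val_injective.injOn) (fun _ _ => by simp) ?_ (fun _ _ => rfl)
    intro i _ hi
    have : i ∉ J := fun hiJ => hi ⟨⟨i, b, hiJ⟩, by simp, rfl⟩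
    rw [hc0 i this, zero_smul]
  let F : AfFan E ι' β :=
    { u := fun i => u i
      X := fun b => X b.1 ∘ₗ ext
      supp := supp
      unit := fun i => hu i
      hX := fun b i hi h => by
        rw [LinearMap.comp_apply, hX b.1 i ((hsupp b i).1 hi), hext]
      complete := complete
      cover := fun i => by
        obtain ⟨b, hb⟩ := i.2
        exact ⟨b, (hsupp b i).2 hb⟩ }
  refine ⟨ι', β, inferInstance, inferInstance, F, Subtype.val, fun i => h0 i, ?_, fun i => rfl, fun b => ⟨?_, ?_⟩⟩
  · refine ⟨fun i => hpos i, fun b j hj => ?_⟩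
    have e1 : X b.1 (ext fun i : ι' => h0 i) = X b.1 h0 := by
      refine Xuniq _ _ _ fun i hi => ?_
      rw [hX _ _ hi, hext _ ⟨i, b, hi⟩]
    change ⟪u j, X b.1 (ext fun i : ι' => h0 i)⟫ < h0 j
    rw [e1]
    refine lt_of_le_of_ne (b.2 j) fun heq => ?_
    have hjn : (j:ι) ∉ b.1.1 := fun h => hj ((hsupp b j).2 h)
    by_cases hli : LinearIndependent ℝ (fun i : (insert (j:ι) b.1.1 : Finset ι) => u i)
    · obtain ⟨Y, hY⟩ := af_dual u (insert (j:ι) b.1.1) hli fun d hd =>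
        b.1.2.2 d fun i hi => hd i (Finset.mem_insert_of_mem hi)
      have hd : Y (Pi.single (j:ι) 1) = 0 := by
        refine b.1.2.2 _ fun i hi => ?_
        rw [hY i (Finset.mem_insert_of_mem hi), Pi.single_eq_of_ne]
        rintro rfl; exact hjn hi
      have := hY j (Finset.mem_insert_self _ _) (Pi.single (j:ι) 1)
      rw [hd] at this
      simp at this
    · refine hgen _ hli ⟨X b.1 h0, fun i hi => ?_⟩
      rcases Finset.mem_insert.1 hi with rfl | hi
      · exact heq
      · exact hX _ i hi _
  · intro d hd
    refine b.1.2.2 d fun i hi => hd ⟨i, b, hi⟩ ((hsupp b _).2 hi)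
  · refine ⟨X b.1 p, ?_, fun i hi => hX b.1 i ((hsupp b i).1 hi) p⟩
    by_contra hcon
    push Not at hcon
    obtain ⟨j, hj⟩ := hinf b.1 hcon
    exact absurd (b.2 j) (not_le.2 hj)

end approxB


section approxC
open Set
open scoped Pointwise NNReal RealInnerProductSpace
universe uE
variable {E : Type uE} [NormedAddCommGroup E] [InnerProductSpace ℝ E] [FiniteDimensional ℝ E]
  [MeasurableSpace E] [BorelSpace E]

theorem af_approx {κ : Type*} [Fintype κ] [Nonempty κ] (K : κ → ConvexBody E) (hK : ∀ k, (0:E) ∈ (K k : Set E))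
    {ε : ℝ} (hε : 0 < ε) :
    ∃ (ι β : Type uE) (_ : Fintype ι) (_ : Finite β) (F : AfFan E ι β) (h : κ → ι → ℝ),
      (∀ k, h k ∈ F.C) ∧ (∀ k, (K k : Set E) ⊆ F.P (h k)) ∧
      ∀ k, ∀ x ∈ F.P (h k), ∃ y ∈ (K k : Set E), ‖x - y‖ ≤ ε := by
  classical
  have hS : ∀ k, ∃ S : Finset E, (K k : Set E) ⊆ interior (convexHull ℝ (S : Set E)) ∧
      convexHull ℝ (S : Set E) ⊆ Metric.thickening (ε/2) (K k : Set E) := fun k =>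
    Convex.exists_subset_interior_convexHull_finset_of_isCompact (K k).convex (K k).isCompact
      (Metric.thickening_mem_nhdsSet _ (half_pos hε))
  choose S hS1 hS2 using hS
  let Q : κ → Set E := fun k => convexHull ℝ (S k : Set E)
  have hQ : ∀ k, (K k : Set E) ⊆ Q k := fun k => (hS1 k).trans interior_subset
  have hQ0 : ∀ k, (0:E) ∈ interior (Q k) := fun k => hS1 k (hK k)
  have hQ0' : ∀ k, (0:E) ∈ Q k := fun k => interior_subset (hQ0 k)
  have hQc : ∀ k, IsCompact (Q k) := fun k => (S k).finite_toSet.isCompact_convexHull ℝ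
  have hsum : convexHull ℝ ((∑ k, S k : Finset E) : Set E) = ∑ k, Q k := by
    rw [Finset.coe_sum, convexHull_sum]
  have h0int : (0:E) ∈ interior (convexHull ℝ ((∑ k, S k : Finset E) : Set E)) := by
    obtain ⟨k⟩ := ‹Nonempty κ›
    refine interior_mono ?_ (hQ0 k)
    rw [hsum]
    intro x hx
    rw [Set.mem_fintype_sum]
    refine ⟨Pi.single k x, fun i => ?_, by simp⟩
    by_cases hi : i = k
    · subst hi; simpa using hx
    · rw [Pi.single_eq_of_ne hi]; exact hQ0' i
  obtain ⟨Y, hY0, hY⟩ := af_hrep _ h0int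
  rw [hsum] at hY
  let u : Y → E := fun y => (‖(y:E)‖⁻¹) • (y:E)
  have hn : ∀ y : Y, 0 < ‖(y:E)‖ := fun y => norm_pos_iff.2 (hY0 y y.2)
  have hu : ∀ y, ‖u y‖ = 1 := fun y => by
    simp only [u, norm_smul, norm_inv, norm_norm]
    exact inv_mul_cancel₀ (hn y).ne'
  have hm : ∀ k (i : Y), ∃ m ∈ Q k, ∀ x ∈ Q k, ⟪u i, x⟫ ≤ ⟪u i, m⟫ := by
    intro k i
    obtain ⟨m, hm, hm'⟩ := (hQc k).exists_isMaxOn ⟨0, hQ0' k⟩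
      (f := fun x => ⟪u i, x⟫) (by fun_prop : Continuous fun x => ⟪u i, x⟫).continuousOn
    exact ⟨m, hm, fun x hx => hm' hx⟩
  choose m hmQ hmax using hm
  let s : κ → Y → ℝ := fun k i => ⟪u i, m k i⟫
  have hs : ∀ k i, 0 < s k i := by
    intro k i
    obtain ⟨r, hr, hball⟩ := Metric.mem_nhds_iff.1 (mem_interior_iff_mem_nhds.1 (hQ0 k))
    have := hmax k i ((r/2) • u i) (hball (by
      rw [mem_ball_zero_iff, norm_smul, hu, Real.norm_of_nonneg (by positivity)]; linarith))
    rw [inner_smul_right, real_inner_self_eq_norm_sq, hu] at this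
    have h2 : 0 < r / 2 * 1 ^ 2 := by positivity
    exact lt_of_lt_of_le h2 this
  let p : Y → ℝ := fun i => ∑ k, s k i
  have hPP : {x | ∀ i, ⟪u i, x⟫ ≤ p i} = ∑ k, Q k := by
    apply Subset.antisymm
    · intro x hx
      rw [hY]
      intro y hy
      have h1 : ∑ k, m k ⟨y, hy⟩ ∈ ∑ k, Q k := by
        rw [Set.mem_fintype_sum]; exact ⟨_, fun k => hmQ k _, rfl⟩
      rw [hY] at h1
      have h1 := h1 y hy
      have h2 := hx ⟨y, hy⟩
      have e : ∀ z, ⟪y, z⟫ = ‖y‖ * ⟪u ⟨y, hy⟩, z⟫ := fun z => by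
        simp only [u, real_inner_smul_left]
        rw [mul_inv_cancel_left₀ (hn ⟨y, hy⟩).ne']
      rw [e] at h1 ⊢
      rw [inner_sum] at h1
      exact (mul_le_mul_of_nonneg_left h2 (norm_nonneg y)).trans h1
    · intro x hx i
      rw [Set.mem_fintype_sum] at hx
      obtain ⟨g, hg, rfl⟩ := hx
      rw [inner_sum]
      exact Finset.sum_le_sum fun k _ => hmax k i _ (hg k)
  obtain ⟨ι, β, _, _, F, e, g0, hg0, hFu, hFb⟩ := af_fan u hu p
    (fun i => Finset.sum_pos (fun k _ => hs k i) Finset.univ_nonempty)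
    (by rw [hPP, ← hsum]; exact (∑ k, S k).finite_toSet.isCompact_convexHull ℝ)
  have hXQ : ∀ b k, F.X b (fun i => s k (e i)) ∈ Q k := by
    intro b k
    obtain ⟨hsep, x, hx, hxe⟩ := hFb b
    have hx' : x ∈ ∑ k, Q k := by rw [← hPP]; exact hx
    rw [Set.mem_fintype_sum] at hx'
    obtain ⟨g, hg, rfl⟩ := hx'
    have : F.X b (fun i => s k (e i)) = g k := by
      rw [← sub_eq_zero]
      refine hsep _ fun i hi => ?_
      have h1 := hxe i hi
      rw [inner_sum] at h1
      have h2 := (Finset.sum_eq_sum_iff_of_le (s := Finset.univ) (f := fun k => ⟪F.u i, g k⟫)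
        (g := fun k => s k (e i)) fun k _ => by
          rw [hFu]; exact hmax k (e i) _ (hg k)).1 h1 k (Finset.mem_univ k)
      rw [inner_sub_right, F.hX b i hi, h2, sub_self]
    rw [this]; exact hg k
  obtain ⟨R, hR⟩ := (Set.finite_range fun b => ‖F.X b g0‖).bddAbove
  let R' := max R 0 + 1
  have hR' : 0 < R' := by positivity
  have hRb : ∀ b, ‖F.X b g0‖ ≤ R' := fun b => (hR ⟨b, rfl⟩).trans ((le_max_left R 0).trans (by simp [R']))
  let δ := ε / 2 / R'
  have hδ : 0 < δ := by positivity
  refine ⟨ι, β, inferInstance, inferInstance, F, fun k => (fun i => s k (e i)) + δ • g0, ?_, ?_, ?_⟩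
  · intro k
    refine ⟨fun i => add_pos (hs k _) (mul_pos hδ (hg0.1 i)), fun b j hj => ?_⟩
    rw [map_add, map_smul, inner_add_right, inner_smul_right]
    refine add_lt_add_of_le_of_lt ?_ (mul_lt_mul_of_pos_left (hg0.2 b j hj) hδ)
    rw [hFu]; exact hmax k (e j) _ (hXQ b k)
  · intro k x hx i
    have h1 := hmax k (e i) x (hQ k hx)
    have h2 := mul_pos hδ (hg0.1 i)
    rw [hFu]
    change _ ≤ s k (e i) + δ * g0 i
    have h3 : ⟪u (e i), x⟫ ≤ s k (e i) := h1
    linarith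
  · intro k x hx
    have hsub : convexHull ℝ (range fun b => F.X b ((fun i => s k (e i)) + δ • g0)) ⊆
        (K k : Set E) + Metric.closedBall 0 ε := by
      refine convexHull_min ?_ ((K k).convex.add (convex_closedBall 0 ε))
      rintro _ ⟨b, rfl⟩
      obtain ⟨y, hy, hd⟩ := Metric.mem_thickening_iff.1 (hS2 k (hXQ b k))
      refine ⟨y, hy, F.X b ((fun i => s k (e i)) + δ • g0) - y, ?_, by simp⟩
      rw [mem_closedBall_zero_iff, map_add, map_smul, add_sub_right_comm]
      refine (norm_add_le _ _).trans ?_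
      rw [← dist_eq_norm, norm_smul, Real.norm_of_nonneg hδ.le]
      have := mul_le_mul_of_nonneg_left (hRb b) hδ.le
      have e2 : δ * R' = ε / 2 := by simp only [δ]; field_simp
      linarith
    obtain ⟨y, hy, z, hz, rfl⟩ := hsub (AfFan.P_sub_hull _ hx)
    exact ⟨y, hy, by simpa using hz⟩

end approxC


section positivity
open Set
open scoped Pointwise NNReal RealInnerProductSpace

def AfPos (m : ℕ) : Prop := ∀ (E : Type) [NormedAddCommGroup E] [InnerProductSpace ℝ E] [FiniteDimensional ℝ E]
  [MeasurableSpace E] [BorelSpace E], Module.finrank ℝ E = m →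
  ∀ V : MultilinearMap ℝ≥0 (fun _ : Fin m => ConvexBody E) ℝ, IsMV V →
  ∀ K : Fin m → ConvexBody E, (∀ k, (interior (K k : Set E)).Nonempty) → 0 < V K

variable {E : Type} [NormedAddCommGroup E] [InnerProductSpace ℝ E] [FiniteDimensional ℝ E]
  [MeasurableSpace E] [BorelSpace E]

namespace AfFan
variable {ι β : Type} [Fintype ι] [Finite β] {F : AfFan E ι β}
variable {m : ℕ} {V : MultilinearMap ℝ≥0 (fun _ : Fin (m+1) => ConvexBody E) ℝ}

theorem package (hm : m ≠ 0) (hpos : AfPos m) (hE : Module.finrank ℝ E = m + 1) (hV : IsMV V) {v : ι → ℝ} (hv : v ∈ F.C) :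
    ∃ (M : MultilinearMap ℝ (fun _ : Fin (m+1) => ι → ℝ) ℝ) (D : ι → MultilinearMap ℝ (fun _ : Fin m => ι → ℝ) ℝ),
      (∀ w : Fin (m+1) → ι → ℝ, (∀ k, w k ∈ F.C) → M w = V (fun k => F.body (w k))) ∧
      (∀ (w : Fin (m+1) → ι → ℝ) (σ : Equiv.Perm (Fin (m+1))), M (w ∘ σ) = M w) ∧
      (∀ i (w : Fin m → ι → ℝ), (∀ k, w k ∈ F.C) → D i w = afDesc V (F.u i) (fun k => F.face i (w k))) ∧
      (∀ i (w : Fin m → ι → ℝ) (σ : Equiv.Perm (Fin m)), D i (w ∘ σ) = D i w) ∧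
      (∀ (x : ι → ℝ) (w : Fin m → ι → ℝ), (m+1 : ℝ) * M (Fin.cons x w) = ∑ i, x i * D i w) ∧
      (∀ i (w : Fin m → ι → ℝ), (∀ k, w k ∈ F.C) → 0 < D i w) := by
  classical
  obtain ⟨M, hM, hMs⟩ := exists_M (F := F) hV hv
  choose D hD hDs using fun i => exists_D (F := F) i (afDesc_isMV hV (F.u i) (F.unit i)) hv
  refine ⟨M, D, hM, hMs, hD, hDs, formula hm hV hv M hM hMs D hD hDs, ?_⟩
  intro i w hw
  rw [hD i w hw]
  exact hpos _ (finrank_afH (F.unit i) hE) _ (afDesc_isMV hV (F.u i) (F.unit i)) _ fun k => face_interior (hw k) i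

theorem M_nonneg {M : MultilinearMap ℝ (fun _ : Fin (m+1) => ι → ℝ) ℝ} {D : ι → MultilinearMap ℝ (fun _ : Fin m => ι → ℝ) ℝ}
    (hMs : ∀ (w : Fin (m+1) → ι → ℝ) (σ : Equiv.Perm (Fin (m+1))), M (w ∘ σ) = M w)
    (hf : ∀ (x : ι → ℝ) (w : Fin m → ι → ℝ), (m+1 : ℝ) * M (Fin.cons x w) = ∑ i, x i * D i w)
    (hD : ∀ i (w : Fin m → ι → ℝ), (∀ k, w k ∈ F.C) → 0 < D i w)
    (w : Fin (m+1) → ι → ℝ) (k : Fin (m+1)) (hk : ∀ i, 0 ≤ w k i) (hw : ∀ l, l ≠ k → w l ∈ F.C) : 0 ≤ M w := by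
  rw [← hMs w (Equiv.swap 0 k)]
  set w' := w ∘ Equiv.swap 0 k
  have h0 : w' 0 = w k := by simp [w']
  have hl : ∀ l : Fin m, w' l.succ ∈ F.C := by
    intro l
    refine hw _ fun h => ?_
    have h2 : l.succ = 0 := (Equiv.swap 0 k).injective (by rw [h, Equiv.swap_apply_left])
    exact Fin.succ_ne_zero l h2
  have := hf (w' 0) (Fin.tail w')
  rw [Fin.cons_self_tail] at this
  have h2 : 0 ≤ ∑ i, w' 0 i * D i (Fin.tail w') := Finset.sum_nonneg fun i _ => by
    rw [h0]; exact mul_nonneg (hk i) (hD i _ hl).le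
  rw [← this] at h2
  exact nonneg_of_mul_nonneg_right h2 (by positivity)

theorem M_mono {M : MultilinearMap ℝ (fun _ : Fin (m+1) => ι → ℝ) ℝ} {D : ι → MultilinearMap ℝ (fun _ : Fin m => ι → ℝ) ℝ}
    (hMs : ∀ (w : Fin (m+1) → ι → ℝ) (σ : Equiv.Perm (Fin (m+1))), M (w ∘ σ) = M w)
    (hf : ∀ (x : ι → ℝ) (w : Fin m → ι → ℝ), (m+1 : ℝ) * M (Fin.cons x w) = ∑ i, x i * D i w)
    (hD : ∀ i (w : Fin m → ι → ℝ), (∀ k, w k ∈ F.C) → 0 < D i w)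
    (w w' : Fin (m+1) → ι → ℝ) (hw : ∀ k, w k ∈ F.C) (hw' : ∀ k, w' k ∈ F.C) (hle : ∀ k i, w k i ≤ w' k i) : M w ≤ M w' := by
  classical
  have key : ∀ s : Finset (Fin (m+1)), M w ≤ M (s.piecewise w' w) := by
    intro s
    induction s using Finset.induction_on with
    | empty => simp
    | insert a s ha ih =>
      refine ih.trans ?_
      rw [Finset.piecewise_insert]
      have e : M (s.piecewise w' w) = M (update (s.piecewise w' w) a (w a)) := by
        congr 1
        rw [eq_comm, Function.update_eq_self_iff, Finset.piecewise_eq_of_notMem _ _ _ ha]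
      rw [e, ← sub_nonneg, ← M.map_update_sub]
      refine M_nonneg hMs hf hD _ a (fun i => ?_) fun l hl => ?_
      · simpa using hle a i
      · rw [update_of_ne hl]
        by_cases h : l ∈ s
        · rw [Finset.piecewise_eq_of_mem _ _ _ h]; exact hw' l
        · rw [Finset.piecewise_eq_of_notMem _ _ _ h]; exact hw l
  simpa using key Finset.univ

end AfFan

theorem afPos (m : ℕ) : AfPos m := by
  induction m with
  | zero =>
    intro E _ _ _ _ _ hE V hV K hK
    have h1 : K = fun _ => (0 : ConvexBody E) := Subsingleton.elim _ _
    rw [h1, hV.diag]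
    have : Subsingleton E := Module.finrank_zero_iff.1 hE
    have h2 : ((0 : ConvexBody E) : Set E) = univ := by
      ext x; simp [Subsingleton.elim x 0]
    rw [h2, ENNReal.toReal_pos_iff]
    have hc : IsCompact (univ : Set E) := (Set.toFinite _).isCompact
    exact ⟨isOpen_univ.measure_pos _ ⟨0, trivial⟩, hc.measure_lt_top⟩
  | succ m ih =>
    intro E _ _ _ _ _ hE V hV K hK
    have hvol : ∀ K : ConvexBody E, (interior (K : Set E)).Nonempty → 0 < (volume (K : Set E)).toReal := by
      intro K hK
      rw [ENNReal.toReal_pos_iff]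
      exact ⟨Measure.measure_pos_of_nonempty_interior _ hK, K.isCompact.measure_lt_top⟩
    by_cases hm : m = 0
    · subst hm
      have : K = fun _ => K 0 := by
        funext k
        have : k = 0 := Fin.eq_zero k
        rw [this]
      rw [this, hV.diag]
      exact hvol _ (hK 0)
    -- translate
    choose a ha using hK
    set L : Fin (m+1) → ConvexBody E := fun k => K k + afPt (-a k) with hL
    rw [← hV.translate K (fun k => -a k)]
    change 0 < V L
    have hL0 : ∀ k, (0:E) ∈ interior (L k : Set E) := by
      intro k
      have e : (L k : Set E) = (Homeomorph.addRight (-a k)) '' (K k : Set E) := by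
        ext x
        simp [hL, ConvexBody.coe_add, afPt, mem_add]
      rw [e, ← Homeomorph.image_interior]
      exact ⟨a k, ha k, by simp⟩
    have hρ : ∃ ρ > 0, ∀ k, Metric.closedBall (0:E) ρ ⊆ (L k : Set E) := by
      have : ∀ᶠ ρ in nhdsWithin (0:ℝ) (Ioi 0), ∀ k, Metric.closedBall (0:E) ρ ⊆ (L k : Set E) := by
        rw [Filter.eventually_all]
        intro k
        obtain ⟨r, hr, hb⟩ := Metric.nhds_basis_closedBall.mem_iff.1 (mem_interior_iff_mem_nhds.1 (hL0 k))
        filter_upwards [Ioo_mem_nhdsGT hr] with ρ hρ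
        exact (Metric.closedBall_subset_closedBall hρ.2.le).trans hb
      obtain ⟨ρ, h1, h2⟩ := (this.and self_mem_nhdsWithin).exists
      exact ⟨ρ, h2, h1⟩
    obtain ⟨ρ, hρ, hball⟩ := hρ
    obtain ⟨R, hR⟩ := (L 0).isCompact.isBounded.exists_norm_le
    let R' := max R 0 + 1
    have hR' : 0 < R' := by positivity
    let c := ρ / R'
    have hc : 0 < c := by positivity
    -- approximations
    have happ : ∀ N : ℕ, ∃ T : Fin (m+1) → ConvexBody E, (∀ k, (L k : Set E) ⊆ T k) ∧
        (∀ k, ∀ x ∈ T k, ∃ y ∈ L k, ‖x - y‖ ≤ 1 / ((N:ℝ) + 1)) ∧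
        c ^ (m+1) * (volume (L 0 : Set E)).toReal ≤ V T := by
      intro N
      have hN : (0:ℝ) < 1 / ((N:ℝ) + 1) := by positivity
      obtain ⟨ι, β, _, _, F, h, hC, hsub, hclose⟩ := af_approx L (fun k => interior_subset (hL0 k)) hN
      obtain ⟨M, D, hM, hMs, hD, hDs, hf, hDp⟩ := AfFan.package hm ih hE hV (hC 0)
      refine ⟨fun k => F.body (h k), fun k => ?_, fun k x hx => ?_, ?_⟩
      · rw [AfFan.body_coe (hC k)]; exact hsub k
      · have hx : x ∈ (F.body (h k) : Set E) := hx
        rw [AfFan.body_coe (hC k)] at hx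
        exact hclose k x hx
      · rw [← hM h hC]
        have h1 : M (fun _ => c • h 0) ≤ M h := by
          refine AfFan.M_mono hMs hf hDp _ _ (fun _ => F.isCone.smul c hc _ (hC 0)) hC fun k i => ?_
          have e1 : ρ ≤ h k i := by
            have hmem : ρ • F.u i ∈ Metric.closedBall (0:E) ρ := by
              rw [mem_closedBall_zero_iff, norm_smul, F.unit, Real.norm_of_nonneg hρ.le, mul_one]
            have := hsub k (hball k hmem) i
            rwa [inner_smul_right, real_inner_self_eq_norm_sq, F.unit, one_pow, mul_one] at this
          have e2 : h 0 i ≤ R' := by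
            obtain ⟨b, hb⟩ := F.cover i
            obtain ⟨y, hy, hxy⟩ := hclose 0 _ (AfFan.X_mem (hC 0) b)
            have e3 := real_inner_le_norm (F.u i) (F.X b (h 0))
            rw [F.hX b i hb, F.unit, one_mul] at e3
            have e4 := norm_le_norm_add_norm_sub y (F.X b (h 0))
            have e5 := hR y hy
            have e6 : 1 / ((N:ℝ) + 1) ≤ 1 := by rw [div_le_one (by positivity)]; simp
            have e7 := le_max_left R 0
            have e8 : ‖y - F.X b (h 0)‖ = ‖F.X b (h 0) - y‖ := norm_sub_rev _ _
            simp only [R']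
            linarith
          change c * h 0 i ≤ _
          calc c * h 0 i ≤ c * R' := mul_le_mul_of_nonneg_left e2 hc.le
            _ = ρ := by simp only [c]; field_simp
            _ ≤ _ := e1
        refine le_trans ?_ h1
        rw [M.map_smul_univ (fun _ => c) (fun _ => h 0), hM _ (fun _ => hC 0), hV.diag, AfFan.body_coe (hC 0)]
        simp only [Finset.prod_const, Finset.card_univ, Fintype.card_fin, smul_eq_mul]
        refine mul_le_mul_of_nonneg_left ?_ (by positivity)
        exact ENNReal.toReal_mono (AfFan.P_compact (h 0)).measure_lt_top.ne (measure_mono (hsub 0))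
    choose T hT1 hT2 hT3 using happ
    have hlim := hV.tendsto L T (fun N => 1 / ((N:ℝ) + 1)) tendsto_one_div_add_atTop_nhds_zero_nat hT1 hT2
    have := ge_of_tendsto' hlim hT3
    refine lt_of_lt_of_le (mul_pos (pow_pos hc _) (hvol _ ⟨0, hL0 0⟩)) this

end positivity


section bil
variable {X : Type*} [AddCommGroup X] [Module ℝ X] {m : ℕ}

/-- `cons x (cons y w)` -/
def af2 (x y : X) (w : Fin m → X) : Fin (m+2) → X := Fin.cons x (Fin.cons y w)

theorem af2_swap (x y : X) (w : Fin m → X) : af2 x y w ∘ Equiv.swap 0 1 = af2 y x w := by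
  funext k
  refine Fin.cases ?_ (fun k => Fin.cases ?_ (fun k => ?_) k) k
  · simp [af2]
  · simp [af2]
  · have : Equiv.swap (0 : Fin (m+2)) 1 k.succ.succ = k.succ.succ :=
      Equiv.swap_apply_of_ne_of_ne (Fin.succ_ne_zero _) (by
        rw [← Fin.succ_zero_eq_one, Ne, Fin.succ_inj]; exact Fin.succ_ne_zero _)
    rw [comp_apply, this]; simp [af2]

theorem af2_left (x y : X) (w : Fin m → X) : af2 x y w ∘ update id 1 0 = af2 x x w := by
  funext k
  refine Fin.cases ?_ (fun k => Fin.cases ?_ (fun k => ?_) k) k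
  · simp [af2]
  · simp [af2]
  · rw [comp_apply, update_of_ne (by
        rw [← Fin.succ_zero_eq_one, Ne, Fin.succ_inj]; exact Fin.succ_ne_zero _)]
    simp [af2]

theorem af2_right (x y : X) (w : Fin m → X) : af2 x y w ∘ update id 0 1 = af2 y y w := by
  funext k
  refine Fin.cases ?_ (fun k => Fin.cases ?_ (fun k => ?_) k) k
  · simp [af2]
  · simp [af2]
  · simp [af2]

theorem af2_eta (f : Fin (m+2) → X) : af2 (f 0) (f 1) (Fin.tail (Fin.tail f)) = f := by
  funext k
  refine Fin.cases ?_ (fun k => Fin.cases ?_ (fun k => ?_) k) k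
  · simp [af2]
  · simp [af2]
  · simp [af2, Fin.tail]

theorem af2_mem {C : Set X} {x y : X} {w : Fin m → X} (hx : x ∈ C) (hy : y ∈ C) (hw : ∀ k, w k ∈ C) :
    ∀ k, af2 x y w k ∈ C := by
  intro k
  refine Fin.cases ?_ (fun k => Fin.cases ?_ (fun k => ?_) k) k
  · simpa [af2]
  · simpa [af2]
  · simpa [af2] using hw k

/-- the bilinear form in the first two slots -/
noncomputable def afBil (M : MultilinearMap ℝ (fun _ : Fin (m+2) => X) ℝ) (w : Fin m → X) : X →ₗ[ℝ] X →ₗ[ℝ] ℝ :=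
  LinearMap.mk₂ ℝ (fun x y => M (af2 x y w))
    (fun x x' y => by simp only [af2]; rw [MultilinearMap.cons_add])
    (fun c x y => by simp only [af2]; rw [MultilinearMap.cons_smul])
    (fun x y y' => by
      have := MultilinearMap.cons_add (M.curryLeft x) w y y'
      simpa [af2] using this)
    (fun c x y => by
      have := MultilinearMap.cons_smul (M.curryLeft x) w c y
      simpa [af2] using this)

theorem afBil_apply (M : MultilinearMap ℝ (fun _ : Fin (m+2) => X) ℝ) (w : Fin m → X) (x y : X) :
    afBil M w x y = M (af2 x y w) := rfl

theorem afBil_symm (M : MultilinearMap ℝ (fun _ : Fin (m+2) => X) ℝ)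
    (hMs : ∀ (w : Fin (m+2) → X) (σ : Equiv.Perm (Fin (m+2))), M (w ∘ σ) = M w) (w : Fin m → X) (x y : X) :
    afBil M w x y = afBil M w y x := by
  rw [afBil_apply, afBil_apply, ← hMs (af2 x y w) (Equiv.swap 0 1), af2_swap]

/-- discriminant invariance -/
theorem af_disc (B : X →ₗ[ℝ] X →ₗ[ℝ] ℝ) (hs : ∀ x y, B x y = B y x) (x v : X) (T : ℝ)
    (h : B (x + T • v) (x + T • v) * B v v ≤ (B (x + T • v) v)^2) : B x x * B v v ≤ (B x v)^2 := by
  simp only [map_add, map_smul, LinearMap.add_apply, LinearMap.smul_apply, smul_eq_mul] at h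
  rw [hs v x] at h
  nlinarith [h]

theorem af_hyper (B : X →ₗ[ℝ] X →ₗ[ℝ] ℝ) (hs : ∀ x y, B x y = B y x) (v : X) (hvv : 0 < B v v)
    (H : ∀ x, B v v * B x x ≤ (B x v)^2) (x y : X) (hyv : 0 < B y v) (hyy : 0 < B y y) :
    B x x * B y y ≤ (B x y)^2 := by
  set s := B x v / B y v with hs'
  have h1 : B (x - s • y) v = 0 := by
    simp only [map_sub, map_smul, LinearMap.sub_apply, LinearMap.smul_apply, smul_eq_mul, hs']
    field_simp; simp
  have h2 := H (x - s • y)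
  rw [h1] at h2
  have h3 : B (x - s • y) (x - s • y) ≤ 0 := by
    by_contra hcon
    push Not at hcon
    have := mul_pos hvv hcon
    nlinarith
  simp only [map_sub, map_smul, LinearMap.sub_apply, LinearMap.smul_apply, smul_eq_mul] at h3
  rw [hs y x] at h3
  nlinarith [sq_nonneg (B x y - s * B y y), mul_le_mul_of_nonneg_right h3 hyy.le]

end bil

section base
open Set
open scoped Pointwise NNReal RealInnerProductSpace
variable {E : Type} [NormedAddCommGroup E] [InnerProductSpace ℝ E] [FiniteDimensional ℝ E]
  [MeasurableSpace E] [BorelSpace E]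
variable {ι β : Type} [Fintype ι] [Finite β] {F : AfFan E ι β}
variable {m : ℕ} {V : MultilinearMap ℝ≥0 (fun _ : Fin (m+2) => ConvexBody E) ℝ}

theorem af2_const {X : Type*} (v : X) : af2 v v (fun _ : Fin m => v) = fun _ => v := by
  funext k
  refine Fin.cases ?_ (fun k => Fin.cases ?_ (fun k => ?_) k) k <;> simp [af2]

theorem AfFan.base0 (hV : IsMV V) {v : ι → ℝ} (hv : v ∈ F.C)
    (M : MultilinearMap ℝ (fun _ : Fin (m+2) => ι → ℝ) ℝ)
    (hM : ∀ w : Fin (m+2) → ι → ℝ, (∀ k, w k ∈ F.C) → M w = V (fun k => F.body (w k)))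
    (hMs : ∀ (w : Fin (m+2) → ι → ℝ) (σ : Equiv.Perm (Fin (m+2))), M (w ∘ σ) = M w)
    (x : ι → ℝ) (hx : afBil M (fun _ => v) x v = 0) : M (fun _ => v) * afBil M (fun _ => v) x x ≤ 0 := by
  set a0 := M (fun _ => v) with ha0
  set a2 := afBil M (fun _ => v) x x with ha2
  set A := ((m+2).choose 2 : ℝ) * a2 with hA
  have hApos : (0:ℝ) < ((m+2).choose 2 : ℝ) := by exact_mod_cast Nat.choose_pos (by omega)
  let r : ℝ → ℝ := fun t => ∑ k ∈ Finset.range m, (m+2).choose (k+3) * (t^k * M (afTuple (m+2) (k+3) x v))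
  have hr : Continuous r := by fun_prop
  have hg : ∀ t : ℝ, M (fun _ => v + t • x) = a0 + A * t^2 + t^3 * r t := by
    intro t
    have e1 : afTuple (m+2) 2 x v = af2 x x (fun _ => v) := by
      funext k
      refine Fin.cases ?_ (fun k => Fin.cases ?_ (fun k => ?_) k) k <;> simp [af2, afTuple]
    have e2 : afTuple (m+2) 1 x v = af2 x v (fun _ => v) := by
      funext k
      refine Fin.cases ?_ (fun k => Fin.cases ?_ (fun k => ?_) k) k <;> simp [af2, afTuple]
    have e3 : afTuple (m+2) 0 x v = fun _ => v := by funext k; simp [afTuple]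
    rw [af_binomial M hMs, Finset.sum_range_succ', Finset.sum_range_succ', Finset.sum_range_succ']
    simp only [zero_add, Nat.reduceAdd, e1, e2, e3, ← afBil_apply, hx, ← ha0, ← ha2]
    simp only [r, Finset.mul_sum, nsmul_eq_mul, smul_eq_mul, hA]
    have : ∀ k ∈ Finset.range m, ((m+2).choose (k+1+1+1) : ℝ) * (t^(k+1+1+1) * M (afTuple (m+2) (k+1+1+1) x v)) =
        t^3 * (((m+2).choose (k+3) : ℝ) * (t^k * M (afTuple (m+2) (k+3) x v))) := fun k _ => by
      simp only [add_assoc, Nat.reduceAdd]; ring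
    rw [Finset.sum_congr rfl this]
    simp
    ring
  have hbm : ∀ᶠ t in nhds (0:ℝ), M (fun _ => v + t • x) * M (fun _ => v + (-t) • x) ≤ a0^2 := by
    have hc1 : Continuous fun t : ℝ => v + t • x := by fun_prop
    have hc2 : Continuous fun t : ℝ => v + (-t) • x := by fun_prop
    have o1 := (F.isCone.isOpen.preimage hc1).mem_nhds (x := 0) (by simpa using hv)
    have o2 := (F.isCone.isOpen.preimage hc2).mem_nhds (x := 0) (by simpa using hv)
    filter_upwards [o1, o2] with t h1 h2
    have h1 : v + t • x ∈ F.C := h1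
    have h2 : v + (-t) • x ∈ F.C := h2
    rw [ha0, hM _ (fun _ => h1), hM _ (fun _ => h2), hM _ (fun _ => hv), hV.diag, hV.diag, hV.diag,
      body_coe h1, body_coe h2, body_coe hv, ← ENNReal.toReal_mul, ← ENNReal.toReal_pow]
    refine ENNReal.toReal_mono (ENNReal.pow_ne_top (P_compact v).measure_lt_top.ne)
      (bm_mid (P_closed _).measurableSet (P_closed _).measurableSet (P_closed _).measurableSet ?_)
    intro y hy z hz i
    have e1 := hy i
    have e2 := hz i
    rw [inner_smul_right, inner_add_right]
    simp only [Pi.add_apply, Pi.smul_apply, smul_eq_mul] at e1 e2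
    linarith
  let G : ℝ → ℝ := fun t => 2 * a0 * A + (A^2 * t^2 + (a0 + A * t^2) * t * (r t - r (-t)) - t^4 * (r t * r (-t)))
  have hG : Continuous G := by fun_prop
  have hG0 : G 0 = 2 * a0 * A := by simp [G]
  have hGle : ∀ᶠ t in nhdsWithin (0:ℝ) (Ioi 0), G t ≤ 0 := by
    filter_upwards [nhdsWithin_le_nhds hbm, self_mem_nhdsWithin] with t ht ht0
    have ht0 : 0 < t := ht0
    rw [hg, hg] at ht
    have e : (a0 + A * t^2 + t^3 * r t) * (a0 + A * (-t)^2 + (-t)^3 * r (-t)) = a0^2 + t^2 * G t := by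
      simp only [G]; ring
    rw [e] at ht
    have h3 : t^2 * G t ≤ 0 := by linarith
    by_contra hcon
    push Not at hcon
    have := mul_pos (pow_pos ht0 2) hcon
    linarith
  have hlim : Filter.Tendsto G (nhdsWithin 0 (Ioi 0)) (nhds (2 * a0 * A)) := by
    rw [← hG0]; exact (hG.tendsto 0).mono_left nhdsWithin_le_nhds
  have := le_of_tendsto hlim hGle
  by_contra hcon
  push Not at hcon
  have h4 : 2 * a0 * A = 2 * ((m+2).choose 2 : ℝ) * (a0 * a2) := by rw [hA]; ring
  have := mul_pos (mul_pos two_pos hApos) hcon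
  linarith

theorem AfFan.base (hV : IsMV V) {v : ι → ℝ} (hv : v ∈ F.C)
    (M : MultilinearMap ℝ (fun _ : Fin (m+2) => ι → ℝ) ℝ)
    (hM : ∀ w : Fin (m+2) → ι → ℝ, (∀ k, w k ∈ F.C) → M w = V (fun k => F.body (w k)))
    (hMs : ∀ (w : Fin (m+2) → ι → ℝ) (σ : Equiv.Perm (Fin (m+2))), M (w ∘ σ) = M w)
    (hpos : 0 < M (fun _ => v)) (x : ι → ℝ) :
    afBil M (fun _ => v) v v * afBil M (fun _ => v) x x ≤ (afBil M (fun _ => v) x v)^2 := by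
  set B := afBil M (fun _ => v) with hB
  have hs : ∀ x y, B x y = B y x := afBil_symm M hMs _
  have hvv : B v v = M (fun _ => v) := by rw [hB, afBil_apply, af2_const]
  set s := B x v / B v v with hs'
  have hvv0 : 0 < B v v := by rw [hvv]; exact hpos
  have hsv : s * B v v = B x v := by rw [hs']; field_simp
  have h1 : B (x - s • v) v = 0 := by
    simp only [map_sub, map_smul, LinearMap.sub_apply, LinearMap.smul_apply, smul_eq_mul]
    linarith
  have h2 := AfFan.base0 hV hv M hM hMs (x - s • v) h1
  rw [← hvv, ← hB] at h2
  simp only [map_sub, map_smul, LinearMap.sub_apply, LinearMap.smul_apply, smul_eq_mul] at h2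
  rw [hs v x] at h2
  rw [← hsv] at h2 ⊢
  nlinarith [h2]

end base


section main
open Set
open scoped Pointwise NNReal RealInnerProductSpace

def AfIneq (m : ℕ) : Prop := ∀ (E : Type) [NormedAddCommGroup E] [InnerProductSpace ℝ E] [FiniteDimensional ℝ E]
  [MeasurableSpace E] [BorelSpace E], Module.finrank ℝ E = m + 2 →
  ∀ V : MultilinearMap ℝ≥0 (fun _ : Fin (m+2) => ConvexBody E) ℝ, IsMV V →
  ∀ K : Fin (m+2) → ConvexBody E, V (K ∘ update id 1 0) * V (K ∘ update id 0 1) ≤ (V K)^2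

variable {E : Type} [NormedAddCommGroup E] [InnerProductSpace ℝ E] [FiniteDimensional ℝ E]
  [MeasurableSpace E] [BorelSpace E]

theorem af3_swap {X : Type*} {m : ℕ} (x v : X) (w : Fin m → X) :
    (af2 x x (Fin.cons v w : Fin (m+1) → X)) ∘ Equiv.swap 0 2 = (Fin.cons v (af2 x x w) : Fin (m+3) → X) := by
  funext k
  refine Fin.cases ?_ (fun k => Fin.cases ?_ (fun k => Fin.cases ?_ (fun k => ?_) k) k) k
  · rw [comp_apply, Equiv.swap_apply_left]; rfl
  · have : Equiv.swap (0 : Fin (m+3)) 2 (Fin.succ 0) = Fin.succ 0 :=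
      Equiv.swap_apply_of_ne_of_ne (Fin.succ_ne_zero _) (by
        intro h; have := congrArg Fin.val h; simp at this; rw [Nat.mod_eq_of_lt (by omega)] at this; omega)
    rw [comp_apply, this]; rfl
  · have : Fin.succ (Fin.succ (0 : Fin (m+1))) = (2 : Fin (m+3)) := rfl
    rw [comp_apply, this, Equiv.swap_apply_right]; rfl
  · have : Equiv.swap (0 : Fin (m+3)) 2 k.succ.succ.succ = k.succ.succ.succ :=
      Equiv.swap_apply_of_ne_of_ne (Fin.succ_ne_zero _) (by
        intro h; have := congrArg Fin.val h; simp at this; rw [Nat.mod_eq_of_lt (by omega)] at this; omega)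
    rw [comp_apply, this]; rfl

namespace AfFan
variable {ι β : Type} [Fintype ι] [Finite β] {F : AfFan E ι β}

theorem step {m : ℕ} (ih : AfIneq m) (hE : Module.finrank ℝ E = m + 2 + 1)
    {V : MultilinearMap ℝ≥0 (fun _ : Fin (m+1+2) => ConvexBody E) ℝ} (hV : IsMV V)
    {v : ι → ℝ} (hv : v ∈ F.C)
    (M : MultilinearMap ℝ (fun _ : Fin (m+1+2) => ι → ℝ) ℝ) (D : ι → MultilinearMap ℝ (fun _ : Fin (m+2) => ι → ℝ) ℝ)
    (hM : ∀ w : Fin (m+1+2) → ι → ℝ, (∀ k, w k ∈ F.C) → M w = V (fun k => F.body (w k)))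
    (hMs : ∀ (w : Fin (m+1+2) → ι → ℝ) (σ : Equiv.Perm (Fin (m+1+2))), M (w ∘ σ) = M w)
    (hD : ∀ i (w : Fin (m+2) → ι → ℝ), (∀ k, w k ∈ F.C) → D i w = afDesc (m := m+2) V (F.u i) (fun k => F.face i (w k)))
    (hDs : ∀ i (w : Fin (m+2) → ι → ℝ) (σ : Equiv.Perm (Fin (m+2))), D i (w ∘ σ) = D i w)
    (hf : ∀ (x : ι → ℝ) (w : Fin (m+2) → ι → ℝ), (m+3 : ℝ) * M (Fin.cons (n := m+2) x w) = ∑ i, x i * D i w)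
    (hDp : ∀ i (w : Fin (m+2) → ι → ℝ), (∀ k, w k ∈ F.C) → 0 < D i w)
    (hMp : 0 < M (fun _ => v))
    (w : Fin m → ι → ℝ) (hw : ∀ k, w k ∈ F.C) (x : ι → ℝ) :
    afBil M (Fin.cons v w) v v * afBil M (Fin.cons v w) x x ≤ (afBil M (Fin.cons v w) x v)^2 := by
  classical
  have hn : (0:ℝ) < m + 3 := by positivity
  have f1 : ∀ (w : Fin m → ι → ℝ) x y, (m+3 : ℝ) * afBil M (Fin.cons v w) x y = ∑ i, x i * afBil (D i) w y v :=
    fun w x y => hf x (af2 y v w)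
  have f2 : ∀ (w : Fin m → ι → ℝ) x, (m+3 : ℝ) * afBil M (Fin.cons v w) x x = ∑ i, v i * afBil (D i) w x x := by
    intro w x
    rw [afBil_apply, ← hMs _ (Equiv.swap 0 2), af3_swap]
    exact hf v (af2 x x w)
  have f3 : ∀ (w : Fin m → ι → ℝ) x i, (m+3 : ℝ) * afBil M (Fin.cons v w) x (Pi.single i 1) = afBil (D i) w x v := by
    intro w x i
    rw [afBil_symm M hMs, f1, Finset.sum_eq_single i]
    · simp
    · intro j _ hj; rw [Pi.single_eq_of_ne hj, zero_mul]
    · simp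
  have dp : ∀ (w : Fin m → ι → ℝ), (∀ k, w k ∈ F.C) → ∀ i, 0 < afBil (D i) w v v := fun w hw i => hDp i _ (af2_mem hv hv hw)
  have daf : ∀ (w : Fin m → ι → ℝ), (∀ k, w k ∈ F.C) → ∀ i x,
      afBil (D i) w x x * afBil (D i) w v v ≤ (afBil (D i) w x v)^2 := by
    intro w hw i x
    obtain ⟨T, hT, ha⟩ := F.isCone.absorb hv x
    refine af_disc _ (afBil_symm (D i) (hDs i) w) x v T ?_
    set a := x + T • v
    have h1 := ih _ (finrank_afH (F.unit i) hE) _ (afDesc_isMV (m := m+2) hV (F.u i) (F.unit i))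
      (fun k => F.face i (af2 a v w k))
    rw [afBil_apply, afBil_apply, afBil_apply, hD i _ (af2_mem ha ha hw), hD i _ (af2_mem hv hv hw), hD i _ (af2_mem ha hv hw),
      ← af2_left a v w, ← af2_right a v w]
    exact h1
  have hp : ∀ (w : Fin m → ι → ℝ), (∀ k, w k ∈ F.C) → ∀ i, 0 < afBil M (Fin.cons v w) v (Pi.single i 1) := by
    intro w hw i
    have h1 := f3 w v i
    have h2 := dp w hw i
    rw [← h1] at h2
    exact pos_of_mul_pos_right h2 hn.le
  have gap : ∀ (w : Fin m → ι → ℝ), (∀ k, w k ∈ F.C) → ∀ x, afBil M (Fin.cons v w) x x ≤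
      ∑ i, v i / afBil M (Fin.cons v w) v (Pi.single i 1) * (afBil M (Fin.cons v w) x (Pi.single i 1))^2 := by
    intro w hw x
    refine le_of_mul_le_mul_left ?_ hn
    rw [f2, Finset.mul_sum]
    refine Finset.sum_le_sum fun i _ => ?_
    have h1 := daf w hw i x
    have h2 := dp w hw i
    rw [← f3 w v i, ← f3 w x i] at h1
    have h3 := hp w hw i
    have h4 := hv.1 i
    set b := afBil M (Fin.cons v w) v (Pi.single i 1)
    set c := afBil M (Fin.cons v w) x (Pi.single i 1)
    have h5 : afBil (D i) w x x * b ≤ (m+3) * c^2 := by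
      refine le_of_mul_le_mul_left ?_ hn
      calc _ = afBil (D i) w x x * ((m+3) * b) := by ring
        _ ≤ _ := h1
        _ = _ := by ring
    calc v i * afBil (D i) w x x = v i / b * (afBil (D i) w x x * b) := by field_simp
      _ ≤ v i / b * ((m+3) * c^2) := mul_le_mul_of_nonneg_left h5 (by positivity)
      _ = _ := by ring
  have key : ∀ s : Finset (Fin m), ∀ x,
      afBil M (Fin.cons v (s.piecewise w fun _ => v)) v v * afBil M (Fin.cons v (s.piecewise w fun _ => v)) x x
        ≤ (afBil M (Fin.cons v (s.piecewise w fun _ => v)) x v)^2 := by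
    intro s
    induction s using Finset.induction_on with
    | empty =>
      intro x
      have e : (Fin.cons v ((∅ : Finset (Fin m)).piecewise w fun _ => v) : Fin (m+1) → ι → ℝ) = fun _ => v := by
        funext k
        refine Fin.cases ?_ (fun k => ?_) k <;> simp
      rw [e]
      exact base hV hv M hM hMs hMp x
    | insert a s ha ihs =>
      set q : Fin m → ι → ℝ := s.piecewise w fun _ => v with hq
      have hqC : ∀ k, q k ∈ F.C := by
        intro k
        by_cases h : k ∈ s
        · rw [hq, Finset.piecewise_eq_of_mem _ _ _ h]; exact hw k
        · rw [hq, Finset.piecewise_eq_of_notMem _ _ _ h]; exact hv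
      have hqa : q a = v := by rw [hq, Finset.piecewise_eq_of_notMem _ _ _ ha]
      rw [Finset.piecewise_insert]
      let z : ℝ → ι → ℝ := fun t => (1 - t) • v + t • w a
      have hz : ∀ t ∈ Icc (0:ℝ) 1, z t ∈ F.C := by
        intro t ht
        rcases eq_or_lt_of_le ht.1 with h | h
        · simp only [z, ← h]; simpa using hv
        rcases eq_or_lt_of_le ht.2 with h' | h'
        · simp only [z, h']; simpa using hw a
        · exact F.isCone.add _ (F.isCone.smul _ (by linarith) _ hv) _ (F.isCone.smul _ h _ (hw a))
      have hzC : ∀ t ∈ Icc (0:ℝ) 1, ∀ k, update q a (z t) k ∈ F.C := by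
        intro t ht k
        by_cases h : k = a
        · subst h; rw [update_self]; exact hz t ht
        · rw [update_of_ne h]; exact hqC k
      let B : ℝ → (ι → ℝ) →ₗ[ℝ] (ι → ℝ) →ₗ[ℝ] ℝ := fun t => afBil M (Fin.cons v (update q a (z t)))
      have hBt : ∀ t x y, B t x y = (1 - t) * B 0 x y + t * B 1 x y := by
        intro t x y
        have hlin : ∀ c, M (af2 x y (Fin.cons v (update q a c))) = (((M.curryLeft x).curryLeft y).curryLeft v) (update q a c) :=
          fun c => rfl
        simp only [B, afBil_apply, hlin, z]
        simp only [MultilinearMap.map_update_add, MultilinearMap.map_update_smul, smul_eq_mul]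
        ring
      have h0 : update q a (z 0) = q := by simp [z, ← hqa]
      have h1 : z 1 = w a := by simp [z]
      have := af_path B (fun t => afBil_symm M hMs _) (fun x y => by
          rw [show (fun t => B t x y) = fun t => (1 - t) * B 0 x y + t * B 1 x y from funext fun t => hBt t x y]
          fun_prop) v hv.1
        (fun t ht i => hp _ (hzC t ht) i) (fun t ht x => gap _ (hzC t ht) x) (fun x => by
          simp only [B, h0]; exact ihs x)
      intro x
      have := this x
      simp only [B, h1] at this
      exact this
  have := key Finset.univ x
  simpa using this

theorem fan_ineq {m : ℕ} (hE : Module.finrank ℝ E = m + 2)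
    (ih : ∀ m', m = m' + 1 → AfIneq m')
    {V : MultilinearMap ℝ≥0 (fun _ : Fin (m+2) => ConvexBody E) ℝ} (hV : IsMV V)
    (h : Fin (m+2) → ι → ℝ) (hC : ∀ k, h k ∈ F.C) :
    V (fun k => F.body (h (update id 1 0 k))) * V (fun k => F.body (h (update id 0 1 k))) ≤ (V (fun k => F.body (h k)))^2 := by
  obtain ⟨M, D, hM, hMs, hD, hDs, hf, hDp⟩ := package (m := m+1) (Nat.succ_ne_zero m) (afPos (m+1)) hE hV (hC 0)
  set x := h 0
  set y := h 1
  set w := Fin.tail (Fin.tail h) with hw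
  have hwC : ∀ k, w k ∈ F.C := fun k => hC _
  have hh : h = af2 x y w := (af2_eta h).symm
  have hMp : ∀ w : Fin (m+2) → ι → ℝ, (∀ k, w k ∈ F.C) → 0 < M w := by
    intro w hw
    rw [hM w hw]
    exact afPos (m+2) E hE V hV _ fun k => ⟨0, body_interior (hw k)⟩
  rw [← hM _ (fun k => hC _), ← hM _ (fun k => hC _), ← hM _ (fun k => hC _)]
  change M (h ∘ update id 1 0) * M (h ∘ update id 0 1) ≤ M h ^ 2
  rw [hh, af2_left, af2_right, ← afBil_apply, ← afBil_apply, ← afBil_apply]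
  have bp : ∀ a ∈ F.C, ∀ b ∈ F.C, 0 < afBil M w a b := fun a ha b hb => hMp _ (af2_mem ha hb hwC)
  obtain ⟨v, hv, H⟩ : ∃ v ∈ F.C, ∀ x, afBil M w v v * afBil M w x x ≤ (afBil M w x v)^2 := by
    cases m with
    | zero =>
      refine ⟨x, hC 0, fun z => ?_⟩
      have e : w = fun _ => x := Subsingleton.elim _ _
      rw [e]
      exact base hV (hC 0) M hM hMs (hMp _ fun _ => hC 0) z
    | succ m' =>
      refine ⟨w 0, hwC 0, fun z => ?_⟩
      have e : w = Fin.cons (w 0) (Fin.tail w) := (Fin.cons_self_tail w).symm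
      rw [e]
      refine step (ih m' rfl) hE hV (hwC 0) M D hM hMs hD hDs (fun x w => ?_) hDp (hMp _ fun _ => hwC 0) _ (fun k => hwC _) z
      have := hf x w
      push_cast at this
      rw [← this]; ring
  exact af_hyper _ (afBil_symm M hMs w) v (bp v hv v hv) H x y (bp _ (hC 1) _ hv) (bp _ (hC 1) _ (hC 1))

end AfFan

theorem afIneq_of {m : ℕ} (ih : ∀ m', m = m' + 1 → AfIneq m') : AfIneq m := by
  intro E _ _ _ _ _ hE V hV K
  choose a ha using fun k => (K k).nonempty
  set L : Fin (m+2) → ConvexBody E := fun k => K k + afPt (-a k) with hL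
  have hL0 : ∀ k, (0:E) ∈ (L k : Set E) := by
    intro k
    simp only [hL, ConvexBody.coe_add]
    exact ⟨a k, ha k, -a k, rfl, by simp⟩
  have htr : ∀ f : Fin (m+2) → Fin (m+2), V (K ∘ f) = V (L ∘ f) := fun f =>
    (hV.translate (K ∘ f) (fun k => -a (f k))).symm
  have e1 := htr id
  simp only [Function.comp_id] at e1
  rw [htr, htr, e1]
  have happ : ∀ N : ℕ, ∃ T : Fin (m+2) → ConvexBody E, (∀ k, (L k : Set E) ⊆ T k) ∧
      (∀ k, ∀ x ∈ T k, ∃ y ∈ L k, ‖x - y‖ ≤ 1 / ((N:ℝ) + 1)) ∧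
      V (T ∘ update id 1 0) * V (T ∘ update id 0 1) ≤ (V T)^2 := by
    intro N
    have hN : (0:ℝ) < 1 / ((N:ℝ) + 1) := by positivity
    obtain ⟨ι, β, _, _, F, h, hC, hsub, hclose⟩ := af_approx L hL0 hN
    refine ⟨fun k => F.body (h k), fun k => ?_, fun k x hx => ?_, ?_⟩
    · rw [AfFan.body_coe (hC k)]; exact hsub k
    · have hx : x ∈ (F.body (h k) : Set E) := hx
      rw [AfFan.body_coe (hC k)] at hx
      exact hclose k x hx
    · exact AfFan.fan_ineq hE ih hV h hC
  choose T hT1 hT2 hT3 using happ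
  have hlim : ∀ f : Fin (m+2) → Fin (m+2), Filter.Tendsto (fun N => V (T N ∘ f)) Filter.atTop (nhds (V (L ∘ f))) := fun f =>
    hV.tendsto (L ∘ f) (fun N => T N ∘ f) (fun N => 1 / ((N:ℝ) + 1)) tendsto_one_div_add_atTop_nhds_zero_nat
      (fun N k => hT1 N (f k)) (fun N k => hT2 N (f k))
  exact le_of_tendsto_of_tendsto' ((hlim _).mul (hlim _)) ((hlim id).pow 2) hT3

theorem afIneq (m : ℕ) : AfIneq m := by
  induction m with
  | zero => exact afIneq_of fun m' h => absurd h (by omega)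
  | succ m ih =>
    refine afIneq_of fun m' h => ?_
    have : m = m' := by omega
    exact this ▸ ih

end main


/-- Alexandrov–Fenchel inequality: let `V` be the mixed volume on `n`-tuples
of convex bodies in `ℝ^n`, i.e. the symmetric function, multilinear with respect to
Minkowski sum and nonnegative scalar multiplication, whose diagonal values give the
`n`-dimensional Lebesgue volume.  Then for convex bodies `Δ₁, …, Δₙ` (the two
distinguished slots being `i ≠ j`):
`V(Δᵢ in slot j) · V(Δⱼ in slot i) ≤ V(Δ)²`. -/
theorem stmt19 {n : ℕ}
    (V : (Fin n → ConvexBody (EuclideanSpace ℝ (Fin n))) → ℝ)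
    (hsym : ∀ (Δ : Fin n → ConvexBody (EuclideanSpace ℝ (Fin n))) (σ : Equiv.Perm (Fin n)),
      V (Δ ∘ σ) = V Δ)
    (hadd : ∀ (Δ : Fin n → ConvexBody (EuclideanSpace ℝ (Fin n))) (i : Fin n)
      (K K' : ConvexBody (EuclideanSpace ℝ (Fin n))),
      V (update Δ i (K + K')) = V (update Δ i K) + V (update Δ i K'))
    (hsmul : ∀ (Δ : Fin n → ConvexBody (EuclideanSpace ℝ (Fin n))) (i : Fin n)
      (c : ℝ) (hc : 0 ≤ c) (K : ConvexBody (EuclideanSpace ℝ (Fin n))),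
      V (update Δ i (c • K)) = c * V (update Δ i K))
    (hdiag : ∀ K : ConvexBody (EuclideanSpace ℝ (Fin n)),
      V (fun _ => K) = (volume (K : Set (EuclideanSpace ℝ (Fin n)))).toReal)
    (Δ : Fin n → ConvexBody (EuclideanSpace ℝ (Fin n))) (i j : Fin n) (hij : i ≠ j) :
    V (update Δ j (Δ i)) * V (update Δ i (Δ j)) ≤ (V Δ) ^ 2 := by
  match n with
  | 0 => exact i.elim0
  | 1 => exact absurd (Subsingleton.elim i j) hij
  | m + 2 =>
    let W : MultilinearMap NNReal (fun _ : Fin (m+2) => ConvexBody (EuclideanSpace ℝ (Fin (m+2)))) ℝ :=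
      { toFun := V
        map_update_add' := fun {inst} Δ i K K' => by
          rw [Subsingleton.elim inst (instDecidableEqFin (m+2))]
          exact hadd Δ i K K'
        map_update_smul' := fun {inst} Δ i c K => by
          rw [Subsingleton.elim inst (instDecidableEqFin (m+2))]
          exact hsmul Δ i c c.2 K }
    have hW : IsMV W := ⟨hsym, hdiag⟩
    let a : Fin (m+2) := Equiv.swap 0 i 1
    have hai : i ≠ a := fun h => by
      have h2 : Equiv.swap 0 i 0 = Equiv.swap 0 i 1 := by rw [Equiv.swap_apply_left]; exact h
      exact absurd ((Equiv.swap 0 i).injective h2) (by simp)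
    let σ : Equiv.Perm (Fin (m+2)) := (Equiv.swap 0 i).trans (Equiv.swap a j)
    have s0 : σ 0 = i := by
      change Equiv.swap a j (Equiv.swap 0 i 0) = i
      rw [Equiv.swap_apply_left, Equiv.swap_apply_of_ne_of_ne hai hij]
    have s1 : σ 1 = j := by
      change Equiv.swap a j a = j
      rw [Equiv.swap_apply_left]
    have key := afIneq m (EuclideanSpace ℝ (Fin (m+2))) (by simp) W hW (Δ ∘ σ)
    have e1 : (Δ ∘ σ) ∘ update id 1 0 = update Δ j (Δ i) ∘ σ := by
      funext k
      by_cases hk : k = 1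
      · subst hk; simp [s0, s1]
      · have : σ k ≠ j := fun h => hk (σ.injective (h.trans s1.symm))
        simp [hk, this]
    have e2 : (Δ ∘ σ) ∘ update id 0 1 = update Δ i (Δ j) ∘ σ := by
      funext k
      by_cases hk : k = 0
      · subst hk; simp [s0, s1]
      · have : σ k ≠ i := fun h => hk (σ.injective (h.trans s0.symm))
        simp [hk, this]
    rw [e1, e2] at key
    rw [← hsym (update Δ j (Δ i)) σ, ← hsym (update Δ i (Δ j)) σ, ← hsym Δ σ]
    exact key
end
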